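/- Let f be a non-negative real ternary quartic form which defines a smooth complex plane curve. Then f has exactly 15 equivalence classes of signed quadratic representations f = ε₁p₁² + ε₂p₂² + ε₃p₃², where each εᵢ ∈ {+1, −1} and p₁, p₂, p₃ are real quadratic forms, and where two signed representations are equivalent if the triples (p₁,p₂,p₃) and (p₁',p₂',p₃') have the same linear span in the space of real quadratic forms. -/

import Mathlib

/-- The type of signed quadratic representations of `f`, i.e. expressions
`f = ε₁p₁² + ε₂p₂² + ε₃p₃²` with each `εᵢ ∈ {+1, −1}` and `p₁, p₂, p₃` real
quadratic forms. -/
def SignedQuadRep (f : MvPolynomial (Fin 3) ℝ) : Type :=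
  { t : (ℝ × ℝ × ℝ) ×
        (MvPolynomial (Fin 3) ℝ × MvPolynomial (Fin 3) ℝ × MvPolynomial (Fin 3) ℝ) //
      (t.1.1 = 1 ∨ t.1.1 = -1) ∧ (t.1.2.1 = 1 ∨ t.1.2.1 = -1) ∧
      (t.1.2.2 = 1 ∨ t.1.2.2 = -1) ∧
      t.2.1.IsHomogeneous 2 ∧ t.2.2.1.IsHomogeneous 2 ∧ t.2.2.2.IsHomogeneous 2 ∧
      f = MvPolynomial.C t.1.1 * t.2.1 ^ 2 + MvPolynomial.C t.1.2.1 * t.2.2.1 ^ 2 +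
          MvPolynomial.C t.1.2.2 * t.2.2.2 ^ 2 }

/-- Two signed quadratic representations are equivalent when the triples
`(p₁,p₂,p₃)` of quadratic forms have the same linear span in the space of real
quadratic forms. -/
noncomputable def SignedQuadRepSetoid (f : MvPolynomial (Fin 3) ℝ) :
    Setoid (SignedQuadRep f) :=
  Setoid.ker (fun t =>
    Submodule.span ℝ ({t.1.2.1, t.1.2.2.1, t.1.2.2.2} : Set (MvPolynomial (Fin 3) ℝ)))

/-- Coefficient vectors of ternary linear forms, in the order `x, y, z`. -/
abbrev LinearCoeffs := Fin 3 → ℝ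

/-- Coefficient vectors of ternary quadratic forms, in the order `x², y², z², yz, xz, xy`. -/
abbrev ConicCoeffs := Fin 6 → ℝ

/-- Coefficient vectors of ternary quartic forms, in the order
`x⁴, y⁴, z⁴, y³z, yz³, x³z, xz³, x³y, xy³, y²z², x²z², x²y², x²yz, xy²z, xyz²`. -/
abbrev QuarticCoeffs := Fin 15 → ℝ

namespace TernaryQuartic

section

open MvPolynomial

/-- The linear form with given coefficients. -/
noncomputable def linPoly (a : LinearCoeffs) : MvPolynomial (Fin 3) ℝ :=
  C (a 0) * X 0 + C (a 1) * X 1 + C (a 2) * X 2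

/-- The exponents of the quadratic monomials. -/
noncomputable def conicExp : Fin 6 → (Fin 3 →₀ ℕ) := fun i =>
  Finsupp.equivFunOnFinite.symm
    ((![![2, 0, 0], ![0, 2, 0], ![0, 0, 2], ![0, 1, 1], ![1, 0, 1], ![1, 1, 0]] :
      Fin 6 → Fin 3 → ℕ) i)

/-- The exponents of the quartic monomials. -/
noncomputable def quarticExp : Fin 15 → (Fin 3 →₀ ℕ) := fun i =>
  Finsupp.equivFunOnFinite.symm
    ((![![4, 0, 0], ![0, 4, 0], ![0, 0, 4], ![0, 3, 1], ![0, 1, 3], ![3, 0, 1], ![1, 0, 3],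
      ![3, 1, 0], ![1, 3, 0], ![0, 2, 2], ![2, 0, 2], ![2, 2, 0], ![2, 1, 1], ![1, 2, 1],
      ![1, 1, 2]] : Fin 15 → Fin 3 → ℕ) i)

/-- The quadratic form with given coefficients. -/
noncomputable def conicPoly : ConicCoeffs →ₗ[ℝ] MvPolynomial (Fin 3) ℝ :=
  ∑ i, (monomial (conicExp i)).comp (LinearMap.proj i)

/-- The quartic form with given coefficients. -/
noncomputable def quarticPoly : QuarticCoeffs →ₗ[ℝ] MvPolynomial (Fin 3) ℝ :=
  ∑ i, (monomial (quarticExp i)).comp (LinearMap.proj i)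

lemma monomial_equivFunOnFinite (e : Fin 3 → ℕ) (a : ℝ) :
    monomial (Finsupp.equivFunOnFinite.symm e) a =
      C a * (X 0 ^ e 0 * X 1 ^ e 1 * X 2 ^ e 2) := by
  rw [monomial_eq, Finsupp.prod_fintype _ _ (by simp)]
  simp [Fin.prod_univ_three]

lemma conicPoly_eq (q : ConicCoeffs) :
    conicPoly q = C (q 0) * X 0 ^ 2 + C (q 1) * X 1 ^ 2 + C (q 2) * X 2 ^ 2 +
      C (q 3) * (X 1 * X 2) + C (q 4) * (X 0 * X 2) + C (q 5) * (X 0 * X 1) := by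
  simp [conicPoly, conicExp, Fin.sum_univ_succ, monomial_equivFunOnFinite]
  ring

lemma quarticPoly_eq (c : QuarticCoeffs) :
    quarticPoly c = C (c 0) * X 0 ^ 4 + C (c 1) * X 1 ^ 4 + C (c 2) * X 2 ^ 4 +
      C (c 3) * (X 1 ^ 3 * X 2) + C (c 4) * (X 1 * X 2 ^ 3) +
      C (c 5) * (X 0 ^ 3 * X 2) + C (c 6) * (X 0 * X 2 ^ 3) +
      C (c 7) * (X 0 ^ 3 * X 1) + C (c 8) * (X 0 * X 1 ^ 3) +
      C (c 9) * (X 1 ^ 2 * X 2 ^ 2) + C (c 10) * (X 0 ^ 2 * X 2 ^ 2) +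
      C (c 11) * (X 0 ^ 2 * X 1 ^ 2) + C (c 12) * (X 0 ^ 2 * X 1 * X 2) +
      C (c 13) * (X 0 * X 1 ^ 2 * X 2) + C (c 14) * (X 0 * X 1 * X 2 ^ 2) := by
  simp [quarticPoly, quarticExp, Fin.sum_univ_succ, monomial_equivFunOnFinite]
  ring

lemma conicExp_injective : Function.Injective conicExp := by
  refine Finsupp.equivFunOnFinite.symm.injective.comp ?_
  decide

lemma quarticExp_injective : Function.Injective quarticExp := by
  refine Finsupp.equivFunOnFinite.symm.injective.comp ?_
  decide

lemma coeff_conicPoly (q : ConicCoeffs) (i : Fin 6) : coeff (conicExp i) (conicPoly q) = q i := by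
  simp [conicPoly, coeff_sum, coeff_monomial, conicExp_injective.eq_iff]

lemma coeff_quarticPoly (c : QuarticCoeffs) (i : Fin 15) :
    coeff (quarticExp i) (quarticPoly c) = c i := by
  simp [quarticPoly, coeff_sum, coeff_monomial, quarticExp_injective.eq_iff]

lemma conicPoly_injective : Function.Injective conicPoly := fun q r h => by
  ext i; rw [← coeff_conicPoly q, h, coeff_conicPoly]

lemma quarticPoly_injective : Function.Injective quarticPoly := fun q r h => by
  ext i; rw [← coeff_quarticPoly q, h, coeff_quarticPoly]

lemma isHomogeneous_conicPoly (q : ConicCoeffs) : (conicPoly q).IsHomogeneous 2 := by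
  simp only [conicPoly, LinearMap.sum_apply, LinearMap.comp_apply, LinearMap.proj_apply]
  refine IsHomogeneous.sum _ _ _ fun i _ => isHomogeneous_monomial _ ?_
  rw [Finsupp.degree_eq_sum]
  fin_cases i <;> simp [conicExp, Fin.sum_univ_three]

lemma exists_conicExp_eq (m : Fin 3 →₀ ℕ) (hm : m.degree = 2) : ∃ i, conicExp i = m := by
  rw [Finsupp.degree_eq_sum, Fin.sum_univ_three] at hm
  obtain ⟨e, rfl⟩ := Finsupp.equivFunOnFinite.symm.surjective m
  simp only [Finsupp.equivFunOnFinite_symm_apply_apply] at hm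
  have he : e = ![e 0, e 1, e 2] := by ext i; fin_cases i <;> rfl
  simp only [conicExp, EmbeddingLike.apply_eq_iff_eq]
  have key : ∀ a < 3, ∀ b < 3, ∀ c < 3, a + b + c = 2 → ∃ i : Fin 6,
      (![![2, 0, 0], ![0, 2, 0], ![0, 0, 2], ![0, 1, 1], ![1, 0, 1], ![1, 1, 0]] :
      Fin 6 → Fin 3 → ℕ) i = ![a, b, c] := by decide
  rw [he]
  exact key _ (by omega) _ (by omega) _ (by omega) hm

lemma exists_quarticExp_eq (m : Fin 3 →₀ ℕ) (hm : m.degree = 4) : ∃ i, quarticExp i = m := by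
  rw [Finsupp.degree_eq_sum, Fin.sum_univ_three] at hm
  obtain ⟨e, rfl⟩ := Finsupp.equivFunOnFinite.symm.surjective m
  simp only [Finsupp.equivFunOnFinite_symm_apply_apply] at hm
  have he : e = ![e 0, e 1, e 2] := by ext i; fin_cases i <;> rfl
  simp only [quarticExp, EmbeddingLike.apply_eq_iff_eq]
  have key : ∀ a < 5, ∀ b < 5, ∀ c < 5, a + b + c = 4 → ∃ i : Fin 15,
      (![![4, 0, 0], ![0, 4, 0], ![0, 0, 4], ![0, 3, 1], ![0, 1, 3], ![3, 0, 1], ![1, 0, 3],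
      ![3, 1, 0], ![1, 3, 0], ![0, 2, 2], ![2, 0, 2], ![2, 2, 0], ![2, 1, 1], ![1, 2, 1],
      ![1, 1, 2]] : Fin 15 → Fin 3 → ℕ) i = ![a, b, c] := by
    set_option maxRecDepth 10000 in decide
  rw [he]
  exact key _ (by omega) _ (by omega) _ (by omega) hm

lemma exists_conicPoly_eq {p : MvPolynomial (Fin 3) ℝ} (hp : p.IsHomogeneous 2) :
    ∃ q, conicPoly q = p := by
  refine ⟨fun i => coeff (conicExp i) p, ?_⟩
  ext m
  by_cases hm : m.degree = 2
  · obtain ⟨i, rfl⟩ := exists_conicExp_eq m hm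
    rw [coeff_conicPoly]
  · rw [(isHomogeneous_conicPoly _).coeff_eq_zero hm, hp.coeff_eq_zero hm]

lemma isHomogeneous_quarticPoly (q : QuarticCoeffs) : (quarticPoly q).IsHomogeneous 4 := by
  simp only [quarticPoly, LinearMap.sum_apply, LinearMap.comp_apply, LinearMap.proj_apply]
  refine IsHomogeneous.sum _ _ _ fun i _ => isHomogeneous_monomial _ ?_
  rw [Finsupp.degree_eq_sum]
  fin_cases i <;> simp [quarticExp, Fin.sum_univ_three]

lemma exists_quarticPoly_eq {p : MvPolynomial (Fin 3) ℝ} (hp : p.IsHomogeneous 4) :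
    ∃ q, quarticPoly q = p := by
  refine ⟨fun i => coeff (quarticExp i) p, ?_⟩
  ext m
  by_cases hm : m.degree = 4
  · obtain ⟨i, rfl⟩ := exists_quarticExp_eq m hm
    rw [coeff_quarticPoly]
  · rw [(isHomogeneous_quarticPoly _).coeff_eq_zero hm, hp.coeff_eq_zero hm]

/-- The product of two linear forms, on coefficients. -/
def linMul : LinearCoeffs →ₗ[ℝ] LinearCoeffs →ₗ[ℝ] ConicCoeffs :=
  LinearMap.mk₂ ℝ (fun a b => ![a 0 * b 0, a 1 * b 1, a 2 * b 2, a 1 * b 2 + a 2 * b 1,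
      a 0 * b 2 + a 2 * b 0, a 0 * b 1 + a 1 * b 0])
    (fun _ _ _ => by ext i; fin_cases i <;> simp <;> ring)
    (fun _ _ _ => by ext i; fin_cases i <;> simp <;> ring)
    (fun _ _ _ => by ext i; fin_cases i <;> simp <;> ring)
    (fun _ _ _ => by ext i; fin_cases i <;> simp <;> ring)

/-- The product of two quadratic forms, on coefficients. -/
def conicMul : ConicCoeffs →ₗ[ℝ] ConicCoeffs →ₗ[ℝ] QuarticCoeffs :=
  LinearMap.mk₂ ℝ (fun q r => ![q 0 * r 0, q 1 * r 1, q 2 * r 2,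
      q 1 * r 3 + q 3 * r 1, q 2 * r 3 + q 3 * r 2, q 0 * r 4 + q 4 * r 0, q 2 * r 4 + q 4 * r 2,
      q 0 * r 5 + q 5 * r 0, q 1 * r 5 + q 5 * r 1, q 1 * r 2 + q 2 * r 1 + q 3 * r 3,
      q 0 * r 2 + q 2 * r 0 + q 4 * r 4, q 0 * r 1 + q 1 * r 0 + q 5 * r 5,
      q 0 * r 3 + q 3 * r 0 + q 4 * r 5 + q 5 * r 4, q 1 * r 4 + q 4 * r 1 + q 3 * r 5 + q 5 * r 3,
      q 2 * r 5 + q 5 * r 2 + q 3 * r 4 + q 4 * r 3])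
    (fun _ _ _ => by ext i; fin_cases i <;> simp <;> ring)
    (fun _ _ _ => by ext i; fin_cases i <;> simp <;> ring)
    (fun _ _ _ => by ext i; fin_cases i <;> simp <;> ring)
    (fun _ _ _ => by ext i; fin_cases i <;> simp <;> ring)

lemma linMul_apply (a b : LinearCoeffs) :
    linMul a b = ![a 0 * b 0, a 1 * b 1, a 2 * b 2, a 1 * b 2 + a 2 * b 1,
      a 0 * b 2 + a 2 * b 0, a 0 * b 1 + a 1 * b 0] := rfl

lemma conicMul_apply (q r : ConicCoeffs) :
    conicMul q r = ![q 0 * r 0, q 1 * r 1, q 2 * r 2,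
      q 1 * r 3 + q 3 * r 1, q 2 * r 3 + q 3 * r 2, q 0 * r 4 + q 4 * r 0, q 2 * r 4 + q 4 * r 2,
      q 0 * r 5 + q 5 * r 0, q 1 * r 5 + q 5 * r 1, q 1 * r 2 + q 2 * r 1 + q 3 * r 3,
      q 0 * r 2 + q 2 * r 0 + q 4 * r 4, q 0 * r 1 + q 1 * r 0 + q 5 * r 5,
      q 0 * r 3 + q 3 * r 0 + q 4 * r 5 + q 5 * r 4, q 1 * r 4 + q 4 * r 1 + q 3 * r 5 + q 5 * r 3,
      q 2 * r 5 + q 5 * r 2 + q 3 * r 4 + q 4 * r 3] := rfl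

lemma conicMul_comm (q r : ConicCoeffs) : conicMul q r = conicMul r q := by
  ext i; fin_cases i <;> simp [conicMul_apply] <;> ring

lemma conicPoly_linMul (a b : LinearCoeffs) :
    conicPoly (linMul a b) = linPoly a * linPoly b := by
  simp only [conicPoly_eq, linPoly, linMul_apply]
  simp
  ring

lemma quarticPoly_conicMul (q r : ConicCoeffs) :
    quarticPoly (conicMul q r) = conicPoly q * conicPoly r := by
  simp only [conicPoly_eq, quarticPoly_eq, conicMul_apply]
  simp
  ring

/-- Three quadratic forms without a common zero in the complex projective plane. -/
def BasePointFree (p : Fin 3 → ConicCoeffs) : Prop :=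
  ∀ x : Fin 3 → ℂ, x ≠ 0 → ∃ i, aeval x (conicPoly (p i)) ≠ 0

lemma X_mem_of_zeroLocus_subset (P : Ideal (MvPolynomial (Fin 3) ℝ)) [P.IsPrime]
    (h : ∀ x ∈ zeroLocus ℂ P, x = 0) (i : Fin 3) : X i ∈ P := by
  rw [← IsPrime.vanishingIdeal_zeroLocus (K := ℂ) P, mem_vanishingIdeal_iff]
  intro x hx
  simp [h x hx]

lemma BasePointFree.X_mem {p : Fin 3 → ConicCoeffs} (hp : BasePointFree p)
    (P : Ideal (MvPolynomial (Fin 3) ℝ)) [P.IsPrime] (h : ∀ i, conicPoly (p i) ∈ P)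
    (i : Fin 3) : X i ∈ P := by
  refine X_mem_of_zeroLocus_subset P (fun x hx => ?_) i
  by_contra hne
  obtain ⟨j, hj⟩ := hp x hne
  exact hj (hx _ (h j))

lemma not_X_zero_dvd_X_one : ¬ (X 0 : MvPolynomial (Fin 3) ℝ) ∣ X 1 := by
  rw [X_dvd_X]
  simp

lemma BasePointFree.not_dvd {p : Fin 3 → ConicCoeffs} (hp : BasePointFree p)
    {q : MvPolynomial (Fin 3) ℝ} (hq : Prime q) : ¬ ∀ i, q ∣ conicPoly (p i) := by
  intro h
  have : (Ideal.span {q}).IsPrime := (Ideal.span_singleton_prime hq.ne_zero).2 hq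
  have hX := hp.X_mem (Ideal.span {q}) (fun i => Ideal.mem_span_singleton.2 (h i))
  have h0 := Ideal.mem_span_singleton.1 (hX 0)
  have h1 := Ideal.mem_span_singleton.1 (hX 1)
  have hX0 : Prime (X 0 : MvPolynomial (Fin 3) ℝ) := X_prime
  exact not_X_zero_dvd_X_one (((hq.associated_of_dvd hX0 h0).dvd_iff_dvd_left).1 h1)

lemma BasePointFree.exists_isRelPrime {p : Fin 3 → ConicCoeffs} (hp : BasePointFree p)
    (h0 : conicPoly (p 0) ≠ 0) :
    ∃ t : ℝ, IsRelPrime (conicPoly (p 0)) (conicPoly (p 1 + t • p 2)) := by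
  classical
  by_contra! hcon
  have key : ∀ t : ℝ, ∃ q : (UniqueFactorizationMonoid.factors (conicPoly (p 0))).toFinset,
      (q : MvPolynomial (Fin 3) ℝ) ∣ conicPoly (p 1 + t • p 2) := by
    intro t
    have := hcon t
    rw [UniqueFactorizationMonoid.isRelPrime_iff_no_prime_factors h0] at this
    push Not at this
    obtain ⟨d, hd0, hd1, hd⟩ := this
    obtain ⟨q, hq, hdq⟩ := UniqueFactorizationMonoid.exists_mem_factors_of_dvd h0
      hd.irreducible hd0
    exact ⟨⟨q, Multiset.mem_toFinset.2 hq⟩, hdq.symm.dvd.trans hd1⟩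
  choose F hF using key
  obtain ⟨t, t', htt, hFt⟩ := Finite.exists_ne_map_eq_of_infinite F
  have hq : Prime ((F t : _) : MvPolynomial (Fin 3) ℝ) :=
    UniqueFactorizationMonoid.prime_of_factor _ (Multiset.mem_toFinset.1 (F t).2)
  have h1 := hF t
  have h2 := hF t'
  rw [← hFt] at h2
  simp only [map_add, map_smul, smul_eq_C_mul] at h1 h2
  have h3 : ((F t : _) : MvPolynomial (Fin 3) ℝ) ∣ conicPoly (p 2) := by
    have h4 := (dvd_sub h1 h2).mul_left (C (t - t')⁻¹)
    have h5 : C (t - t')⁻¹ * (conicPoly (p 1) + C t * conicPoly (p 2) -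
        (conicPoly (p 1) + C t' * conicPoly (p 2))) = conicPoly (p 2) := by
      have : (C (t - t')⁻¹ * (C t - C t') : MvPolynomial (Fin 3) ℝ) = 1 := by
        rw [← C_sub, ← C_mul, inv_mul_cancel₀ (sub_ne_zero.2 htt), C_1]
      linear_combination conicPoly (p 2) * this
    rwa [h5] at h4
  have h4 : ((F t : _) : MvPolynomial (Fin 3) ℝ) ∣ conicPoly (p 1) :=
    (dvd_add_left (h3.mul_left _)).1 h1
  refine hp.not_dvd hq fun i => ?_
  fin_cases i
  · exact UniqueFactorizationMonoid.dvd_of_mem_factors (Multiset.mem_toFinset.1 (F t).2)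
  · exact h4
  · exact h3

lemma isPrime_span_X_pair : (Ideal.span {X 0, X 1} : Ideal (MvPolynomial (Fin 3) ℝ)).IsPrime := by
  let φ : MvPolynomial (Fin 3) ℝ →ₐ[ℝ] MvPolynomial (Fin 3) ℝ := aeval ![0, 0, X 2]
  have hφ : (Ideal.Quotient.mkₐ ℝ (Ideal.span {X 0, X 1})).comp φ =
      Ideal.Quotient.mkₐ ℝ (Ideal.span {X 0, X 1}) := by
    ext i
    fin_cases i
    · simpa [φ] using (Ideal.Quotient.eq_zero_iff_mem.2 (Ideal.subset_span (by simp))).symm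
    · simpa [φ] using (Ideal.Quotient.eq_zero_iff_mem.2 (Ideal.subset_span (by simp))).symm
    · simp [φ]
  have : (Ideal.span {X 0, X 1} : Ideal (MvPolynomial (Fin 3) ℝ)) = RingHom.ker φ := by
    apply le_antisymm
    · rw [Ideal.span_le]
      rintro x (rfl | rfl) <;> simp [φ, RingHom.mem_ker]
    · intro x hx
      have h1 := DFunLike.congr_fun hφ x
      rw [RingHom.mem_ker] at hx
      rw [AlgHom.comp_apply, hx, map_zero] at h1
      exact Ideal.Quotient.eq_zero_iff_mem.1 h1.symm
  rw [this]
  exact RingHom.ker_isPrime φ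

/-- The coordinate ring of a complete intersection of two plane curves, one of which avoids the
point `(0 : 0 : 1)`, has positive depth at the irrelevant ideal. -/
lemma mem_span_pair_of_X_mul_mem {A B w : MvPolynomial (Fin 3) ℝ}
    (hA : A ∉ Ideal.span {X 0, X 1}) (hAB : IsRelPrime A B)
    (h0 : X 0 * w ∈ Ideal.span {A, B}) (h1 : X 1 * w ∈ Ideal.span {A, B}) :
    w ∈ Ideal.span {A, B} := by
  have hA0 : A ≠ 0 := by rintro rfl; simp at hA
  obtain ⟨a, b, hab⟩ := Ideal.mem_span_pair.1 h0
  obtain ⟨c, d, hcd⟩ := Ideal.mem_span_pair.1 h1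
  have h2 : A * (X 1 * a - X 0 * c) = B * (X 0 * d - X 1 * b) := by
    linear_combination X 1 * hab - X 0 * hcd
  obtain ⟨e, he⟩ := hAB.dvd_of_dvd_mul_left ⟨_, h2.symm⟩
  have h3 : X 1 * a - X 0 * c = B * e := by
    apply mul_left_cancel₀ hA0; rw [h2, he]; ring
  have hmem : A * e ∈ Ideal.span {X 0, X 1} := by
    rw [← he]
    exact Ideal.mem_span_pair.2 ⟨d, -b, by ring⟩
  obtain ⟨s, t, rfl⟩ := Ideal.mem_span_pair.1
    ((isPrime_span_X_pair.mem_or_mem hmem).resolve_left hA)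
  have hX0 : (X 0 : MvPolynomial (Fin 3) ℝ) ≠ 0 := X_ne_zero 0
  have hP0 : Prime (X 0 : MvPolynomial (Fin 3) ℝ) := X_prime
  obtain ⟨k, hk⟩ : (X 0 : MvPolynomial (Fin 3) ℝ) ∣ a - t * B :=
    (hP0.dvd_or_dvd (show X 0 ∣ X 1 * (a - t * B) from
      ⟨c + s * B, by linear_combination h3⟩)).resolve_left not_X_zero_dvd_X_one
  obtain ⟨k', hk'⟩ : (X 0 : MvPolynomial (Fin 3) ℝ) ∣ b + t * A :=
    (hP0.dvd_or_dvd (show X 0 ∣ X 1 * (b + t * A) from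
      ⟨d - s * A, by linear_combination -he⟩)).resolve_left not_X_zero_dvd_X_one
  refine Ideal.mem_span_pair.2 ⟨k, k', mul_left_cancel₀ hX0 ?_⟩
  linear_combination hab - A * hk - B * hk'

lemma BasePointFree.mem_span_pair_of_mul_mem {p : Fin 3 → ConicCoeffs} (hp : BasePointFree p)
    (hA : conicPoly (p 0) ∉ Ideal.span {X 0, X 1})
    (hAB : IsRelPrime (conicPoly (p 0)) (conicPoly (p 1))) {v : MvPolynomial (Fin 3) ℝ}
    (hv : conicPoly (p 2) * v ∈ Ideal.span {conicPoly (p 0), conicPoly (p 1)}) :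
    v ∈ Ideal.span {conicPoly (p 0), conicPoly (p 1)} := by
  set J := Ideal.span {conicPoly (p 0), conicPoly (p 1)} with hJ
  by_contra hcon
  obtain ⟨P, hP, hle⟩ := exists_le_isAssociatedPrime_of_isNoetherianRing
    (MvPolynomial (Fin 3) ℝ) (Ideal.Quotient.mk J v) (by rwa [Ne, Ideal.Quotient.eq_zero_iff_mem])
  rw [isAssociatedPrime_iff] at hP
  obtain ⟨hPp, y, rfl⟩ := hP
  obtain ⟨w, rfl⟩ := Ideal.Quotient.mk_surjective y
  have hmem : ∀ r u : MvPolynomial (Fin 3) ℝ,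
      r ∈ (⊥ : Submodule (MvPolynomial (Fin 3) ℝ) (MvPolynomial (Fin 3) ℝ ⧸ J)).colon
        {Ideal.Quotient.mk J u} ↔ r * u ∈ J := by
    intro r u
    rw [Submodule.mem_colon_singleton, Submodule.mem_bot]
    change Ideal.Quotient.mk J (r * u) = 0 ↔ _
    rw [Ideal.Quotient.eq_zero_iff_mem]
  have hX := hp.X_mem ((⊥ : Submodule (MvPolynomial (Fin 3) ℝ)
    (MvPolynomial (Fin 3) ℝ ⧸ J)).colon {Ideal.Quotient.mk J w}) (by
      intro i
      fin_cases i
      · exact (hmem _ _).2 (J.mul_mem_right _ (Ideal.subset_span (by simp)))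
      · exact (hmem _ _).2 (J.mul_mem_right _ (Ideal.subset_span (by simp)))
      · exact hle ((hmem _ _).2 hv))
  have hw : w ∈ J := mem_span_pair_of_X_mul_mem hA hAB ((hmem _ _).1 (hX 0)) ((hmem _ _).1 (hX 1))
  exact hPp.ne_top ((Ideal.eq_top_iff_one _).2 ((hmem _ _).2 (by simpa using hw)))

lemma homogeneousComponent_mul_of_isHomogeneous {A : MvPolynomial (Fin 3) ℝ} {n : ℕ}
    (hA : A.IsHomogeneous n) (α : MvPolynomial (Fin 3) ℝ) :
    homogeneousComponent n (α * A) = C (coeff 0 α) * A := by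
  conv_lhs => rw [← sum_homogeneousComponent α, Finset.sum_mul, map_sum]
  rw [Finset.sum_eq_single 0]
  · rw [homogeneousComponent_zero, homogeneousComponent_of_mem ((isHomogeneous_C _ _).mul hA)]
    simp
  · intro i _ hi
    rw [homogeneousComponent_of_mem ((homogeneousComponent_isHomogeneous i α).mul hA)]
    simp [hi]
  · simp

lemma eq_C_mul_of_isHomogeneous {A h e : MvPolynomial (Fin 3) ℝ} {n : ℕ}
    (hA : A.IsHomogeneous n) (hh : h.IsHomogeneous n) (he : h = e * A) :
    h = C (coeff 0 e) * A := by
  rw [← homogeneousComponent_mul_of_isHomogeneous hA, ← he, homogeneousComponent_of_mem hh]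
  exact (if_pos rfl).symm

/-- The map `(h₀, h₁, h₂) ↦ p₀ h₀ + p₁ h₁ + p₂ h₂`. -/
def combine (p : Fin 3 → ConicCoeffs) : (Fin 3 → ConicCoeffs) →ₗ[ℝ] QuarticCoeffs :=
  ∑ i, (conicMul (p i)).comp (LinearMap.proj i)

lemma combine_apply (p h : Fin 3 → ConicCoeffs) :
    combine p h = conicMul (p 0) (h 0) + conicMul (p 1) (h 1) + conicMul (p 2) (h 2) := by
  simp [combine, Fin.sum_univ_three]

/-- The Koszul syzygies. -/
def koszul (p : Fin 3 → ConicCoeffs) : (Fin 3 → ℝ) →ₗ[ℝ] (Fin 3 → ConicCoeffs) where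
  toFun t := ![t 2 • p 1 - t 1 • p 2, t 0 • p 2 - t 2 • p 0, t 1 • p 0 - t 0 • p 1]
  map_add' s t := by ext i j; fin_cases i <;> simp <;> ring
  map_smul' c t := by ext i j; fin_cases i <;> simp <;> ring

lemma koszul_apply (p : Fin 3 → ConicCoeffs) (t : Fin 3 → ℝ) :
    koszul p t = ![t 2 • p 1 - t 1 • p 2, t 0 • p 2 - t 2 • p 0, t 1 • p 0 - t 0 • p 1] := rfl

lemma combine_koszul (p : Fin 3 → ConicCoeffs) (t : Fin 3 → ℝ) : combine p (koszul p t) = 0 := by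
  rw [combine_apply]
  simp [koszul_apply, conicMul_comm (p 1) (p 0), conicMul_comm (p 2) (p 0),
    conicMul_comm (p 2) (p 1)]

lemma surjective_combine_of_ker_le {p : Fin 3 → ConicCoeffs}
    (h : LinearMap.ker (combine p) ≤ LinearMap.range (koszul p)) :
    Function.Surjective (combine p) := by
  rw [← LinearMap.range_eq_top]
  apply Submodule.eq_top_of_finrank_eq
  have h1 := LinearMap.finrank_range_add_finrank_ker (combine p)
  have h2 := Submodule.finrank_mono h
  have h3 := LinearMap.finrank_range_le (koszul p)
  have h4 := Submodule.finrank_le (LinearMap.range (combine p))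
  simp only [Module.finrank_pi_fintype, Module.finrank_self,
    Finset.sum_const, Finset.card_univ, Fintype.card_fin, smul_eq_mul] at h1 h2 h3 h4 ⊢
  omega

lemma BasePointFree.surjective_combine_of_isRelPrime {p : Fin 3 → ConicCoeffs}
    (hp : BasePointFree p) (hA : conicPoly (p 0) ∉ Ideal.span {X 0, X 1})
    (hAB : IsRelPrime (conicPoly (p 0)) (conicPoly (p 1))) :
    Function.Surjective (combine p) := by
  apply surjective_combine_of_ker_le
  intro h hh
  have hA0 : conicPoly (p 0) ≠ 0 := by intro h; simp [h] at hA
  rw [LinearMap.mem_ker, combine_apply] at hh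
  have hh' := congrArg quarticPoly hh
  simp only [map_add, quarticPoly_conicMul, map_zero] at hh'
  have h2 := hp.mem_span_pair_of_mul_mem hA hAB (v := conicPoly (h 2))
    (Ideal.mem_span_pair.2 ⟨-conicPoly (h 0), -conicPoly (h 1), by linear_combination -hh'⟩)
  obtain ⟨α, β, hαβ⟩ := Ideal.mem_span_pair.1 h2
  set c := coeff 0 α
  set d := coeff 0 β
  have h3 : h 2 = c • p 0 + d • p 1 := by
    apply conicPoly_injective
    have := congrArg (homogeneousComponent 2) hαβ
    rw [map_add, homogeneousComponent_mul_of_isHomogeneous (isHomogeneous_conicPoly _),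
      homogeneousComponent_mul_of_isHomogeneous (isHomogeneous_conicPoly _),
      homogeneousComponent_of_mem (isHomogeneous_conicPoly _)] at this
    simpa [smul_eq_C_mul] using this.symm
  have h4 : conicPoly (p 0) * conicPoly (h 0 + c • p 2) =
      conicPoly (p 1) * (-conicPoly (h 1 + d • p 2)) := by
    rw [h3] at hh'
    simp only [map_add, map_smul, smul_eq_C_mul] at hh' ⊢
    linear_combination hh'
  obtain ⟨e, he⟩ := hAB.dvd_of_dvd_mul_left ⟨_, h4.symm⟩
  have h5 : conicPoly (h 0 + c • p 2) = e * conicPoly (p 1) := by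
    apply mul_left_cancel₀ hA0; rw [h4, he]; ring
  have h6 : conicPoly (h 1 + d • p 2) = (-e) * conicPoly (p 0) := by linear_combination -he
  have h7 := eq_C_mul_of_isHomogeneous (isHomogeneous_conicPoly _) (isHomogeneous_conicPoly _) h5
  have h8 := eq_C_mul_of_isHomogeneous (isHomogeneous_conicPoly _) (isHomogeneous_conicPoly _) h6
  rw [← smul_eq_C_mul, ← map_smul] at h7 h8
  have h9 := conicPoly_injective h7
  have h10 := conicPoly_injective h8
  rw [coeff_neg] at h10
  refine ⟨![-d, c, coeff 0 e], ?_⟩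
  rw [koszul_apply]
  ext i j
  have h9j := congrFun h9 j
  have h10j := congrFun h10 j
  have h3j := congrFun h3 j
  fin_cases i <;> simp at h9j h10j h3j ⊢ <;> linarith

lemma combine_eq_sum (p h : Fin 3 → ConicCoeffs) : combine p h = ∑ i, conicMul (p i) (h i) := by
  simp [combine]

lemma BasePointFree.surjective_combine {p : Fin 3 → ConicCoeffs} (hp : BasePointFree p) :
    Function.Surjective (combine p) := by
  obtain ⟨j, hj⟩ := hp ![0, 0, 1] (by intro h; simpa using congrFun h 2)
  have hj' : conicPoly (p j) ∉ Ideal.span {X 0, X 1} := by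
    intro h
    obtain ⟨a, b, hab⟩ := Ideal.mem_span_pair.1 h
    apply hj
    rw [← hab]
    simp
  let σ : Equiv.Perm (Fin 3) := Equiv.swap 0 j
  let p' : Fin 3 → ConicCoeffs := p ∘ σ
  have hp' : BasePointFree p' := fun x hx => by
    obtain ⟨i, hi⟩ := hp x hx
    exact ⟨σ.symm i, by simpa [p'] using hi⟩
  have hp'0 : conicPoly (p' 0) ∉ Ideal.span {X 0, X 1} := by simpa [p', σ] using hj'
  obtain ⟨t, ht⟩ := hp'.exists_isRelPrime (by intro h; simp [h] at hp'0)
  let q : Fin 3 → ConicCoeffs := ![p' 0, p' 1 + t • p' 2, p' 2]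
  have hq : BasePointFree q := fun x hx => by
    by_contra! hcon
    have h0 := hcon 0
    have h1 := hcon 1
    have h2 := hcon 2
    simp only [q, Matrix.cons_val] at h0 h1 h2
    rw [map_add, map_smul, map_add, map_smul, h2, smul_zero, add_zero] at h1
    obtain ⟨i, hi⟩ := hp' x hx
    fin_cases i <;> contradiction
  have hs := hq.surjective_combine_of_isRelPrime (by simpa [q] using hp'0) (by simpa [q] using ht)
  intro c
  obtain ⟨h, rfl⟩ := hs c
  let h' : Fin 3 → ConicCoeffs := ![h 0, h 1, h 2 + t • h 1]
  refine ⟨h' ∘ σ.symm, ?_⟩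
  have : combine p (h' ∘ σ.symm) = combine p' h' := by
    rw [combine_eq_sum, combine_eq_sum, ← Equiv.sum_comp σ]
    simp [p']
  rw [this, combine_apply, combine_apply]
  simp [h', q]
  abel

end

section

open MvPolynomial Matrix

lemma linearIndependent_of_surjective {p : Fin 3 → ConicCoeffs}
    (hp : Function.Surjective (combine p)) : LinearIndependent ℝ p := by
  rw [Fintype.linearIndependent_iff]
  intro g hg
  by_contra! hne
  obtain ⟨i₀, hi₀⟩ := hne
  let φ : ConicCoeffs →ₗ[ℝ] (Fin 3 → ConicCoeffs) := LinearMap.pi fun i => g i • LinearMap.id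
  have hφ : LinearMap.range φ ≤ LinearMap.ker (combine p) := by
    rintro _ ⟨u, rfl⟩
    rw [LinearMap.mem_ker, combine_eq_sum]
    have := congrArg (fun v => conicMul v u) hg
    simpa [φ] using this
  have hinj : Function.Injective φ := by
    intro u v huv
    have := congrFun huv i₀
    simpa [φ, hi₀] using this
  have h1 := LinearMap.finrank_range_add_finrank_ker (combine p)
  have h2 := Submodule.finrank_mono hφ
  rw [LinearMap.finrank_range_of_inj hinj] at h2
  rw [LinearMap.range_eq_top.2 hp, finrank_top] at h1
  simp only [Module.finrank_pi_fintype, Module.finrank_self,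
    Finset.sum_const, Finset.card_univ, Fintype.card_fin, smul_eq_mul] at h1 h2
  omega

lemma koszul_injective {p : Fin 3 → ConicCoeffs} (hp : LinearIndependent ℝ p) :
    Function.Injective (koszul p) := by
  rw [← LinearMap.ker_eq_bot, LinearMap.ker_eq_bot']
  intro t ht
  have h0 := congrFun ht 0
  have h1 := congrFun ht 1
  rw [koszul_apply] at h0 h1
  have k0 := Fintype.linearIndependent_iff.1 hp ![0, t 2, -t 1]
    (by simpa [Fin.sum_univ_three, sub_eq_add_neg] using h0)
  have k1 := Fintype.linearIndependent_iff.1 hp ![-t 2, 0, t 0]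
    (by simp [Fin.sum_univ_three] at h1 ⊢; rw [← h1]; abel)
  ext i
  fin_cases i
  · simpa using k1 2
  · simpa using k0 2
  · simpa using k0 1

lemma exists_koszul_eq {p h : Fin 3 → ConicCoeffs} (hp : Function.Surjective (combine p))
    (hh : combine p h = 0) : ∃ t, koszul p t = h := by
  have hle : LinearMap.range (koszul p) ≤ LinearMap.ker (combine p) := by
    rintro _ ⟨t, rfl⟩
    exact combine_koszul p t
  have h1 := LinearMap.finrank_range_add_finrank_ker (combine p)
  have h2 := LinearMap.finrank_range_of_inj (koszul_injective (linearIndependent_of_surjective hp))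
  rw [LinearMap.range_eq_top.2 hp, finrank_top] at h1
  have heq := Submodule.eq_of_le_of_finrank_eq hle (by
    rw [h2]
    simp only [Module.finrank_pi_fintype, Module.finrank_self,
      Finset.sum_const, Finset.card_univ, Fintype.card_fin, smul_eq_mul] at h1 ⊢
    omega)
  have : h ∈ LinearMap.range (koszul p) := heq ▸ hh
  exact this

lemma continuous_conicMul : Continuous fun v : ConicCoeffs × ConicCoeffs => conicMul v.1 v.2 := by
  simp only [conicMul_apply]
  refine continuous_pi fun i => ?_
  fin_cases i <;> simp <;> fun_prop

@[fun_prop]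
lemma Continuous.conicMul {T : Type*} [TopologicalSpace T] {f g : T → ConicCoeffs}
    (hf : Continuous f) (hg : Continuous g) : Continuous fun t => conicMul (f t) (g t) :=
  continuous_conicMul.comp (hf.prodMk hg)

lemma isOpen_setOf_surjective_combine : IsOpen {p | Function.Surjective (combine p)} := by
  rw [isOpen_iff_mem_nhds]
  intro p hp
  choose h hh using fun i : Fin 15 => hp (Pi.single i 1)
  have hopen : IsOpen {q | LinearIndependent ℝ fun i => combine q (h i)} := by
    refine isOpen_setOfPred_linearIndependent.preimage (f := fun q i => combine q (h i)) ?_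
    simp only [combine_eq_sum]
    fun_prop
  have hmem : p ∈ {q | LinearIndependent ℝ fun i => combine q (h i)} := by
    simp only [Set.mem_ofPred_eq, hh]
    convert (Pi.basisFun ℝ (Fin 15)).linearIndependent using 1
    ext i
    simp
  filter_upwards [hopen.mem_nhds hmem] with q hq
  have := LinearIndependent.span_eq_top_of_card_eq_finrank' hq (by simp)
  rw [← LinearMap.range_eq_top, eq_top_iff, ← this, Submodule.span_le]
  rintro _ ⟨i, rfl⟩
  exact ⟨_, rfl⟩

/-- The signed sum of squares `∑ sᵢ pᵢ²`. -/
def squareSum (s : Fin 3 → ℝ) (p : Fin 3 → ConicCoeffs) : QuarticCoeffs :=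
  ∑ i, s i • conicMul (p i) (p i)

/-- A vector of signs. -/
def IsSign (s : Fin 3 → ℝ) : Prop := ∀ i, s i = 1 ∨ s i = -1

lemma IsSign.mul_self {s : Fin 3 → ℝ} (hs : IsSign s) (i : Fin 3) : s i * s i = 1 := by
  rcases hs i with h | h <;> simp [h]

lemma IsSign.ne_zero {s : Fin 3 → ℝ} (hs : IsSign s) (i : Fin 3) : s i ≠ 0 := by
  rcases hs i with h | h <;> simp [h]

lemma finite_isSign : {s | IsSign s}.Finite := by
  have : {s | IsSign s} = Set.pi Set.univ fun _ : Fin 3 => ({1, -1} : Set ℝ) := by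
    ext s; simp [IsSign]
  rw [this]
  exact Set.Finite.pi fun _ => by simp

lemma continuous_squareSum (s : Fin 3 → ℝ) : Continuous (squareSum s) := by
  unfold squareSum
  fun_prop

/-- Coefficients of positive quartic forms defining a smooth complex curve. -/
structure IsSmoothPositive (c : QuarticCoeffs) : Prop where
  pos : ∀ x : Fin 3 → ℝ, x ≠ 0 → 0 < eval x (quarticPoly c)
  smooth : ∀ x : Fin 3 → ℂ, x ≠ 0 → ∃ i, aeval x (pderiv i (quarticPoly c)) ≠ 0

lemma quarticPoly_squareSum (s : Fin 3 → ℝ) (p : Fin 3 → ConicCoeffs) :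
    quarticPoly (squareSum s p) = ∑ i, C (s i) * conicPoly (p i) ^ 2 := by
  simp [squareSum, quarticPoly_conicMul, smul_eq_C_mul, pow_two]

lemma IsSmoothPositive.basePointFree {s : Fin 3 → ℝ} {p : Fin 3 → ConicCoeffs}
    (h : IsSmoothPositive (squareSum s p)) : BasePointFree p := by
  intro x hx
  by_contra! hcon
  obtain ⟨i, hi⟩ := h.smooth x hx
  apply hi
  rw [quarticPoly_squareSum]
  simp [hcon, Derivation.leibniz_pow]

lemma IsSmoothPositive.surjective_combine {s : Fin 3 → ℝ} {p : Fin 3 → ConicCoeffs}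
    (h : IsSmoothPositive (squareSum s p)) : Function.Surjective (combine p) :=
  h.basePointFree.surjective_combine

lemma vecMul_eq_zero_of_linearIndependent {q : Fin 3 → ConicCoeffs} (hq : LinearIndependent ℝ q)
    {v : Fin 3 → ℝ} (hv : v ᵥ* (Matrix.of q) = 0) : v = 0 := by
  have := (vecMul_injective_iff (M := Matrix.of q)).2 hq
  exact this (by simpa using hv)

/-- The action of matrices on triples of conics. -/
def mix (A : Matrix (Fin 3) (Fin 3) ℝ) (p : Fin 3 → ConicCoeffs) : Fin 3 → ConicCoeffs :=
  fun i => ∑ j, A i j • p j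

lemma of_mix (A : Matrix (Fin 3) (Fin 3) ℝ) (p : Fin 3 → ConicCoeffs) :
    Matrix.of (mix A p) = A * Matrix.of p := by
  ext i k
  simp [mix, Matrix.mul_apply]

lemma mix_apply (A : Matrix (Fin 3) (Fin 3) ℝ) (p : Fin 3 → ConicCoeffs) (i : Fin 3) (j : Fin 6) :
    mix A p i j = A i 0 * p 0 j + A i 1 * p 1 j + A i 2 * p 2 j := by
  simp [mix, Fin.sum_univ_three]

lemma mix_mix (A B : Matrix (Fin 3) (Fin 3) ℝ) (p : Fin 3 → ConicCoeffs) :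
    mix A (mix B p) = mix (A * B) p :=
  Matrix.of.injective (by rw [of_mix, of_mix, of_mix, Matrix.mul_assoc])

lemma mix_one (p : Fin 3 → ConicCoeffs) : mix 1 p = p :=
  Matrix.of.injective (by rw [of_mix, Matrix.one_mul])

lemma mix_sub (A B : Matrix (Fin 3) (Fin 3) ℝ) (p : Fin 3 → ConicCoeffs) :
    mix (A - B) p = mix A p - mix B p := by
  ext i j
  simp only [mix_apply, Pi.sub_apply, Matrix.sub_apply]
  ring

lemma vecMul_of_mix (v : Fin 3 → ℝ) (A : Matrix (Fin 3) (Fin 3) ℝ) (p : Fin 3 → ConicCoeffs) :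
    v ᵥ* Matrix.of (mix A p) = (v ᵥ* A) ᵥ* Matrix.of p := by
  rw [of_mix, vecMul_vecMul]

lemma span_range_mix_le (A : Matrix (Fin 3) (Fin 3) ℝ) (p : Fin 3 → ConicCoeffs) :
    Submodule.span ℝ (Set.range (mix A p)) ≤ Submodule.span ℝ (Set.range p) := by
  rw [Submodule.span_le]
  rintro _ ⟨i, rfl⟩
  exact Submodule.sum_mem _ fun j _ => Submodule.smul_mem _ _ (Submodule.subset_span ⟨j, rfl⟩)

lemma span_range_le_of_mix_eq_mix {A B : Matrix (Fin 3) (Fin 3) ℝ} {p q : Fin 3 → ConicCoeffs}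
    (hA : A.det ≠ 0) (h : mix A p = mix B q) :
    Submodule.span ℝ (Set.range p) ≤ Submodule.span ℝ (Set.range q) := by
  have : p = mix (A⁻¹ * B) q := by
    rw [← mix_mix, ← h, mix_mix, Matrix.nonsing_inv_mul _ hA.isUnit, mix_one]
  rw [this]
  exact span_range_mix_le _ _

lemma det_ne_zero_of_mix_eq_mix {A B : Matrix (Fin 3) (Fin 3) ℝ} {p q : Fin 3 → ConicCoeffs}
    (hq : LinearIndependent ℝ q) (h : mix A p = mix B q)
    (hAB : A + B = (2 : ℝ) • (1 : Matrix (Fin 3) (Fin 3) ℝ)) : A.det ≠ 0 := by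
  intro hdet
  obtain ⟨v, hv0, hv⟩ := exists_vecMul_eq_zero_iff.2 hdet
  have h1 : (v ᵥ* B) ᵥ* Matrix.of q = 0 := by
    rw [← vecMul_of_mix, ← h, vecMul_of_mix, hv, zero_vecMul]
  have h2 := vecMul_eq_zero_of_linearIndependent hq h1
  have h3 := congrArg (v ᵥ* ·) hAB
  simp only [vecMul_add, hv, h2, vecMul_smul, vecMul_one, add_zero] at h3
  exact hv0 (by simpa using h3.symm)

/-- Nearby representations with the same value span the same net (Cayley transform). -/
lemma span_eq_of_squareSum_eq {s : Fin 3 → ℝ} (hs : IsSign s) {p q : Fin 3 → ConicCoeffs}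
    (hp : LinearIndependent ℝ p) (hq : LinearIndependent ℝ q)
    (hpq : Function.Surjective (combine (p + q))) (h : squareSum s p = squareSum s q) :
    Submodule.span ℝ (Set.range p) = Submodule.span ℝ (Set.range q) := by
  have h0 : combine (p + q) (fun i => s i • (p i - q i)) = 0 := by
    rw [← sub_eq_zero] at h
    rw [combine_eq_sum, ← h, squareSum, squareSum, ← Finset.sum_sub_distrib]
    refine Finset.sum_congr rfl fun i _ => ?_
    simp only [Pi.add_apply, map_smul, map_add, map_sub, LinearMap.add_apply,
      conicMul_comm (q i) (p i), ← smul_sub]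
    congr 1
    abel
  obtain ⟨t, ht⟩ := exists_koszul_eq hpq h0
  let M : Matrix (Fin 3) (Fin 3) ℝ := !![0, s 0 * t 2, -(s 0 * t 1); -(s 1 * t 2), 0, s 1 * t 0;
    s 2 * t 1, -(s 2 * t 0), 0]
  have key : mix (1 - M) p = mix (1 + M) q := by
    ext i j
    have h1 := congrFun (congrFun ht i) j
    rw [koszul_apply] at h1
    have h2 := hs.mul_self i
    simp only [mix_apply]
    fin_cases i <;> simp [M] at h1 h2 ⊢
    · linear_combination -s 0 * h1 - (p 0 j - q 0 j) * h2
    · linear_combination -s 1 * h1 - (p 1 j - q 1 j) * h2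
    · linear_combination -s 2 * h1 - (p 2 j - q 2 j) * h2
  have hsum : (1 - M) + (1 + M) = (2 : ℝ) • (1 : Matrix (Fin 3) (Fin 3) ℝ) := by
    rw [two_smul]; abel
  apply le_antisymm
  · exact span_range_le_of_mix_eq_mix (det_ne_zero_of_mix_eq_mix hq key hsum) key
  · exact span_range_le_of_mix_eq_mix
      (det_ne_zero_of_mix_eq_mix hp key.symm (by rw [add_comm]; exact hsum)) key.symm

/-- The quadratic form with matrix `N`, evaluated at three conics. -/
def quadSum (N : Matrix (Fin 3) (Fin 3) ℝ) (p : Fin 3 → ConicCoeffs) : QuarticCoeffs :=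
  ∑ j, ∑ k, N j k • conicMul (p j) (p k)

lemma squareSum_eq_quadSum (s : Fin 3 → ℝ) (p : Fin 3 → ConicCoeffs) :
    squareSum s p = quadSum (Matrix.diagonal s) p := by
  simp [squareSum, quadSum, Matrix.diagonal_apply]

lemma squareSum_mix (s : Fin 3 → ℝ) (A : Matrix (Fin 3) (Fin 3) ℝ) (p : Fin 3 → ConicCoeffs) :
    squareSum s (mix A p) = quadSum (Aᵀ * Matrix.diagonal s * A) p := by
  simp only [squareSum, quadSum, mix, Fin.sum_univ_three, map_add, map_smul, LinearMap.add_apply,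
    LinearMap.smul_apply, Matrix.mul_apply, Matrix.transpose_apply, Matrix.diagonal_apply]
  simp
  module

lemma eq_zero_of_quadSum_eq_zero {N : Matrix (Fin 3) (Fin 3) ℝ} {p : Fin 3 → ConicCoeffs}
    (hp : Function.Surjective (combine p)) (hN : N.IsSymm) (h : quadSum N p = 0) : N = 0 := by
  have h0 : combine p (mix N p) = 0 := by
    rw [← h, combine_eq_sum, quadSum]
    simp [mix]
  obtain ⟨t, ht⟩ := exists_koszul_eq hp h0
  let M : Matrix (Fin 3) (Fin 3) ℝ := !![0, t 2, -t 1; -t 2, 0, t 0; t 1, -t 0, 0]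
  have hM : mix (N - M) p = 0 := by
    rw [mix_sub, ← ht, koszul_apply, sub_eq_zero]
    ext i j
    rw [mix_apply]
    fin_cases i <;> simp [M] <;> ring
  have hz : N - M = 0 := by
    ext i j
    have h1 : (N - M) i ᵥ* Matrix.of p = 0 := by
      rw [← Matrix.mul_apply_eq_vecMul, ← of_mix, hM]; rfl
    have := vecMul_eq_zero_of_linearIndependent (linearIndependent_of_surjective hp) h1
    exact congrFun this j
  have hNM : N = M := sub_eq_zero.1 hz
  have hs := hNM ▸ hN
  have e01 := hs.apply 0 1
  have e02 := hs.apply 0 2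
  have e12 := hs.apply 1 2
  simp [M] at e01 e02 e12
  have t0 : t 0 = 0 := by linarith
  have t1 : t 1 = 0 := by linarith
  have t2 : t 2 = 0 := by linarith
  rw [hNM]
  ext i j
  fin_cases i <;> fin_cases j <;> simp [M, t0, t1, t2]

/-- Two representations of the same form with the same span differ by an isometry. -/
lemma exists_isometry {s s' : Fin 3 → ℝ} {p q : Fin 3 → ConicCoeffs}
    (hp : Function.Surjective (combine p)) (hq : LinearIndependent ℝ q)
    (hle : Submodule.span ℝ (Set.range q) ≤ Submodule.span ℝ (Set.range p))
    (h : squareSum s q = squareSum s' p) :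
    ∃ A : Matrix (Fin 3) (Fin 3) ℝ, A.det ≠ 0 ∧ mix A p = q ∧
      ∀ r, squareSum s (mix A r) = squareSum s' r := by
  choose A hA using fun i => (Submodule.mem_span_range_iff_exists_fun ℝ).1
    (hle (Submodule.subset_span ⟨i, rfl⟩))
  have hAq : mix (Matrix.of A) p = q := by
    ext i j
    simp [← hA i, mix]
  refine ⟨Matrix.of A, ?_, hAq, ?_⟩
  · intro hdet
    obtain ⟨v, hv0, hv⟩ := exists_vecMul_eq_zero_iff.2 hdet
    refine hv0 (vecMul_eq_zero_of_linearIndependent hq ?_)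
    rw [← hAq, vecMul_of_mix, hv, zero_vecMul]
  · have hN : (Matrix.of A)ᵀ * Matrix.diagonal s * Matrix.of A - Matrix.diagonal s' = 0 := by
      apply eq_zero_of_quadSum_eq_zero hp
      · simp [Matrix.IsSymm, Matrix.transpose_mul, Matrix.mul_assoc]
      · have e : quadSum ((Matrix.of A)ᵀ * Matrix.diagonal s * Matrix.of A) p =
            quadSum (Matrix.diagonal s') p := by
          rw [← squareSum_mix, hAq, ← squareSum_eq_quadSum]
          exact h
        rw [← sub_eq_zero] at e
        rw [← e]
        simp [quadSum, sub_smul]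
    intro r
    rw [squareSum_mix, sub_eq_zero.1 hN, squareSum_eq_quadSum]

lemma span_range_mix {A : Matrix (Fin 3) (Fin 3) ℝ} (hA : A.det ≠ 0) (p : Fin 3 → ConicCoeffs) :
    Submodule.span ℝ (Set.range (mix A p)) = Submodule.span ℝ (Set.range p) :=
  le_antisymm (span_range_mix_le _ _) (span_range_le_of_mix_eq_mix hA (B := 1) (mix_one _).symm)

/-- The conics are pairwise orthogonal for the standard inner product on coefficients. -/
def IsOrthogonal (p : Fin 3 → ConicCoeffs) : Prop := Pairwise fun i j => p i ⬝ᵥ p j = 0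

/-- The spans of the signed representations of the quartic form with coefficients `c`. -/
def repSpans (c : QuarticCoeffs) : Set (Submodule ℝ ConicCoeffs) :=
  {W | ∃ s, IsSign s ∧ ∃ p, squareSum s p = c ∧ Submodule.span ℝ (Set.range p) = W}

/-- Absorb the absolute values of weights into the conics. -/
lemma exists_isSign_squareSum (d : Fin 3 → ℝ) (p : Fin 3 → ConicCoeffs) :
    ∃ s, IsSign s ∧ squareSum s (fun i => √|d i| • p i) = squareSum d p := by
  refine ⟨fun i => if d i < 0 then -1 else 1, fun i => ?_, ?_⟩
  · dsimp only
    split_ifs <;> simp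
  · refine Finset.sum_congr rfl fun i _ => ?_
    simp only [map_smul, LinearMap.smul_apply, smul_smul]
    congr 1
    rw [Real.mul_self_sqrt (abs_nonneg _)]
    split_ifs with h
    · rw [abs_of_neg h]; ring
    · rw [abs_of_nonneg (not_lt.1 h)]; ring

lemma exists_orthonormal {p : Fin 3 → ConicCoeffs} (hp : LinearIndependent ℝ p) :
    ∃ e : Fin 3 → ConicCoeffs, Matrix.of e * (Matrix.of e)ᵀ = 1 ∧
      Submodule.span ℝ (Set.range e) = Submodule.span ℝ (Set.range p) := by
  let ι : ConicCoeffs ≃ₗ[ℝ] EuclideanSpace ℝ (Fin 6) := (WithLp.linearEquiv 2 ℝ (Fin 6 → ℝ)).symm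
  have hP : LinearIndependent ℝ (ι ∘ p) := hp.map' ι.toLinearMap ι.ker
  have ho := InnerProductSpace.gramSchmidtNormed_orthonormal hP
  refine ⟨fun i => ι.symm (InnerProductSpace.gramSchmidtNormed ℝ (ι ∘ p) i), ?_, ?_⟩
  · ext i j
    rw [orthonormal_iff_ite] at ho
    have := ho i j
    rw [Matrix.mul_apply, Matrix.one_apply, ← this]
    simp [PiLp.inner_apply, ι, mul_comm]
  · have h := (InnerProductSpace.span_gramSchmidtNormed_range (𝕜 := ℝ) (ι ∘ p)).trans
      (InnerProductSpace.span_gramSchmidt ℝ (ι ∘ p))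
    have h' := congrArg (Submodule.map ι.symm.toLinearMap) h
    rw [Submodule.map_span, Submodule.map_span, ← Set.range_comp, ← Set.range_comp] at h'
    convert h' using 3
    all_goals (ext i : 1; simp)

/-- Every representation can be made orthogonal without changing its span. -/
lemma exists_isOrthogonal {s : Fin 3 → ℝ} {p : Fin 3 → ConicCoeffs}
    (h : IsSmoothPositive (squareSum s p)) :
    ∃ s' q, IsSign s' ∧ IsOrthogonal q ∧ squareSum s' q = squareSum s p ∧
      Submodule.span ℝ (Set.range q) = Submodule.span ℝ (Set.range p) := by
  have hp := linearIndependent_of_surjective h.surjective_combine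
  obtain ⟨e, he, hspan⟩ := exists_orthonormal hp
  choose A hA using fun i => (Submodule.mem_span_range_iff_exists_fun ℝ).1
    (hspan ▸ Submodule.subset_span ⟨i, rfl⟩ : p i ∈ Submodule.span ℝ (Set.range e))
  have hAp : mix (Matrix.of A) e = p := by
    ext i j
    simp [← hA i, mix]
  set N : Matrix (Fin 3) (Fin 3) ℝ := (Matrix.of A)ᵀ * Matrix.diagonal s * Matrix.of A with hN
  have hsymm : N.IsHermitian := by
    simp [Matrix.IsHermitian, hN, Matrix.conjTranspose_eq_transpose_of_trivial,
      Matrix.transpose_mul, Matrix.mul_assoc]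
  set U : Matrix (Fin 3) (Fin 3) ℝ := ↑hsymm.eigenvectorUnitary with hU
  have hspec : N = U * Matrix.diagonal hsymm.eigenvalues * Uᵀ := by
    have := hsymm.spectral_theorem
    rw [Unitary.conjStarAlgAut_apply] at this
    simpa [← hU, Matrix.star_eq_conjTranspose,
      Matrix.conjTranspose_eq_transpose_of_trivial] using this
  have hUU : Uᵀ * U = 1 := by
    have := Unitary.coe_star_mul_self hsymm.eigenvectorUnitary
    rwa [Matrix.star_eq_conjTranspose, Matrix.conjTranspose_eq_transpose_of_trivial] at this
  have hval : squareSum hsymm.eigenvalues (mix Uᵀ e) = squareSum s p := by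
    rw [← hAp, squareSum_mix, squareSum_mix, Matrix.transpose_transpose, ← hspec]
  obtain ⟨s', hs', hsq⟩ := exists_isSign_squareSum hsymm.eigenvalues (mix Uᵀ e)
  refine ⟨s', _, hs', ?_, hsq.trans hval, ?_⟩
  · have hUe : Matrix.of (mix Uᵀ e) * (Matrix.of (mix Uᵀ e))ᵀ = 1 := by
      rw [of_mix, Matrix.transpose_mul, Matrix.transpose_transpose, Matrix.mul_assoc,
        ← Matrix.mul_assoc _ _ U, he, Matrix.one_mul, hUU]
    intro i j hij
    have h1 := congrFun (congrFun hUe i) j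
    rw [Matrix.mul_apply, Matrix.one_apply_ne hij] at h1
    rw [smul_dotProduct, dotProduct_smul]
    have h2 : mix Uᵀ e i ⬝ᵥ mix Uᵀ e j = 0 := h1
    rw [h2]
    simp
  · set q : Fin 3 → ConicCoeffs := fun i => √|hsymm.eigenvalues i| • mix Uᵀ e i with hq
    have hqs : IsSmoothPositive (squareSum s' q) := by rwa [hsq, hval]
    have hqi := linearIndependent_of_surjective hqs.surjective_combine
    apply Submodule.eq_of_le_of_finrank_eq
    · rw [Submodule.span_le]
      rintro _ ⟨i, rfl⟩
      refine Submodule.smul_mem _ _ ?_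
      rw [← hspan]
      exact span_range_mix_le _ _ (Submodule.subset_span ⟨i, rfl⟩)
    · rw [finrank_span_eq_card hqi, finrank_span_eq_card hp]

lemma eval_linPoly (a x : Fin 3 → ℝ) : eval x (linPoly a) = a ⬝ᵥ x := by
  simp [linPoly, dotProduct, Fin.sum_univ_three]

lemma isHomogeneous_linPoly (a : LinearCoeffs) : (linPoly a).IsHomogeneous 1 :=
  ((isHomogeneous_C_mul_X _ _).add (isHomogeneous_C_mul_X _ _)).add (isHomogeneous_C_mul_X _ _)

lemma linPoly_smul (r : ℝ) (a : LinearCoeffs) : linPoly (r • a) = C r * linPoly a := by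
  simp [linPoly]; ring

lemma linPoly_injective : Function.Injective linPoly := by
  intro a b h
  ext i
  have := congrArg (eval (Pi.single i 1)) h
  simpa [eval_linPoly] using this

lemma linPoly_ne_zero {a : LinearCoeffs} (ha : a ≠ 0) : linPoly a ≠ 0 := by
  intro h
  exact ha (linPoly_injective (h.trans (by simp [linPoly])))

lemma exists_linPoly_eq {p : MvPolynomial (Fin 3) ℝ} (hp : p.IsHomogeneous 1) :
    ∃ a, linPoly a = p := by
  refine ⟨fun i => coeff (Finsupp.single i 1) p, ?_⟩
  ext m
  by_cases hm : m.degree = 1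
  · obtain ⟨i, rfl⟩ : ∃ i, m = Finsupp.single i 1 := by
      rw [Finsupp.degree_eq_sum, Fin.sum_univ_three] at hm
      obtain h | h | h : (m 0 = 1 ∧ m 1 = 0 ∧ m 2 = 0) ∨ (m 0 = 0 ∧ m 1 = 1 ∧ m 2 = 0) ∨
          (m 0 = 0 ∧ m 1 = 0 ∧ m 2 = 1) := by omega
      exacts [⟨0, by ext j; fin_cases j <;> simp [h]⟩, ⟨1, by ext j; fin_cases j <;> simp [h]⟩,
        ⟨2, by ext j; fin_cases j <;> simp [h]⟩]
    simp only [linPoly, coeff_add, coeff_C_mul, coeff_X, Finsupp.single_left_inj one_ne_zero]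
    fin_cases i <;> simp
  · rw [(isHomogeneous_linPoly _).coeff_eq_zero hm, hp.coeff_eq_zero hm]

lemma prime_linPoly {a : LinearCoeffs} (ha : a ≠ 0) : Prime (linPoly a) := by
  rw [← UniqueFactorizationMonoid.irreducible_iff_prime]
  refine irreducible_of_totalDegree_eq_one
    ((isHomogeneous_linPoly a).totalDegree (linPoly_ne_zero ha)) fun x hx => ?_
  rw [isUnit_iff_ne_zero]
  rintro rfl
  refine linPoly_ne_zero ha ?_
  ext m
  simpa using hx m

lemma homogeneousComponent_mul_isHomogeneous {A : MvPolynomial (Fin 3) ℝ} {m : ℕ}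
    (hA : A.IsHomogeneous m) (u : MvPolynomial (Fin 3) ℝ) (n : ℕ) :
    homogeneousComponent (n + m) (u * A) = homogeneousComponent n u * A := by
  conv_lhs => rw [← sum_homogeneousComponent u, Finset.sum_mul, map_sum]
  have h : ∀ i, homogeneousComponent (n + m) (homogeneousComponent i u * A) =
      if i = n then homogeneousComponent n u * A else 0 := fun i => by
    rw [homogeneousComponent_of_mem ((homogeneousComponent_isHomogeneous i u).mul hA)]
    split_ifs with h1 h2 h2
    · rw [h2]
    · omega
    · omega
    · rfl
  simp only [h, Finset.sum_ite_eq', Finset.mem_range]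
  split_ifs with hn
  · rfl
  · rw [homogeneousComponent_eq_zero n u (by omega), zero_mul]

lemma exists_linPoly_of_mul_eq {a : LinearCoeffs} {q : ConicCoeffs} {u : MvPolynomial (Fin 3) ℝ}
    (ha : a ≠ 0) (h : conicPoly q = linPoly a * u) : ∃ b, u = linPoly b := by
  have h1 := homogeneousComponent_mul_isHomogeneous (isHomogeneous_linPoly a) u 1
  rw [mul_comm, ← h, homogeneousComponent_of_mem (isHomogeneous_conicPoly q), if_pos rfl, h,
    mul_comm] at h1
  obtain ⟨b, hb⟩ := exists_linPoly_eq (homogeneousComponent_isHomogeneous 1 u)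
  exact ⟨b, (mul_right_cancel₀ (linPoly_ne_zero ha) h1).trans hb.symm⟩

lemma exists_linMul_eq_of_not_irreducible {q : ConicCoeffs} (hq : q ≠ 0)
    (h : ¬ Irreducible (conicPoly q)) : ∃ a b, linMul a b = q := by
  have hq0 : conicPoly q ≠ 0 := fun h0 => hq (conicPoly_injective (by simpa using h0))
  have hdeg : ∀ u : MvPolynomial (Fin 3) ℝ, u ≠ 0 → ¬ IsUnit u → u.totalDegree ≠ 0 := by
    intro u hu0 hu h0
    rw [totalDegree_eq_zero_iff_eq_C] at h0
    rw [h0] at hu hu0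
    exact hu ((isUnit_iff_ne_zero.2 (by simpa using hu0)).map C)
  have htd := (isHomogeneous_conicPoly q).totalDegree hq0
  rw [irreducible_iff] at h
  push Not at h
  obtain ⟨u, v, huv, hu, hv⟩ := h (fun hun => by
    rw [MvPolynomial.isUnit_iff_totalDegree_of_isReduced, htd] at hun
    simp at hun)
  have hu0 : u ≠ 0 := by rintro rfl; simp at huv; exact hq0 huv
  have hv0 : v ≠ 0 := by rintro rfl; simp at huv; exact hq0 huv
  have hu1 := hdeg u hu0 hu
  have hv1 := hdeg v hv0 hv
  rw [huv, totalDegree_mul_of_isDomain hu0 hv0] at htd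
  have hv2 : v.totalDegree = 1 := by omega
  have h2 : conicPoly q = homogeneousComponent 1 u * homogeneousComponent 1 v := by
    have h3 : homogeneousComponent 2 (conicPoly q) = conicPoly q := by
      rw [homogeneousComponent_of_mem (isHomogeneous_conicPoly q), if_pos rfl]
    rw [← h3, huv]
    conv_lhs => rw [← sum_homogeneousComponent v, hv2, Finset.sum_range_succ,
      Finset.sum_range_one, mul_add, map_add]
    rw [homogeneousComponent_mul_isHomogeneous (homogeneousComponent_isHomogeneous 0 v) u 2,
      homogeneousComponent_eq_zero 2 u (by omega), zero_mul, zero_add]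
    exact homogeneousComponent_mul_isHomogeneous (homogeneousComponent_isHomogeneous 1 v) u 1
  obtain ⟨a, ha⟩ := exists_linPoly_eq (homogeneousComponent_isHomogeneous 1 u)
  obtain ⟨b, hb⟩ := exists_linPoly_eq (homogeneousComponent_isHomogeneous 1 v)
  exact ⟨a, b, conicPoly_injective (by rw [conicPoly_linMul, h2, ha, hb])⟩

lemma eq_smul_of_dvd {q r : ConicCoeffs} (h : conicPoly q ∣ conicPoly r) : ∃ k : ℝ, r = k • q := by
  obtain ⟨e, he⟩ := h
  refine ⟨coeff 0 e, conicPoly_injective ?_⟩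
  rw [map_smul, smul_eq_C_mul]
  exact eq_C_mul_of_isHomogeneous (isHomogeneous_conicPoly q) (isHomogeneous_conicPoly r)
    (by rw [he, mul_comm])

lemma eq_smul_of_linPoly_dvd {a b : LinearCoeffs} (h : linPoly a ∣ linPoly b) :
    ∃ k : ℝ, b = k • a := by
  obtain ⟨e, he⟩ := h
  refine ⟨coeff 0 e, linPoly_injective ?_⟩
  rw [linPoly_smul]
  exact eq_C_mul_of_isHomogeneous (isHomogeneous_linPoly a) (isHomogeneous_linPoly b)
    (by rw [he, mul_comm])

/-- Three independent conics with `q₀ q₂ = q₁²` are, up to sign, `a², ab, b²`. -/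
lemma exists_linMul_of_conicMul_eq {A C B : ConicCoeffs} (hA : A ≠ 0) (hAC : ∀ k : ℝ, C ≠ k • A)
    (h : conicMul A B = conicMul C C) :
    ∃ ε : ℝ, (ε = 1 ∨ ε = -1) ∧ ∃ a b : LinearCoeffs, A = ε • linMul a a ∧ C = ε • linMul a b ∧
      B = ε • linMul b b := by
  have hA0 : conicPoly A ≠ 0 := fun h0 => hA (conicPoly_injective (by simpa using h0))
  have hpoly : conicPoly A * conicPoly B = conicPoly C * conicPoly C := by
    rw [← quarticPoly_conicMul, ← quarticPoly_conicMul, h]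
  by_cases hirr : Irreducible (conicPoly A)
  · have hp := UniqueFactorizationMonoid.irreducible_iff_prime.1 hirr
    obtain ⟨k, hk⟩ := eq_smul_of_dvd
      ((hp.dvd_or_dvd (Dvd.intro _ hpoly)).elim id id)
    exact absurd hk (hAC k)
  · obtain ⟨a₁, a₂, rfl⟩ := exists_linMul_eq_of_not_irreducible hA hirr
    have ha₁ : a₁ ≠ 0 := by rintro rfl; simp at hA
    have ha₂ : a₂ ≠ 0 := by rintro rfl; simp at hA
    have hl₁ := linPoly_ne_zero ha₁
    rw [conicPoly_linMul] at hpoly hA0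
    obtain ⟨u, hu⟩ : linPoly a₁ ∣ conicPoly C :=
      ((prime_linPoly ha₁).dvd_or_dvd ⟨_, by rw [← hpoly, mul_assoc]⟩).elim id id
    obtain ⟨m, rfl⟩ := exists_linPoly_of_mul_eq ha₁ hu
    rw [hu] at hpoly
    have h2 : linPoly a₂ * conicPoly B = linPoly a₁ * (linPoly m * linPoly m) :=
      mul_left_cancel₀ hl₁ (by linear_combination hpoly)
    have hC : C = linMul a₁ m := conicPoly_injective (by rw [hu, conicPoly_linMul])
    by_cases hdvd : linPoly a₁ ∣ linPoly a₂
    · obtain ⟨k, rfl⟩ := eq_smul_of_linPoly_dvd hdvd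
      have hk : k ≠ 0 := by rintro rfl; simp at ha₂
      have hB : k • B = linMul m m := by
        apply conicPoly_injective
        apply mul_left_cancel₀ hl₁
        rw [map_smul, smul_eq_C_mul, conicPoly_linMul]
        rw [linPoly_smul] at h2
        linear_combination h2
      have hB' : B = k⁻¹ • linMul m m := by rw [← hB, inv_smul_smul₀ hk]
      have hsq := Real.mul_self_sqrt (abs_nonneg k)
      have hs0 : √|k| ≠ 0 := (Real.sqrt_pos.2 (abs_pos.2 hk)).ne'
      rcases lt_or_gt_of_ne hk with hneg | hpos
      · rw [abs_of_neg hneg] at hsq hs0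
        refine ⟨-1, Or.inr rfl, √(-k) • a₁, -(√(-k))⁻¹ • m, ?_, ?_, ?_⟩
        · simp [smul_smul, hsq]
        · simp [hC, smul_smul, hs0]
        · rw [hB']
          simp only [map_smul, LinearMap.smul_apply, smul_smul]
          congr 1
          field_simp
          linear_combination hsq
      · rw [abs_of_pos hpos] at hsq hs0
        refine ⟨1, Or.inl rfl, √k • a₁, (√k)⁻¹ • m, ?_, ?_, ?_⟩
        · simp [smul_smul, hsq]
        · simp [hC, smul_smul, hs0]
        · rw [hB']
          simp only [map_smul, LinearMap.smul_apply, smul_smul]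
          congr 1
          field_simp
          linear_combination hsq
    · exfalso
      obtain ⟨v, hv⟩ := ((prime_linPoly ha₁).dvd_or_dvd (Dvd.intro _ h2.symm)).resolve_left hdvd
      rw [hv] at h2
      have h3 : linPoly a₂ * v = linPoly m * linPoly m :=
        mul_left_cancel₀ hl₁ (by linear_combination h2)
      obtain ⟨k, hk⟩ := eq_smul_of_linPoly_dvd
        (((prime_linPoly ha₂).dvd_or_dvd (Dvd.intro _ h3)).elim id id)
      exact hAC k (by rw [hC, hk, map_smul])

/-- The tangent space to the cone `{(a², ab, b²)}`. -/
lemma exists_linMul_of_tangent {a b : LinearCoeffs} (hab : LinearIndependent ℝ ![a, b])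
    {α β γ : ConicCoeffs}
    (h : conicMul (linMul b b) α + conicMul (linMul a a) γ = (2 : ℝ) • conicMul (linMul a b) β) :
    ∃ l m, α = (2 : ℝ) • linMul a l ∧ β = linMul a m + linMul b l ∧ γ = (2 : ℝ) • linMul b m := by
  have ha : a ≠ 0 := hab.ne_zero 0
  have hb : b ≠ 0 := hab.ne_zero 1
  have hla := linPoly_ne_zero ha
  have hlb := linPoly_ne_zero hb
  have hndvd : ¬ linPoly a ∣ linPoly b := by
    intro hd
    obtain ⟨k, hk⟩ := eq_smul_of_linPoly_dvd hd
    have := LinearIndependent.pair_iff.1 hab k (-1) (by simp [hk])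
    simp at this
  have hndvd' : ¬ linPoly b ∣ linPoly a := by
    intro hd
    obtain ⟨k, hk⟩ := eq_smul_of_linPoly_dvd hd
    have := LinearIndependent.pair_iff.1 hab (-1) k (by simp [hk])
    simp at this
  have hp : linPoly b * linPoly b * conicPoly α + linPoly a * linPoly a * conicPoly γ =
      2 * (linPoly a * linPoly b * conicPoly β) := by
    have := congrArg quarticPoly h
    simpa only [map_add, map_smul, quarticPoly_conicMul, conicPoly_linMul, smul_eq_C_mul,
      map_ofNat] using this
  obtain ⟨u, hu⟩ : linPoly a ∣ conicPoly α := by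
    have : linPoly a ∣ linPoly b * (linPoly b * conicPoly α) :=
      ⟨2 * (linPoly b * conicPoly β) - linPoly a * conicPoly γ, by linear_combination hp⟩
    exact (((prime_linPoly ha).dvd_or_dvd
      (((prime_linPoly ha).dvd_or_dvd this).resolve_left hndvd)).resolve_left hndvd)
  obtain ⟨v, hv⟩ : linPoly b ∣ conicPoly γ := by
    have : linPoly b ∣ linPoly a * (linPoly a * conicPoly γ) :=
      ⟨2 * (linPoly a * conicPoly β) - linPoly b * conicPoly α, by linear_combination hp⟩
    exact (((prime_linPoly hb).dvd_or_dvd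
      (((prime_linPoly hb).dvd_or_dvd this).resolve_left hndvd')).resolve_left hndvd')
  obtain ⟨l, rfl⟩ := exists_linPoly_of_mul_eq ha hu
  obtain ⟨m, rfl⟩ := exists_linPoly_of_mul_eq hb hv
  have hh : (2 : MvPolynomial (Fin 3) ℝ) * C 2⁻¹ = 1 := by
    rw [← map_ofNat C 2, ← C_mul]; norm_num
  refine ⟨(2 : ℝ)⁻¹ • l, (2 : ℝ)⁻¹ • m, ?_, ?_, ?_⟩
  · apply conicPoly_injective
    rw [show (2 : ℝ) • linMul a ((2 : ℝ)⁻¹ • l) = linMul a l by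
      rw [map_smul, smul_inv_smul₀ (by norm_num)], hu, conicPoly_linMul]
  · apply conicPoly_injective
    rw [map_add, conicPoly_linMul, conicPoly_linMul, linPoly_smul, linPoly_smul]
    apply mul_left_cancel₀ (mul_ne_zero hla hlb)
    rw [hu, hv] at hp
    linear_combination -C 2⁻¹ * hp - linPoly a * linPoly b * conicPoly β * hh
  · apply conicPoly_injective
    rw [show (2 : ℝ) • linMul b ((2 : ℝ)⁻¹ • m) = linMul b m by
      rw [map_smul, smul_inv_smul₀ (by norm_num)], hv, conicPoly_linMul]

end

section

open MvPolynomial Matrix Filter Topology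

lemma hasStrictFDerivAt_bilinear {E F G V : Type*} [NormedAddCommGroup E] [NormedSpace ℝ E]
    [FiniteDimensional ℝ E] [NormedAddCommGroup F] [NormedSpace ℝ F] [FiniteDimensional ℝ F]
    [NormedAddCommGroup G] [NormedSpace ℝ G] [NormedAddCommGroup V] [NormedSpace ℝ V]
    (B : E →ₗ[ℝ] F →ₗ[ℝ] G) {f : V → E} {g : V → F} {f' : V →L[ℝ] E} {g' : V →L[ℝ] F}
    {D : V →L[ℝ] G} {x : V} (hf : HasStrictFDerivAt f f' x) (hg : HasStrictFDerivAt g g' x)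
    (hD : ∀ v, D v = B (f x) (g' v) + B (f' v) (g x)) :
    HasStrictFDerivAt (fun y => B (f y) (g y)) D x := by
  exact (B.toContinuousBilinearMap.hasStrictFDerivAt_of_bilinear hf hg).congr_fderiv
    (ContinuousLinearMap.ext fun v => by simp [hD])

lemma continuous_eval_quarticPoly :
    Continuous fun t : (Fin 3 → ℝ) × QuarticCoeffs => eval t.1 (quarticPoly t.2) := by
  simp only [quarticPoly_eq, map_add, map_mul, map_pow, eval_C, eval_X]
  fun_prop

lemma continuous_linMul : Continuous fun v : LinearCoeffs × LinearCoeffs => linMul v.1 v.2 := by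
  simp only [linMul_apply]
  refine continuous_pi fun i => ?_
  fin_cases i <;> simp <;> fun_prop

@[fun_prop]
lemma Continuous.linMul {T : Type*} [TopologicalSpace T] {f g : T → LinearCoeffs}
    (hf : Continuous f) (hg : Continuous g) : Continuous fun t => linMul (f t) (g t) :=
  continuous_linMul.comp (hf.prodMk hg)

@[fun_prop]
lemma Continuous.crossProduct {T : Type*} [TopologicalSpace T] {f g : T → (Fin 3 → ℝ)}
    (hf : Continuous f) (hg : Continuous g) : Continuous fun t => crossProduct (f t) (g t) := by
  simp only [cross_apply]
  refine continuous_pi fun i => ?_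
  fin_cases i <;> simp <;> fun_prop

lemma Continuous.eval_quarticPoly {T : Type*} [TopologicalSpace T] {f : T → (Fin 3 → ℝ)}
    {g : T → QuarticCoeffs} (hf : Continuous f) (hg : Continuous g) :
    Continuous fun t => eval (f t) (quarticPoly (g t)) := by
  have h := continuous_eval_quarticPoly
  have h2 := h.comp (hf.prodMk hg)
  simpa only [Function.comp_def] using h2

/-- The differential of `(a, b) ↦ (a², ab, b²)`. -/
noncomputable def squareTangent (a b : LinearCoeffs) :
    LinearCoeffs × LinearCoeffs →ₗ[ℝ] (Fin 3 → ConicCoeffs) :=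
  LinearMap.pi ![(2 : ℝ) • (linMul a).comp (LinearMap.fst ℝ _ _),
    (linMul a).comp (LinearMap.snd ℝ _ _) + (linMul b).comp (LinearMap.fst ℝ _ _),
    (2 : ℝ) • (linMul b).comp (LinearMap.snd ℝ _ _)]

/-- The linear part of the discriminant `αγ - β²` at `(a², ab, b²)`. -/
noncomputable def discLin (a b : LinearCoeffs) (r : Fin 3 → ConicCoeffs) : QuarticCoeffs :=
  conicMul (linMul a a) (r 2) + conicMul (linMul b b) (r 0) - (2 : ℝ) • conicMul (linMul a b) (r 1)

/-- The discriminant `αγ - β²` of a triple of conics. -/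
noncomputable def disc (r : Fin 3 → ConicCoeffs) : QuarticCoeffs :=
  conicMul (r 0) (r 2) - conicMul (r 1) (r 1)

lemma linMul_comm (a b : LinearCoeffs) : linMul a b = linMul b a := by
  ext i; fin_cases i <;> simp [linMul_apply] <;> ring

lemma disc_add (a b : LinearCoeffs) (ρ : ℝ) (r : Fin 3 → ConicCoeffs) :
    disc (![linMul a a, linMul a b, linMul b b] + ρ • r) =
      ρ • discLin a b r + ρ ^ 2 • disc r := by
  apply quarticPoly_injective
  simp [disc, discLin, quarticPoly_conicMul, conicPoly_linMul, smul_eq_C_mul, map_ofNat]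
  ring

lemma eval_discLin (a b : LinearCoeffs) (r : Fin 3 → ConicCoeffs) :
    eval (crossProduct a b) (quarticPoly (discLin a b r)) = 0 := by
  have h1 : a ⬝ᵥ crossProduct a b = 0 := dot_self_cross a b
  have h2 : b ⬝ᵥ crossProduct a b = 0 := dot_cross_self a b
  simp [discLin, quarticPoly_conicMul, conicPoly_linMul, smul_eq_C_mul, eval_linPoly, h1, h2]

lemma mem_range_squareTangent {a b : LinearCoeffs} (hab : LinearIndependent ℝ ![a, b])
    {r : Fin 3 → ConicCoeffs} (h : discLin a b r = 0) : r ∈ LinearMap.range (squareTangent a b) := by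
  obtain ⟨l, m, h0, h1, h2⟩ := exists_linMul_of_tangent hab (α := r 0) (β := r 1) (γ := r 2)
    (by rw [discLin, sub_eq_zero] at h; rw [← h, add_comm])
  refine ⟨(l, m), ?_⟩
  ext1 i
  fin_cases i <;> simp [squareTangent, h0, h1, h2]

/-- Near a degenerate triple `(a², ab, b²)`, the discriminant of a triple of conics is not a
nonzero multiple of a quartic form that does not vanish at the common zero of `a` and `b`. -/
lemma eventually_eq_zero_of_disc_eq {a b : LinearCoeffs} (hab : LinearIndependent ℝ ![a, b])
    {c : QuarticCoeffs} (hc : eval (crossProduct a b) (quarticPoly c) ≠ 0) :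
    ∀ᶠ t : (Fin 3 → ConicCoeffs) × QuarticCoeffs × ℝ in
      𝓝 (![linMul a a, linMul a b, linMul b b], c, 0), disc t.1 = t.2.2 • t.2.1 → t.2.2 = 0 := by
  obtain ⟨C₀, hC⟩ := Submodule.exists_isCompl (LinearMap.range (squareTangent a b))
  let K : Set (Fin 3 → ConicCoeffs) := {r | r ∈ C₀ ∧ ‖r‖ = 1}
  have hK : IsCompact K := by
    refine Metric.isCompact_of_isClosed_isBounded ?_ ?_
    · exact (Submodule.closed_of_finiteDimensional C₀).inter
        (isClosed_eq continuous_norm continuous_const)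
    · refine (Metric.isBounded_closedBall (x := (0 : Fin 3 → ConicCoeffs)) (r := 1)).subset ?_
      intro r hr
      simpa using hr.2.le
  let G : ((LinearCoeffs × LinearCoeffs) × ℝ × QuarticCoeffs) × (Fin 3 → ConicCoeffs) →
      QuarticCoeffs := fun t =>
    let P := crossProduct (a + t.1.1.1) (b + t.1.1.2)
    eval P (quarticPoly t.1.2.2) • discLin (a + t.1.1.1) (b + t.1.1.2) t.2 +
      (t.1.2.1 * eval P (quarticPoly t.1.2.2)) • disc t.2 -
      (t.1.2.1 * eval P (quarticPoly (disc t.2))) • t.1.2.2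
  have hG : Continuous G := by
    have h1 : Continuous fun t : ((LinearCoeffs × LinearCoeffs) × ℝ × QuarticCoeffs) ×
        (Fin 3 → ConicCoeffs) => crossProduct (a + t.1.1.1) (b + t.1.1.2) := by fun_prop
    have h2 : Continuous fun t : ((LinearCoeffs × LinearCoeffs) × ℝ × QuarticCoeffs) ×
        (Fin 3 → ConicCoeffs) => disc t.2 := by
      unfold disc
      fun_prop
    have h3 : Continuous fun t : ((LinearCoeffs × LinearCoeffs) × ℝ × QuarticCoeffs) ×
        (Fin 3 → ConicCoeffs) => discLin (a + t.1.1.1) (b + t.1.1.2) t.2 := by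
      unfold discLin
      fun_prop
    have h4 := Continuous.eval_quarticPoly h1 h2
    have h5 := Continuous.eval_quarticPoly h1 (continuous_fst.snd.snd)
    exact ((h5.smul h3).add ((continuous_fst.snd.fst.mul h5).smul h2)).sub
      ((continuous_fst.snd.fst.mul h4).smul continuous_fst.snd.snd)
  have hGne : ∀ r ∈ K, G (((0, 0), 0, c), r) ≠ 0 := by
    intro r hr h0
    simp only [G, add_zero, zero_mul, zero_smul, sub_zero, smul_eq_zero, hc, false_or] at h0
    have := Submodule.disjoint_def.1 hC.disjoint r (mem_range_squareTangent hab h0) hr.1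
    have h1 := hr.2
    rw [this, norm_zero] at h1
    exact zero_ne_one h1
  have hev : ∀ᶠ x in 𝓝 (((0, 0), 0, c) : (LinearCoeffs × LinearCoeffs) × ℝ × QuarticCoeffs),
      ∀ r ∈ K, G (x, r) ≠ 0 :=
    hK.eventually_forall_of_forall_eventually fun r hr =>
      hG.continuousAt.eventually_ne (hGne r hr)
  let Ψ : (LinearCoeffs × LinearCoeffs) × C₀ → (Fin 3 → ConicCoeffs) := fun y =>
    ![linMul (a + y.1.1) (a + y.1.1), linMul (a + y.1.1) (b + y.1.2),
      linMul (b + y.1.2) (b + y.1.2)] + (y.2 : Fin 3 → ConicCoeffs)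
  let D : (LinearCoeffs × LinearCoeffs) × C₀ →L[ℝ] (Fin 3 → ConicCoeffs) :=
    LinearMap.toContinuousLinearMap
      ((squareTangent a b).comp (LinearMap.fst ℝ _ _) + C₀.subtype.comp (LinearMap.snd ℝ _ _))
  have hD : HasStrictFDerivAt Ψ D 0 := by
    have h1 : HasStrictFDerivAt (fun y : (LinearCoeffs × LinearCoeffs) × C₀ => a + y.1.1)
        ((ContinuousLinearMap.fst ℝ _ _).comp (ContinuousLinearMap.fst ℝ _ _)) 0 :=
      (((ContinuousLinearMap.fst ℝ LinearCoeffs LinearCoeffs).comp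
        (ContinuousLinearMap.fst ℝ _ C₀)).hasStrictFDerivAt).const_add a
    have h2 : HasStrictFDerivAt (fun y : (LinearCoeffs × LinearCoeffs) × C₀ => b + y.1.2)
        ((ContinuousLinearMap.snd ℝ _ _).comp (ContinuousLinearMap.fst ℝ _ _)) 0 :=
      (((ContinuousLinearMap.snd ℝ LinearCoeffs LinearCoeffs).comp
        (ContinuousLinearMap.fst ℝ _ C₀)).hasStrictFDerivAt).const_add b
    have h3 : HasStrictFDerivAt (fun y : (LinearCoeffs × LinearCoeffs) × C₀ =>
        (y.2 : Fin 3 → ConicCoeffs)) (C₀.subtypeL.comp (ContinuousLinearMap.snd ℝ _ _)) 0 :=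
      (C₀.subtypeL.comp (ContinuousLinearMap.snd ℝ (LinearCoeffs × LinearCoeffs) C₀)).hasStrictFDerivAt
    have h4 : HasStrictFDerivAt (fun y : (LinearCoeffs × LinearCoeffs) × C₀ =>
        (![linMul (a + y.1.1) (a + y.1.1), linMul (a + y.1.1) (b + y.1.2),
          linMul (b + y.1.2) (b + y.1.2)] : Fin 3 → ConicCoeffs))
        (LinearMap.toContinuousLinearMap
          ((squareTangent a b).comp (LinearMap.fst ℝ (LinearCoeffs × LinearCoeffs) C₀))) 0 := by
      rw [hasStrictFDerivAt_pi']
      intro i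
      fin_cases i
      · refine hasStrictFDerivAt_bilinear linMul h1 h1 fun v => ?_
        simp [squareTangent, two_smul, linMul_comm]
      · refine hasStrictFDerivAt_bilinear linMul h1 h2 fun v => ?_
        simp [squareTangent, linMul_comm]
      · refine hasStrictFDerivAt_bilinear linMul h2 h2 fun v => ?_
        simp [squareTangent, two_smul, linMul_comm]
    exact h4.add h3
  have hsurj : LinearMap.range (D : (LinearCoeffs × LinearCoeffs) × C₀ →ₗ[ℝ] (Fin 3 → ConicCoeffs)) = ⊤ := by
    rw [eq_top_iff]
    intro e _
    obtain ⟨_, ⟨y, rfl⟩, z, hz, rfl⟩ := Submodule.mem_sup.1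
      (hC.codisjoint.eq_top ▸ Submodule.mem_top : e ∈ LinearMap.range (squareTangent a b) ⊔ C₀)
    exact ⟨(y, ⟨z, hz⟩), by simp [D]⟩
  have hmap := hD.map_nhds_eq_of_surj hsurj
  have hΨ0 : Ψ 0 = ![linMul a a, linMul a b, linMul b b] := by simp [Ψ]
  rw [hΨ0] at hmap
  rw [nhds_prod_eq, ← hmap, ← Filter.map_id (f := 𝓝 ((c, 0) : QuarticCoeffs × ℝ)),
    Filter.prod_map_map_eq, eventually_map, ← nhds_prod_eq]
  have hcont : Continuous fun t : ((LinearCoeffs × LinearCoeffs) × C₀) × QuarticCoeffs × ℝ =>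
      ((t.1.1, ‖t.1.2‖, t.2.1) : (LinearCoeffs × LinearCoeffs) × ℝ × QuarticCoeffs) := by fun_prop
  have hc' : ∀ᶠ x in 𝓝 (((0, 0), 0, c) : (LinearCoeffs × LinearCoeffs) × ℝ × QuarticCoeffs),
      eval (crossProduct (a + x.1.1) (b + x.1.2)) (quarticPoly x.2.2) ≠ 0 := by
    refine (Continuous.eval_quarticPoly (by fun_prop)
      continuous_snd.snd).continuousAt.eventually_ne ?_
    simpa using hc
  have h0 : ((0 : (LinearCoeffs × LinearCoeffs) × C₀).1, ‖(0 : (LinearCoeffs × LinearCoeffs) × C₀).2‖,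
      c) = ((0, 0), 0, c) := by simp; rfl
  have key := hcont.tendsto ((0 : (LinearCoeffs × LinearCoeffs) × C₀), c, (0 : ℝ))
  simp only at key
  rw [h0] at key
  filter_upwards [key.eventually hev, key.eventually hc'] with t ht htc heq
  obtain ⟨⟨⟨l, m⟩, r⟩, c', σ⟩ := t
  simp only [id, Ψ] at heq ht htc ⊢
  by_cases hr : r = 0
  · have hd := disc_add (a + l) (b + m) 0 0
    subst hr
    simp only [zero_smul, add_zero, ne_eq, OfNat.ofNat_ne_zero, not_false_eq_true, zero_pow] at hd
    simp only [ZeroMemClass.coe_zero, add_zero, hd] at heq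
    have h1 := congrArg (fun q => eval (crossProduct (a + l) (b + m)) (quarticPoly q)) heq
    rw [map_zero, map_zero, map_smul, smul_eq_C_mul, map_mul, eval_C] at h1
    exact (mul_eq_zero.1 h1.symm).resolve_right htc
  · exfalso
    have hn : ‖r‖ ≠ 0 := norm_ne_zero_iff.2 hr
    have hrK : ‖r‖⁻¹ • (r : Fin 3 → ConicCoeffs) ∈ K :=
      ⟨C₀.smul_mem _ r.2, by rw [norm_smul, norm_inv, norm_norm]; exact inv_mul_cancel₀ hn⟩
    refine ht _ hrK ?_
    have hrr : (r : Fin 3 → ConicCoeffs) = ‖r‖ • (‖r‖⁻¹ • (r : Fin 3 → ConicCoeffs)) := by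
      rw [smul_inv_smul₀ hn]
    rw [hrr, disc_add] at heq
    generalize ‖r‖⁻¹ • (r : Fin 3 → ConicCoeffs) = r' at heq hrK
    have h1 := congrArg (fun q => eval (crossProduct (a + l) (b + m)) (quarticPoly q)) heq
    simp only [G]
    generalize a + l = a' at h1 heq ⊢
    generalize b + m = b' at h1 heq ⊢
    simp only [map_add, map_smul, smul_eq_C_mul, map_mul, eval_C, eval_discLin, mul_zero,
      zero_add] at h1
    refine smul_right_injective _ hn ?_
    ext i
    have h2 := congrFun heq i
    simp only [Pi.add_apply, Pi.smul_apply, smul_eq_mul, Pi.sub_apply, Pi.zero_apply] at h2 ⊢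
    linear_combination eval (crossProduct a' b') (quarticPoly c') * h2 - c' i * h1

lemma conicMul_self_eq_zero {q : ConicCoeffs} (h : conicMul q q = 0) : q = 0 := by
  apply conicPoly_injective
  have := congrArg quarticPoly h
  rw [quarticPoly_conicMul, map_zero, mul_self_eq_zero] at this
  rw [this, map_zero]

lemma eq_zero_or_eq_zero_of_conicMul_eq_zero {q r : ConicCoeffs} (h : conicMul q r = 0) :
    q = 0 ∨ r = 0 := by
  have := congrArg quarticPoly h
  rw [quarticPoly_conicMul, map_zero, mul_eq_zero] at this
  exact this.imp (fun h => conicPoly_injective (by rw [h, map_zero]))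
    fun h => conicPoly_injective (by rw [h, map_zero])

lemma eq_zero_of_sum_conicMul_self_eq_zero {p : Fin 3 → ConicCoeffs}
    (h : ∑ i, conicMul (p i) (p i) = 0) : p = 0 := by
  ext1 i
  apply conicPoly_injective
  rw [Pi.zero_apply, map_zero]
  refine MvPolynomial.funext fun x => ?_
  have h1 := congrArg (fun q => eval x (quarticPoly q)) h
  simp only [map_sum, quarticPoly_conicMul, map_mul, map_zero] at h1
  have h2 := (Finset.sum_eq_zero_iff_of_nonneg fun i _ => mul_self_nonneg _).1 h1 i
    (Finset.mem_univ i)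
  simpa using h2

lemma IsSign.cases {s : Fin 3 → ℝ} (hs : IsSign s) :
    ∃ ε : ℝ, (ε = 1 ∨ ε = -1) ∧ ((∀ i, s i = ε) ∨ ∃ i j k : Fin 3, i ≠ j ∧ j ≠ k ∧ i ≠ k ∧
      ∀ p, squareSum s p =
        ε • (conicMul (p i) (p i) + conicMul (p j) (p j) - conicMul (p k) (p k))) := by
  have key : ∀ p, squareSum s p = s 0 • conicMul (p 0) (p 0) + s 1 • conicMul (p 1) (p 1) +
      s 2 • conicMul (p 2) (p 2) := fun p => by simp [squareSum, Fin.sum_univ_three]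
  rcases hs 0 with h0 | h0 <;> rcases hs 1 with h1 | h1 <;> rcases hs 2 with h2 | h2
  · exact ⟨1, by simp, .inl fun i => by fin_cases i <;> simpa⟩
  · exact ⟨1, by simp, .inr ⟨0, 1, 2, by decide, by decide, by decide, fun p => by
      rw [key, h0, h1, h2]; module⟩⟩
  · exact ⟨1, by simp, .inr ⟨0, 2, 1, by decide, by decide, by decide, fun p => by
      rw [key, h0, h1, h2]; module⟩⟩
  · exact ⟨-1, by simp, .inr ⟨1, 2, 0, by decide, by decide, by decide, fun p => by
      rw [key, h0, h1, h2]; module⟩⟩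
  · exact ⟨1, by simp, .inr ⟨1, 2, 0, by decide, by decide, by decide, fun p => by
      rw [key, h0, h1, h2]; module⟩⟩
  · exact ⟨-1, by simp, .inr ⟨0, 2, 1, by decide, by decide, by decide, fun p => by
      rw [key, h0, h1, h2]; module⟩⟩
  · exact ⟨-1, by simp, .inr ⟨0, 1, 2, by decide, by decide, by decide, fun p => by
      rw [key, h0, h1, h2]; module⟩⟩
  · exact ⟨-1, by simp, .inl fun i => by fin_cases i <;> simpa⟩

lemma eventually_eq_zero_of_squareSum_eq {s : Fin 3 → ℝ} (hs : IsSign s) {p : Fin 3 → ConicCoeffs}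
    (hp : IsOrthogonal p) (hp0 : p ≠ 0) {c : QuarticCoeffs}
    (hc : ∀ x : Fin 3 → ℝ, x ≠ 0 → 0 < eval x (quarticPoly c)) :
    ∀ᶠ t : (QuarticCoeffs × ℝ) × (Fin 3 → ConicCoeffs) in 𝓝 ((c, 0), p),
      squareSum s t.2 = t.1.2 • t.1.1 → t.1.2 = 0 := by
  by_cases hz : squareSum s p = 0
  swap
  · have hcont : Continuous fun t : (QuarticCoeffs × ℝ) × (Fin 3 → ConicCoeffs) =>
        squareSum s t.2 - t.1.2 • t.1.1 :=
      ((continuous_squareSum s).comp continuous_snd).sub (by fun_prop)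
    filter_upwards [hcont.continuousAt.eventually_ne (y := 0) (by simpa using hz)] with t ht h
    exact absurd (sub_eq_zero.2 h) ht
  obtain ⟨ε, hε, h | ⟨i, j, k, hij, hjk, hik, h⟩⟩ := hs.cases
  · have hε0 : ε ≠ 0 := by rcases hε with rfl | rfl <;> simp
    refine absurd (eq_zero_of_sum_conicMul_self_eq_zero ?_) hp0
    rw [squareSum] at hz
    simp only [h, ← Finset.smul_sum] at hz
    exact (smul_eq_zero.1 hz).resolve_left hε0
  have hε0 : ε ≠ 0 := by rcases hε with rfl | rfl <;> simp
  have hεε : ε * ε = 1 := by rcases hε with rfl | rfl <;> simp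
  have hall : ∀ n, n = i ∨ n = j ∨ n = k := by clear! s p c ε; decide +revert
  have h0 : conicMul (p i) (p i) + conicMul (p j) (p j) - conicMul (p k) (p k) = 0 := by
    have := h p
    rw [hz] at this
    exact (smul_eq_zero.1 this.symm).resolve_left hε0
  have hdisc : ∀ q : Fin 3 → ConicCoeffs, disc ![q k - q i, q j, q k + q i] =
      -(conicMul (q i) (q i) + conicMul (q j) (q j) - conicMul (q k) (q k)) := by
    intro q
    simp only [disc, cons_val_zero, cons_val_one, cons_val, map_sub, map_add,
      LinearMap.sub_apply, conicMul_comm (q i) (q k)]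
    abel
  have hik0 : ∀ r : ℝ, p k = r • p i → p j = 0 → False := by
    intro r hr hj
    have hk : p k = 0 := by
      have := hp hik.symm
      rw [← dotProduct_self_eq_zero]
      nth_rewrite 2 [hr]
      rw [dotProduct_smul, this, smul_zero]
    have hi : p i = 0 := by
      rw [hj, hk] at h0
      exact conicMul_self_eq_zero (by simpa using h0)
    refine hp0 (funext fun n => ?_)
    rcases hall n with rfl | rfl | rfl <;> simp [hi, hj, hk]
  have hA : p k - p i ≠ 0 := by
    intro hA
    rw [sub_eq_zero] at hA
    have hk : p i ⬝ᵥ p k = 0 := hp hik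
    rw [hA, dotProduct_self_eq_zero] at hk
    refine hik0 1 (by simpa using hA) (conicMul_self_eq_zero ?_)
    simpa [hA] using h0
  have hAC : ∀ r : ℝ, p j ≠ r • (p k - p i) := by
    intro r hr
    have hj : p j = 0 := by
      rw [← dotProduct_self_eq_zero]
      nth_rewrite 2 [hr]
      rw [dotProduct_smul, dotProduct_sub, hp hjk, hp hij.symm, sub_zero, smul_zero]
    have h2 := hdisc p
    rw [h0, neg_zero] at h2
    simp only [disc, cons_val_zero, cons_val_one, cons_val, hj, map_zero, sub_zero] at h2
    rcases eq_zero_or_eq_zero_of_conicMul_eq_zero h2 with h3 | h3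
    · exact hA h3
    · exact hik0 (-1) (by rw [neg_smul, one_smul]; exact eq_neg_of_add_eq_zero_left h3) hj
  obtain ⟨δ, hδ, a, b, ha, hc', hb⟩ := exists_linMul_of_conicMul_eq hA hAC
    (B := p k + p i) (by
      have h2 := hdisc p
      rw [h0, neg_zero] at h2
      simpa [disc, sub_eq_zero] using h2)
  have hδδ : δ * δ = 1 := by rcases hδ with rfl | rfl <;> simp
  have hab : LinearIndependent ℝ ![a, b] := by
    have ha0 : a ≠ 0 := by
      rintro rfl
      exact hA (by rw [ha]; simp)
    rw [LinearIndependent.pair_iff' ha0]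
    rintro r rfl
    refine hAC r ?_
    rw [hc', ha, map_smul, smul_comm]
  have hev := eventually_eq_zero_of_disc_eq hab
    (hc _ (crossProduct_ne_zero_iff_linearIndependent.2 hab)).ne'
  let F : (QuarticCoeffs × ℝ) × (Fin 3 → ConicCoeffs) →
      (Fin 3 → ConicCoeffs) × QuarticCoeffs × ℝ := fun t =>
    (δ • ![t.2 k - t.2 i, t.2 j, t.2 k + t.2 i], t.1.1, -ε * t.1.2)
  have hF : Continuous F := by
    have h1 : Continuous fun t : (QuarticCoeffs × ℝ) × (Fin 3 → ConicCoeffs) =>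
        (![t.2 k - t.2 i, t.2 j, t.2 k + t.2 i] : Fin 3 → ConicCoeffs) := by
      refine continuous_pi fun n => ?_
      fin_cases n <;> simp <;> fun_prop
    have h2 : Continuous fun t : (QuarticCoeffs × ℝ) × (Fin 3 → ConicCoeffs) =>
        ((t.1.1, -ε * t.1.2) : QuarticCoeffs × ℝ) := by fun_prop
    have h3 := (h1.const_smul δ).prodMk h2
    exact h3
  have hF0 : F ((c, 0), p) = (![linMul a a, linMul a b, linMul b b], c, 0) := by
    simp only [F, ha, hc', hb, mul_zero]
    congr 1
    ext1 n
    fin_cases n <;> simp [smul_smul, hδδ]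
  have hdδ : ∀ q, disc (δ • q) = disc q := by
    intro q
    simp [disc, smul_smul, hδδ]
  have := hF.tendsto ((c, 0), p)
  rw [hF0] at this
  filter_upwards [this.eventually hev] with t ht heq
  have h1 := ht (by
    simp only [F]
    rw [hdδ, hdisc, mul_smul, ← heq, h, smul_smul, neg_mul, hεε]
    simp)
  simpa [F, hε0] using h1

lemma isClosed_setOf_isOrthogonal : IsClosed {p | IsOrthogonal p} := by
  simp only [IsOrthogonal, Pairwise, Set.ofPred_forall]
  refine isClosed_iInter fun i => isClosed_iInter fun j => isClosed_iInter fun _ =>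
    isClosed_eq ?_ continuous_const
  exact Continuous.dotProduct (continuous_apply i) (continuous_apply j)

lemma squareSum_smul (s : Fin 3 → ℝ) (r : ℝ) (p : Fin 3 → ConicCoeffs) :
    squareSum s (r • p) = r ^ 2 • squareSum s p := by
  simp only [squareSum, Pi.smul_apply, map_smul, LinearMap.smul_apply, Finset.smul_sum, smul_smul]
  exact Finset.sum_congr rfl fun i _ => by congr 1; ring

/-- Orthogonal representations of positive quartic forms near `c` are uniformly bounded. -/
lemma exists_eventually_norm_le {c : QuarticCoeffs}
    (hc : ∀ x : Fin 3 → ℝ, x ≠ 0 → 0 < eval x (quarticPoly c)) :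
    ∃ M, ∀ᶠ c' in 𝓝 c, ∀ s, IsSign s → ∀ p, IsOrthogonal p → squareSum s p = c' → ‖p‖ ≤ M := by
  let K : Set (Fin 3 → ConicCoeffs) := {p | IsOrthogonal p ∧ ‖p‖ = 1}
  have hK : IsCompact K := by
    refine Metric.isCompact_of_isClosed_isBounded (isClosed_setOf_isOrthogonal.inter
      (isClosed_eq continuous_norm continuous_const)) ?_
    refine (Metric.isBounded_closedBall (x := (0 : Fin 3 → ConicCoeffs)) (r := 1)).subset ?_
    intro r hr
    simpa using hr.2.le
  have hev : ∀ᶠ x : QuarticCoeffs × ℝ in 𝓝 (c, 0), ∀ s ∈ {s | IsSign s}, ∀ p ∈ K,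
      squareSum s p = x.2 • x.1 → x.2 = 0 := by
    rw [eventually_all_finite finite_isSign]
    intro s hs
    refine hK.eventually_forall_of_forall_eventually fun p hp => ?_
    refine eventually_eq_zero_of_squareSum_eq hs hp.1 ?_ hc
    rintro rfl
    simpa using hp.2
  rw [nhds_prod_eq, eventually_prod_iff] at hev
  obtain ⟨P, hP, Q, hQ, hPQ⟩ := hev
  have ht : Tendsto (fun t : ℝ => t⁻¹ ^ 2) atTop (𝓝 0) := by
    simpa using (tendsto_inv_atTop_zero (𝕜 := ℝ)).pow 2
  obtain ⟨M, hM⟩ := eventually_atTop.1 (ht.eventually hQ)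
  refine ⟨max M 1, hP.mono fun c' hc' s hs p hp h => ?_⟩
  by_contra! hlt
  have hM' := max_lt_iff.1 hlt
  have hn : ‖p‖ ≠ 0 := (zero_lt_one.trans hM'.2).ne'
  have := hPQ hc' (hM _ hM'.1.le) s hs (‖p‖⁻¹ • p) ⟨fun i j hij => ?_, ?_⟩ ?_
  · simp [hn] at this
  · simp [dotProduct_smul, smul_dotProduct, hp hij]
  · rw [norm_smul, norm_inv, norm_norm, inv_mul_cancel₀ hn]
  · rw [squareSum_smul, h]

lemma map_squareSum_nhds {s : Fin 3 → ℝ} (hs : IsSign s) {p : Fin 3 → ConicCoeffs}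
    (hp : Function.Surjective (combine p)) :
    Filter.map (squareSum s) (𝓝 p) = 𝓝 (squareSum s p) := by
  let D : (Fin 3 → ConicCoeffs) →L[ℝ] QuarticCoeffs := LinearMap.toContinuousLinearMap
    ((combine p).comp (LinearMap.pi fun i => (2 * s i) • LinearMap.proj i))
  have hD : HasStrictFDerivAt (squareSum s) D p := by
    have h1 : ∀ i, HasStrictFDerivAt (fun q : Fin 3 → ConicCoeffs => q i)
        (ContinuousLinearMap.proj i : (Fin 3 → ConicCoeffs) →L[ℝ] ConicCoeffs) p :=
      fun i => (ContinuousLinearMap.proj (R := ℝ) (φ := fun _ : Fin 3 => ConicCoeffs)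
        i).hasStrictFDerivAt
    have h2 : ∀ i, HasStrictFDerivAt (fun q : Fin 3 → ConicCoeffs => conicMul (q i) (q i))
        ((2 : ℝ) • LinearMap.toContinuousLinearMap ((conicMul (p i)).comp (LinearMap.proj i))) p :=
      fun i => hasStrictFDerivAt_bilinear conicMul (h1 i) (h1 i) fun v => by
        simp [two_smul, conicMul_comm]
    have h3 := HasStrictFDerivAt.fun_sum (u := Finset.univ) fun i _ => (h2 i).const_smul (s i)
    refine h3.congr_fderiv (ContinuousLinearMap.ext fun v => ?_)
    simp only [D, combine_eq_sum, _root_.sum_apply, _root_.smul_apply,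
      LinearMap.coe_toContinuousLinearMap', LinearMap.comp_apply, LinearMap.proj_apply,
      LinearMap.pi_apply, LinearMap.smul_apply, map_smul, smul_smul, mul_comm]
  refine hD.map_nhds_eq_of_surj (LinearMap.range_eq_top.2 fun y => ?_)
  obtain ⟨h, rfl⟩ := hp y
  refine ⟨fun i => (2 * s i)⁻¹ • h i, ?_⟩
  have : ∀ i, (2 * s i) • (2 * s i)⁻¹ • h i = h i := fun i =>
    smul_inv_smul₀ (mul_ne_zero two_ne_zero (hs.ne_zero i)) _
  simp only [D, ContinuousLinearMap.coe_coe, LinearMap.coe_toContinuousLinearMap',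
    LinearMap.comp_apply]
  congr 1
  ext1 i
  simpa only [LinearMap.pi_apply, LinearMap.smul_apply, LinearMap.proj_apply] using this i

lemma eventually_linearIndependent {p : Fin 3 → ConicCoeffs} (hp : LinearIndependent ℝ p) :
    ∀ᶠ q in 𝓝 p, LinearIndependent ℝ q :=
  isOpen_setOfPred_linearIndependent.mem_nhds hp

/-- Near a representation, representations of the same form have the same span. -/
lemma exists_nhds_span_eq {s : Fin 3 → ℝ} (hs : IsSign s) {p : Fin 3 → ConicCoeffs}
    (hp : Function.Surjective (combine p)) :
    ∃ U ∈ 𝓝 p, ∀ q ∈ U, ∀ q' ∈ U, squareSum s q = squareSum s q' →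
      Submodule.span ℝ (Set.range q) = Submodule.span ℝ (Set.range q') := by
  have hlin := eventually_linearIndependent (linearIndependent_of_surjective hp)
  have hadd : Function.Surjective (combine (p + p)) := by
    intro y
    obtain ⟨h, hh⟩ := hp ((2 : ℝ)⁻¹ • y)
    refine ⟨h, ?_⟩
    have : combine (p + p) h = (2 : ℝ) • combine p h := by
      simp [combine_eq_sum, Finset.sum_add_distrib, two_smul]
    rw [this, hh, smul_inv_smul₀ two_ne_zero]
  have hcont : Continuous fun x : (Fin 3 → ConicCoeffs) × (Fin 3 → ConicCoeffs) => x.1 + x.2 := by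
    fun_prop
  have hopen : {q | Function.Surjective (combine q)} ∈ 𝓝 (p + p) :=
    isOpen_setOf_surjective_combine.mem_nhds hadd
  have hev := hcont.tendsto (p, p) hopen
  rw [Filter.mem_map, nhds_prod_eq] at hev
  obtain ⟨U, hU, V, hV, h⟩ := Filter.mem_prod_iff.1 hev
  refine ⟨(U ∩ V) ∩ {q | LinearIndependent ℝ q}, inter_mem (inter_mem hU hV) hlin,
    fun q hq q' hq' heq => ?_⟩
  have hsur : Function.Surjective (combine (q + q')) := h (Set.mk_mem_prod hq.1.1 hq'.1.2)
  have hq2 : LinearIndependent ℝ q := hq.2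
  have hq2' : LinearIndependent ℝ q' := hq'.2
  exact span_eq_of_squareSum_eq hs hq2 hq2' hsur heq

lemma eventually_not_span_le {p p' : Fin 3 → ConicCoeffs} (hp : LinearIndependent ℝ p)
    (hne : ¬ Submodule.span ℝ (Set.range p') ≤ Submodule.span ℝ (Set.range p)) :
    ∀ᶠ x in 𝓝 (p, p'),
      Submodule.span ℝ (Set.range x.1) ≠ Submodule.span ℝ (Set.range x.2) := by
  obtain ⟨j, hj⟩ : ∃ j, p' j ∉ Submodule.span ℝ (Set.range p) := by
    by_contra! h
    exact hne (Submodule.span_le.2 (by rintro _ ⟨j, rfl⟩; exact h j))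
  have hlin : LinearIndependent ℝ (Fin.cons (p' j) p : Fin 4 → ConicCoeffs) :=
    linearIndependent_finCons.2 ⟨hp, hj⟩
  have hcont : Continuous fun x : (Fin 3 → ConicCoeffs) × (Fin 3 → ConicCoeffs) =>
      (Fin.cons (x.2 j) x.1 : Fin 4 → ConicCoeffs) := by
    refine continuous_pi fun i => ?_
    refine Fin.cases ?_ (fun i => ?_) i
    · simp only [Fin.cons_zero]; fun_prop
    · simp only [Fin.cons_succ]; fun_prop
  filter_upwards [hcont.continuousAt.eventually
    (isOpen_setOfPred_linearIndependent.mem_nhds hlin)] with x hx heq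
  exact (linearIndependent_finCons.1 hx).2 (heq ▸ Submodule.subset_span ⟨j, rfl⟩)

lemma eventually_span_ne {p p' : Fin 3 → ConicCoeffs} (hp : LinearIndependent ℝ p)
    (hp' : LinearIndependent ℝ p')
    (hne : Submodule.span ℝ (Set.range p) ≠ Submodule.span ℝ (Set.range p')) :
    ∀ᶠ x in 𝓝 (p, p'),
      Submodule.span ℝ (Set.range x.1) ≠ Submodule.span ℝ (Set.range x.2) := by
  by_cases h : Submodule.span ℝ (Set.range p') ≤ Submodule.span ℝ (Set.range p)
  · have := eventually_not_span_le hp' fun h' => hne (le_antisymm h' h)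
    filter_upwards [continuous_swap.tendsto (p, p') |>.eventually this] with x hx
    exact hx.symm
  · exact eventually_not_span_le hp h

lemma finite_repSpans {c : QuarticCoeffs} (hc : IsSmoothPositive c) : (repSpans c).Finite := by
  obtain ⟨M, hM⟩ := exists_eventually_norm_le hc.pos
  have hM := hM.self_of_nhds
  have hsub : repSpans c ⊆ ⋃ s ∈ {s | IsSign s}, (fun p => Submodule.span ℝ (Set.range p)) ''
      {p | IsOrthogonal p ∧ squareSum s p = c} := by
    rintro W ⟨s, hs, p, rfl, rfl⟩
    obtain ⟨s', q, hs', hq, hsum, hspan⟩ := exists_isOrthogonal hc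
    exact Set.mem_biUnion hs' ⟨q, ⟨hq, hsum⟩, hspan⟩
  refine (finite_isSign.biUnion fun s hs => ?_).subset hsub
  have hK : IsCompact {p | IsOrthogonal p ∧ squareSum s p = c} := by
    refine Metric.isCompact_of_isClosed_isBounded (isClosed_setOf_isOrthogonal.inter
      (isClosed_eq (continuous_squareSum s) continuous_const)) ?_
    refine (Metric.isBounded_closedBall (x := (0 : Fin 3 → ConicCoeffs)) (r := M)).subset ?_
    intro p hp
    simpa using hM s hs p hp.1 hp.2
  have hU : ∀ p ∈ {p | IsOrthogonal p ∧ squareSum s p = c}, ∃ U ∈ 𝓝 p, ∀ q ∈ U,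
      squareSum s q = c → Submodule.span ℝ (Set.range q) = Submodule.span ℝ (Set.range p) := by
    rintro p ⟨-, rfl⟩
    obtain ⟨U, hU, h⟩ := exists_nhds_span_eq hs hc.surjective_combine
    exact ⟨U, hU, fun q hq hsum => h q hq p (mem_of_mem_nhds hU) hsum⟩
  choose! U hU hUspan using hU
  obtain ⟨t, ht, hcov⟩ := hK.elim_nhds_subcover U hU
  refine (t.finite_toSet.image fun p => Submodule.span ℝ (Set.range p)).subset ?_
  rintro _ ⟨p, hp, rfl⟩
  obtain ⟨q, hq, hpq⟩ := Set.mem_iUnion₂.1 (hcov hp)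
  exact ⟨q, hq, (hUspan q (ht q hq) p hpq hp.2).symm⟩

/-- The number of spans of representations is locally constant. -/
lemma eventually_ncard_repSpans_eq {c : QuarticCoeffs} (hc : IsSmoothPositive c) :
    ∀ᶠ c' in 𝓝 c, IsSmoothPositive c' → (repSpans c').ncard = (repSpans c).ncard := by
  have : Finite (repSpans c) := finite_repSpans hc
  choose s hs p hsum hspan using fun W : repSpans c => W.2
  have hsur : ∀ W, Function.Surjective (combine (p W)) := fun W =>
    IsSmoothPositive.surjective_combine (s := s W) (by rwa [hsum W])
  choose U₁ hU₁ huniq using fun W => exists_nhds_span_eq (hs W) (hsur W)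
  have hsep : ∀ W W', ∃ A ∈ 𝓝 (p W), ∃ B ∈ 𝓝 (p W'), ∀ q ∈ A, ∀ q' ∈ B, W ≠ W' →
      Submodule.span ℝ (Set.range q) ≠ Submodule.span ℝ (Set.range q') := by
    intro W W'
    by_cases hW : W = W'
    · exact ⟨Set.univ, univ_mem, Set.univ, univ_mem, fun _ _ _ _ h => absurd hW h⟩
    · have := eventually_span_ne (linearIndependent_of_surjective (hsur W))
        (linearIndependent_of_surjective (hsur W'))
        (by rw [hspan, hspan]; exact fun h => hW (Subtype.ext h))
      obtain ⟨A, hA, B, hB, hAB⟩ := mem_nhds_prod_iff.1 this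
      exact ⟨A, hA, B, hB, fun q hq q' hq' _ => hAB (Set.mk_mem_prod hq hq')⟩
  choose A hA B hB hAB using hsep
  let U := fun W => U₁ W ∩ ((⋂ W', A W W') ∩ ⋂ W', B W' W)
  have hU : ∀ W, U W ∈ 𝓝 (p W) := fun W =>
    inter_mem (hU₁ W) (inter_mem (iInter_mem.2 fun W' => hA W W') (iInter_mem.2 fun W' => hB W' W))
  have hopen : ∀ᶠ c' in 𝓝 c, ∀ W, ∃ q ∈ U W, squareSum (s W) q = c' := by
    rw [eventually_all]
    intro W
    have := image_mem_map (m := squareSum (s W)) (hU W)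
    rw [map_squareSum_nhds (hs W) (hsur W), hsum W] at this
    exact this
  obtain ⟨M, hM⟩ := exists_eventually_norm_le hc.pos
  have hK : IsCompact {q | IsOrthogonal q ∧ ‖q‖ ≤ M} := by
    refine Metric.isCompact_of_isClosed_isBounded (isClosed_setOf_isOrthogonal.inter
      (isClosed_le continuous_norm continuous_const)) ?_
    refine (Metric.isBounded_closedBall (x := (0 : Fin 3 → ConicCoeffs)) (r := M)).subset ?_
    intro p hp
    simpa using hp.2
  have hcover : ∀ᶠ c' in 𝓝 c, ∀ s' ∈ {s | IsSign s}, ∀ p' ∈ {q | IsOrthogonal q ∧ ‖q‖ ≤ M},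
      squareSum s' p' = c' → ∃ W, ∃ q ∈ U W, squareSum (s W) q = c' ∧
        Submodule.span ℝ (Set.range q) = Submodule.span ℝ (Set.range p') := by
    rw [eventually_all_finite finite_isSign]
    intro s' hs'
    refine hK.eventually_forall_of_forall_eventually fun p' _ => ?_
    by_cases heq : squareSum s' p' = c
    · let W : repSpans c := ⟨_, s', hs', p', heq, rfl⟩
      obtain ⟨N, hN, hmix, hiso⟩ := exists_isometry (s := s W) (s' := s') (p := p') (q := p W)
        (IsSmoothPositive.surjective_combine (s := s') (by rwa [heq]))
        (linearIndependent_of_surjective (hsur W)) (hspan W).le (by rw [hsum, heq])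
      have hcont : Continuous fun x : QuarticCoeffs × (Fin 3 → ConicCoeffs) => mix N x.2 := by
        unfold mix
        fun_prop
      have := hcont.tendsto (c, p')
      simp only [hmix] at this
      filter_upwards [this.eventually (hU W)] with x hx hx'
      exact ⟨W, _, hx, by rw [hiso, hx'], span_range_mix hN _⟩
    · have hcont : Continuous fun x : QuarticCoeffs × (Fin 3 → ConicCoeffs) =>
          squareSum s' x.2 - x.1 := ((continuous_squareSum s').comp continuous_snd).sub
            continuous_fst
      filter_upwards [hcont.continuousAt.eventually_ne (y := 0) (sub_ne_zero.2 heq)] with x hx hx'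
      exact absurd (sub_eq_zero.2 hx') hx
  filter_upwards [hopen, hM, hcover] with c' h1 h2 h3 hc'
  choose Q hQU hQ using h1
  let φ : repSpans c → repSpans c' := fun W => ⟨_, s W, hs W, Q W, hQ W, rfl⟩
  have hφ : Function.Bijective φ := by
    constructor
    · intro W W' h
      by_contra hne
      refine hAB W W' (Q W) ?_ (Q W') ?_ hne (congrArg Subtype.val h)
      · exact Set.mem_iInter.1 (hQU W).2.1 W'
      · exact Set.mem_iInter.1 (hQU W').2.2 W
    · rintro ⟨V, s', hs', p', hp', rfl⟩
      obtain ⟨s'', q, hs'', hq, hq', hspan'⟩ := exists_isOrthogonal (hp' ▸ hc')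
      rw [hp'] at hq'
      obtain ⟨W, r, hrU, hr, hrspan⟩ := h3 s'' hs'' q ⟨hq, h2 s'' hs'' q hq hq'⟩ hq'
      refine ⟨W, Subtype.ext ?_⟩
      exact (huniq W _ (hQU W).1 _ hrU.1 ((hQ W).trans hr.symm)).trans (hrspan.trans hspan')
  rw [← Nat.card_coe_set_eq, ← Nat.card_coe_set_eq]
  exact (Nat.card_congr (Equiv.ofBijective φ hφ)).symm

lemma eq_zero_of_add_mul_eq_zero {w : ℂ} (hw : w.im ≠ 0) {r s : ℝ}
    (h : (r : ℂ) + s * w = 0) : r = 0 ∧ s = 0 := by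
  have him := congrArg Complex.im h
  have hre := congrArg Complex.re h
  simp at him hre
  have hs : s = 0 := him.resolve_right hw
  subst hs
  exact ⟨by simpa using hre, rfl⟩

lemma aeval_pderiv_zero_quarticPoly (c : QuarticCoeffs) (z : Fin 3 → ℂ) :
    aeval z (pderiv 0 (quarticPoly c)) = 4 * c 0 * z 0 ^ 3 + 3 * c 5 * z 0 ^ 2 * z 2 +
      c 6 * z 2 ^ 3 + 3 * c 7 * z 0 ^ 2 * z 1 + c 8 * z 1 ^ 3 + 2 * c 10 * z 0 * z 2 ^ 2 +
      2 * c 11 * z 0 * z 1 ^ 2 + 2 * c 12 * z 0 * z 1 * z 2 + c 13 * z 1 ^ 2 * z 2 +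
      c 14 * z 1 * z 2 ^ 2 := by
  simp [quarticPoly_eq, pderiv_X]
  ring

lemma aeval_pderiv_one_quarticPoly (c : QuarticCoeffs) (z : Fin 3 → ℂ) :
    aeval z (pderiv 1 (quarticPoly c)) = 4 * c 1 * z 1 ^ 3 + 3 * c 3 * z 1 ^ 2 * z 2 +
      c 4 * z 2 ^ 3 + c 7 * z 0 ^ 3 + 3 * c 8 * z 0 * z 1 ^ 2 + 2 * c 9 * z 1 * z 2 ^ 2 +
      2 * c 11 * z 0 ^ 2 * z 1 + c 12 * z 0 ^ 2 * z 2 + 2 * c 13 * z 0 * z 1 * z 2 +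
      c 14 * z 0 * z 2 ^ 2 := by
  simp [quarticPoly_eq, pderiv_X]
  ring

lemma aeval_pderiv_two_quarticPoly (c : QuarticCoeffs) (z : Fin 3 → ℂ) :
    aeval z (pderiv 2 (quarticPoly c)) = 4 * c 2 * z 2 ^ 3 + c 3 * z 1 ^ 3 +
      3 * c 4 * z 1 * z 2 ^ 2 + c 5 * z 0 ^ 3 + 3 * c 6 * z 0 * z 2 ^ 2 + 2 * c 9 * z 1 ^ 2 * z 2 +
      2 * c 10 * z 0 ^ 2 * z 2 + c 12 * z 0 ^ 2 * z 1 + c 13 * z 0 * z 1 ^ 2 +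
      2 * c 14 * z 0 * z 1 * z 2 := by
  simp [quarticPoly_eq, pderiv_X]
  ring

/-- The common zeros of the partial derivatives of a quartic form. -/
def singularPoints (c : QuarticCoeffs) : Set (Fin 3 → ℂ) :=
  {z | ∀ i, aeval z (pderiv i (quarticPoly c)) = 0}

/-- A parametrization of the quartic forms that are singular at two conjugate points
of the line `z = p₀ x + p₁ y`. -/
noncomputable def nodalQuartic (p : Fin 13 → ℝ) : QuarticCoeffs :=
  conicMul ![p 2, 1, 0, 0, 0, p 3]
      (p 4 • ![p 2, 1, 0, 0, 0, p 3] + linMul ![-p 0, -p 1, 1] ![p 5, p 6, 0]) +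
    conicMul (linMul ![-p 0, -p 1, 1] ![-p 0, -p 1, 1]) ![p 7, p 8, p 9, p 10, p 11, p 12]

lemma eval_nodalQuartic (p : Fin 13 → ℝ) (x : Fin 3 → ℝ) :
    eval x (quarticPoly (nodalQuartic p)) =
      (p 2 * x 0 ^ 2 + p 3 * (x 0 * x 1) + x 1 ^ 2) *
        (p 4 * (p 2 * x 0 ^ 2 + p 3 * (x 0 * x 1) + x 1 ^ 2) +
          (x 2 - p 0 * x 0 - p 1 * x 1) * (p 5 * x 0 + p 6 * x 1)) +
      (x 2 - p 0 * x 0 - p 1 * x 1) ^ 2 *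
        (p 7 * x 0 ^ 2 + p 8 * x 1 ^ 2 + p 9 * x 2 ^ 2 + p 10 * (x 1 * x 2) +
          p 11 * (x 0 * x 2) + p 12 * (x 0 * x 1)) := by
  simp only [nodalQuartic, map_add, quarticPoly_conicMul, map_smul, conicPoly_linMul, map_mul,
    smul_eval]
  simp [conicPoly_eq, linPoly]
  ring

lemma exists_nodalQuartic_eq {c : QuarticCoeffs} {z : Fin 3 → ℂ} (hz : z ∈ singularPoints c)
    (hz0 : z 0 ≠ 0) (hw : (z 1 / z 0).im ≠ 0) : ∃ p, nodalQuartic p = c := by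
  obtain ⟨w, hzw⟩ : ∃ w, z 1 / z 0 = w := ⟨_, rfl⟩
  rw [hzw] at hw
  have hz1 : z 1 = w * z 0 := by rw [← hzw, div_mul_cancel₀ _ hz0]
  obtain ⟨s, t, hst⟩ : ∃ s t : ℝ, z 2 / z 0 = s + t * w := by
    refine ⟨(z 2 / z 0).re - (z 2 / z 0).im / w.im * w.re, (z 2 / z 0).im / w.im, ?_⟩
    apply Complex.ext <;> simp
    field_simp
  have hz2 : z 2 = (s + t * w) * z 0 := by rw [← hst, div_mul_cancel₀ _ hz0]
  obtain ⟨a, b, hab⟩ : ∃ a b : ℝ, w ^ 2 + b * w + a = 0 := by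
    refine ⟨w.re ^ 2 + w.im ^ 2, -2 * w.re, ?_⟩
    apply Complex.ext <;> simp [pow_two] <;> ring
  have h0 := hz 0
  have h1 := hz 1
  have h2 := hz 2
  rw [aeval_pderiv_zero_quarticPoly, hz1, hz2] at h0
  rw [aeval_pderiv_one_quarticPoly, hz1, hz2] at h1
  rw [aeval_pderiv_two_quarticPoly, hz1, hz2] at h2
  -- the restriction of `c` to the line, and of its derivative transverse to the line
  obtain ⟨f0, hf0⟩ : ∃ f0, f0 = c 0 + s * c 5 + s ^ 2 * c 10 + s ^ 3 * c 6 + s ^ 4 * c 2 := ⟨_, rfl⟩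
  obtain ⟨f1, hf1⟩ : ∃ f1, f1 = c 7 + t * c 5 + s * c 12 + 2 * s * t * c 10 + s ^ 2 * c 14 +
    3 * s ^ 2 * t * c 6 + s ^ 3 * c 4 + 4 * s ^ 3 * t * c 2 := ⟨_, rfl⟩
  obtain ⟨f2, hf2⟩ : ∃ f2, f2 = c 11 + t * c 12 + s * c 13 + t ^ 2 * c 10 + 2 * s * t * c 14 +
    s ^ 2 * c 9 + 3 * s * t ^ 2 * c 6 + 3 * s ^ 2 * t * c 4 + 6 * s ^ 2 * t ^ 2 * c 2 := ⟨_, rfl⟩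
  obtain ⟨f3, hf3⟩ : ∃ f3, f3 = c 8 + t * c 13 + s * c 3 + t ^ 2 * c 14 + 2 * s * t * c 9 +
    t ^ 3 * c 6 + 3 * s * t ^ 2 * c 4 + 4 * s * t ^ 3 * c 2 := ⟨_, rfl⟩
  obtain ⟨f4, hf4⟩ : ∃ f4, f4 = c 1 + t * c 3 + t ^ 2 * c 9 + t ^ 3 * c 4 + t ^ 4 * c 2 := ⟨_, rfl⟩
  obtain ⟨g0, hg0⟩ : ∃ g0, g0 = c 5 + 2 * s * c 10 + 3 * s ^ 2 * c 6 + 4 * s ^ 3 * c 2 := ⟨_, rfl⟩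
  obtain ⟨g1, hg1⟩ : ∃ g1, g1 = c 12 + 2 * t * c 10 + 2 * s * c 14 + 6 * s * t * c 6 +
    3 * s ^ 2 * c 4 + 12 * s ^ 2 * t * c 2 := ⟨_, rfl⟩
  obtain ⟨g2, hg2⟩ : ∃ g2, g2 = c 13 + 2 * t * c 14 + 2 * s * c 9 + 3 * t ^ 2 * c 6 +
    6 * s * t * c 4 + 12 * s * t ^ 2 * c 2 := ⟨_, rfl⟩
  obtain ⟨g3, hg3⟩ : ∃ g3, g3 = c 3 + 2 * t * c 9 + 3 * t ^ 2 * c 4 + 4 * t ^ 3 * c 2 := ⟨_, rfl⟩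
  have hF : (f0 : ℂ) + f1 * w + f2 * w ^ 2 + f3 * w ^ 3 + f4 * w ^ 4 = 0 := by
    have : (4 * z 0 ^ 4 : ℂ) * (f0 + f1 * w + f2 * w ^ 2 + f3 * w ^ 3 + f4 * w ^ 4) = 0 := by
      simp only [hf0, hf1, hf2, hf3, hf4]
      push_cast
      linear_combination z 0 * h0 + w * z 0 * h1 + (s + t * w) * z 0 * h2
    exact (mul_eq_zero.1 this).resolve_left (by simp [hz0])
  have hF' : (f1 : ℂ) + 2 * f2 * w + 3 * f3 * w ^ 2 + 4 * f4 * w ^ 3 = 0 := by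
    have : (z 0 ^ 3 : ℂ) * (f1 + 2 * f2 * w + 3 * f3 * w ^ 2 + 4 * f4 * w ^ 3) = 0 := by
      simp only [hf1, hf2, hf3, hf4]
      push_cast
      linear_combination h1 + t * h2
    exact (mul_eq_zero.1 this).resolve_left (by simp [hz0])
  have hG : (g0 : ℂ) + g1 * w + g2 * w ^ 2 + g3 * w ^ 3 = 0 := by
    have : (z 0 ^ 3 : ℂ) * (g0 + g1 * w + g2 * w ^ 2 + g3 * w ^ 3) = 0 := by
      simp only [hg0, hg1, hg2, hg3]
      push_cast
      linear_combination h2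
    exact (mul_eq_zero.1 this).resolve_left (by simp [hz0])
  obtain ⟨l0, hl0⟩ : ∃ l0, l0 = g2 - b * g3 := ⟨_, rfl⟩
  obtain ⟨q1, hq1⟩ : ∃ q1, q1 = f3 - b * f4 := ⟨_, rfl⟩
  obtain ⟨q0, hq0⟩ : ∃ q0, q0 = f2 - b * q1 - a * f4 := ⟨_, rfl⟩
  obtain ⟨hg, hg'⟩ := eq_zero_of_add_mul_eq_zero hw (r := g0 - a * l0)
    (s := g1 - b * l0 - a * g3) (by
      rw [hl0]; push_cast
      linear_combination hG - (g2 - b * g3 + g3 * w) * hab)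
  obtain ⟨hf, hf'⟩ := eq_zero_of_add_mul_eq_zero hw (r := f0 - a * q0)
    (s := f1 - b * q0 - a * q1) (by
      rw [hq0, hq1]; push_cast
      linear_combination hF - (f2 - b * (f3 - b * f4) - a * f4 + (f3 - b * f4) * w + f4 * w ^ 2)
        * hab)
  have hq : (q0 : ℂ) + q1 * w + f4 * w ^ 2 = 0 := by
    have hne : (2 * w + b : ℂ) ≠ 0 := fun h => by
      have := congrArg Complex.im h
      simp at this
      exact hw this
    refine (mul_eq_zero.1 (?_ : (2 * w + b : ℂ) * _ = 0)).resolve_left hne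
    have hfc : (f1 - b * q0 - a * q1 : ℂ) = 0 := by exact_mod_cast congrArg Complex.ofReal hf'
    have h0c : (q0 : ℂ) = f2 - b * q1 - a * f4 := by rw [hq0]; push_cast; ring
    have h1c : (q1 : ℂ) = f3 - b * f4 := by rw [hq1]; push_cast; ring
    have : (f1 : ℂ) = b * q0 + a * q1 := by linear_combination hfc
    have h2c : (f2 : ℂ) = q0 + b * q1 + a * f4 := by linear_combination -h0c
    have h3c : (f3 : ℂ) = q1 + b * f4 := by linear_combination -h1c
    rw [this, h2c, h3c] at hF'
    linear_combination hF' - (q1 + 2 * f4 * w) * hab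
  obtain ⟨hd, hd'⟩ := eq_zero_of_add_mul_eq_zero hw (r := q0 - a * f4) (s := q1 - b * f4) (by
      push_cast
      linear_combination hq - f4 * hab)
  refine ⟨![s, t, a, b, f4, l0, g3, c 10 + 2 * s * c 6 + 3 * s ^ 2 * c 2,
    c 9 + 2 * t * c 4 + 3 * t ^ 2 * c 2, c 2, c 4 + 2 * t * c 2, c 6 + 2 * s * c 2,
    c 14 + 2 * t * c 6 + 2 * s * c 4 + 6 * s * t * c 2], ?_⟩
  refine quarticPoly_injective (MvPolynomial.funext fun x => ?_)
  rw [eval_nodalQuartic]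
  simp only [quarticPoly_eq, map_add, map_mul, map_pow, eval_C, eval_X]
  simp only [Matrix.cons_val]
  subst hq0 hq1 hl0
  subst hf0 hf1 hf2 hf3 hf4 hg0 hg1 hg2 hg3
  linear_combination (-x 0 ^ 4) * hf - x 0 ^ 3 * x 1 * hf' -
    (a * x 0 ^ 2 + b * (x 0 * x 1) + x 1 ^ 2) * (x 0 ^ 2 * hd + x 0 * x 1 * hd') -
    (x 2 - s * x 0 - t * x 1) * (x 0 ^ 3 * hg + x 0 ^ 2 * x 1 * hg')

/-- The permutation of quartic coefficients induced by exchanging `y` and `z`. -/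
def swapYZ : Fin 15 → Fin 15 := ![0, 2, 1, 4, 3, 7, 8, 5, 6, 9, 11, 10, 12, 14, 13]

/-- The permutation of quartic coefficients induced by exchanging `x` and `z`. -/
def swapXZ : Fin 15 → Fin 15 := ![2, 1, 0, 8, 7, 6, 5, 4, 3, 11, 10, 9, 14, 13, 12]

lemma swapYZ_mem_singularPoints {c : QuarticCoeffs} {z : Fin 3 → ℂ} (hz : z ∈ singularPoints c) :
    ![z 0, z 2, z 1] ∈ singularPoints (c ∘ swapYZ) := by
  have h0 := hz 0
  have h1 := hz 1
  have h2 := hz 2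
  rw [aeval_pderiv_zero_quarticPoly] at h0
  rw [aeval_pderiv_one_quarticPoly] at h1
  rw [aeval_pderiv_two_quarticPoly] at h2
  refine Fin.forall_fin_succ.2 ⟨?_, Fin.forall_fin_succ.2 ⟨?_, Fin.forall_fin_one.2 ?_⟩⟩
  · rw [aeval_pderiv_zero_quarticPoly]
    simp [swapYZ]
    linear_combination h0
  · change aeval _ (pderiv 1 _) = 0
    rw [aeval_pderiv_one_quarticPoly]
    simp [swapYZ]
    linear_combination h2
  · change aeval _ (pderiv 2 _) = 0
    rw [aeval_pderiv_two_quarticPoly]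
    simp [swapYZ]
    linear_combination h1

lemma swapXZ_mem_singularPoints {c : QuarticCoeffs} {z : Fin 3 → ℂ} (hz : z ∈ singularPoints c) :
    ![z 2, z 1, z 0] ∈ singularPoints (c ∘ swapXZ) := by
  have h0 := hz 0
  have h1 := hz 1
  have h2 := hz 2
  rw [aeval_pderiv_zero_quarticPoly] at h0
  rw [aeval_pderiv_one_quarticPoly] at h1
  rw [aeval_pderiv_two_quarticPoly] at h2
  refine Fin.forall_fin_succ.2 ⟨?_, Fin.forall_fin_succ.2 ⟨?_, Fin.forall_fin_one.2 ?_⟩⟩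
  · rw [aeval_pderiv_zero_quarticPoly]
    simp [swapXZ]
    linear_combination h2
  · change aeval _ (pderiv 1 _) = 0
    rw [aeval_pderiv_one_quarticPoly]
    simp [swapXZ]
    linear_combination h1
  · change aeval _ (pderiv 2 _) = 0
    rw [aeval_pderiv_two_quarticPoly]
    simp [swapXZ]
    linear_combination h0

lemma four_mul_eval_quarticPoly (c : QuarticCoeffs) (x : Fin 3 → ℝ) :
    (4 * eval x (quarticPoly c) : ℂ) = ∑ i, x i * aeval (fun i => (x i : ℂ))
      (pderiv i (quarticPoly c)) := by
  rw [Fin.sum_univ_three, aeval_pderiv_zero_quarticPoly, aeval_pderiv_one_quarticPoly,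
    aeval_pderiv_two_quarticPoly]
  simp [quarticPoly_eq]
  ring

lemma aeval_pderiv_smul (c : QuarticCoeffs) (l : ℂ) (z : Fin 3 → ℂ) (i : Fin 3) :
    aeval (fun i => l * z i) (pderiv i (quarticPoly c)) =
      l ^ 3 * aeval z (pderiv i (quarticPoly c)) := by
  fin_cases i
  · simp only [Fin.zero_eta, aeval_pderiv_zero_quarticPoly]; ring
  · simp only [Fin.mk_one, aeval_pderiv_one_quarticPoly]; ring
  · simp only [Fin.reduceFinMk, aeval_pderiv_two_quarticPoly]; ring

lemma not_real_of_mem_singularPoints {c : QuarticCoeffs}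
    (hc : ∀ x : Fin 3 → ℝ, x ≠ 0 → 0 < eval x (quarticPoly c)) {z : Fin 3 → ℂ}
    (hz : z ∈ singularPoints c) {l : ℂ} (hl : l ≠ 0) {x : Fin 3 → ℝ} (hx : x ≠ 0)
    (h : ∀ i, z i = l * x i) : False := by
  obtain rfl : z = fun i => l * x i := funext h
  refine (hc x hx).ne' ?_
  have h4 := four_mul_eval_quarticPoly c x
  have : ∀ i, aeval (fun i => (x i : ℂ)) (pderiv i (quarticPoly c)) = 0 := fun i => by
    have h1 := hz i
    rw [aeval_pderiv_smul c l (fun i => (x i : ℂ))] at h1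
    exact (mul_eq_zero.1 h1).resolve_left (pow_ne_zero _ hl)
  simp only [this, mul_zero, Finset.sum_const_zero] at h4
  exact_mod_cast (mul_eq_zero.1 h4).resolve_left (by norm_num)

lemma Complex.eq_mul_ofReal_div_re {a b : ℂ} (hb : b ≠ 0) (h : (a / b).im = 0) :
    a = b * ((a / b).re : ℝ) := by
  have : a / b = ((a / b).re : ℝ) := Complex.ext (by simp) (by simpa using h)
  rw [← this, mul_div_cancel₀ _ hb]

/-- Positive singular quartic forms lie in three families of dimension 13. -/
lemma mem_range_nodalQuartic {c : QuarticCoeffs}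
    (hc : ∀ x : Fin 3 → ℝ, x ≠ 0 → 0 < eval x (quarticPoly c)) {z : Fin 3 → ℂ}
    (hz : z ∈ singularPoints c) (hz0 : z ≠ 0) :
    ∃ p, c = nodalQuartic p ∨ c = nodalQuartic p ∘ swapYZ ∨ c = nodalQuartic p ∘ swapXZ := by
  by_cases h0 : z 0 = 0
  · by_cases h2 : z 2 = 0
    · exfalso
      have h1 : z 1 ≠ 0 := fun h1 => hz0 (funext fun i => by fin_cases i <;> simp [h0, h1, h2])
      refine not_real_of_mem_singularPoints hc hz h1 (x := ![0, 1, 0])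
        (fun h => by simpa using congrFun h 1) fun i => ?_
      fin_cases i <;> simp [h0, h2]
    · by_cases h1 : (z 1 / z 2).im = 0
      · exfalso
        refine not_real_of_mem_singularPoints hc hz h2 (x := ![0, (z 1 / z 2).re, 1])
          (fun h => by simpa using congrFun h 2) fun i => ?_
        fin_cases i
        · simp [h0]
        · exact Complex.eq_mul_ofReal_div_re h2 h1
        · simp
      · obtain ⟨p, hp⟩ := exists_nodalQuartic_eq (swapXZ_mem_singularPoints hz) h2 h1
        refine ⟨p, Or.inr (Or.inr ?_)⟩
        rw [hp]
        ext i
        fin_cases i <;> rfl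
  · by_cases h1 : (z 1 / z 0).im = 0
    · by_cases h2 : (z 2 / z 0).im = 0
      · exfalso
        refine not_real_of_mem_singularPoints hc hz h0 (x := ![1, (z 1 / z 0).re, (z 2 / z 0).re])
          (fun h => by simpa using congrFun h 0) fun i => ?_
        fin_cases i
        · simp
        · exact Complex.eq_mul_ofReal_div_re h0 h1
        · exact Complex.eq_mul_ofReal_div_re h0 h2
      · obtain ⟨p, hp⟩ := exists_nodalQuartic_eq (swapYZ_mem_singularPoints hz) h0 h2
        refine ⟨p, Or.inr (Or.inl ?_)⟩
        rw [hp]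
        ext i
        fin_cases i <;> rfl
    · obtain ⟨p, hp⟩ := exists_nodalQuartic_eq hz h0 h1
      exact ⟨p, Or.inl hp.symm⟩

lemma contDiff_nodalQuartic : ContDiff ℝ 1 nodalQuartic := by
  refine contDiff_pi.2 fun i => ?_
  fin_cases i <;> simp [nodalQuartic, conicMul_apply, linMul_apply] <;> fun_prop

/-- The quartic forms whose segment from `c` meets a family of singular forms. -/
noncomputable def coneMap (c : QuarticCoeffs) (e : Fin 15 → Fin 15) (p : Fin 14 → ℝ) : QuarticCoeffs :=
  c + p 0 • (nodalQuartic (fun i => p i.succ) ∘ e - c)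

lemma dimH_range_coneMap (c : QuarticCoeffs) (e : Fin 15 → Fin 15) :
    dimH (Set.range (coneMap c e)) ≤ 14 := by
  have : ContDiff ℝ 1 (coneMap c e) := by
    have h1 : ContDiff ℝ 1 fun p : Fin 14 → ℝ => nodalQuartic (fun i => p i.succ) :=
      contDiff_nodalQuartic.comp (contDiff_pi.2 fun i => contDiff_apply ℝ ℝ i.succ)
    have h2 : ContDiff ℝ 1 fun p : Fin 14 → ℝ => nodalQuartic (fun i => p i.succ) ∘ e :=
      contDiff_pi.2 fun i => (contDiff_pi.1 h1) (e i)
    exact contDiff_const.add ((contDiff_apply ℝ ℝ 0).smul (h2.sub contDiff_const))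
  simpa using this.dimH_range_le

lemma isOpen_setOf_pos :
    IsOpen {c | ∀ x : Fin 3 → ℝ, x ≠ 0 → 0 < eval x (quarticPoly c)} := by
  have hset : {c | ∀ x : Fin 3 → ℝ, x ≠ 0 → 0 < eval x (quarticPoly c)} =
      {c | ∀ x ∈ Metric.sphere (0 : Fin 3 → ℝ) 1, 0 < eval x (quarticPoly c)} := by
    ext c
    refine ⟨fun h x hx => h x (ne_zero_of_mem_unit_sphere ⟨x, hx⟩), fun h x hx => ?_⟩
    have h1 := h (‖x‖⁻¹ • x) (by simp [norm_smul, hx])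
    rw [show eval (‖x‖⁻¹ • x) (quarticPoly c) = ‖x‖⁻¹ ^ 4 * eval x (quarticPoly c) from by
      simp [quarticPoly_eq]; ring] at h1
    exact pos_of_mul_pos_right h1 (by positivity)
  rw [hset, isOpen_iff_mem_nhds]
  intro c hc
  refine (isCompact_sphere (0 : Fin 3 → ℝ) 1).eventually_forall_of_forall_eventually fun x hx => ?_
  have h : Continuous fun y : QuarticCoeffs × (Fin 3 → ℝ) => eval y.2 (quarticPoly y.1) :=
    Continuous.eval_quarticPoly continuous_snd continuous_fst
  exact (isOpen_lt continuous_const h).mem_nhds (hc x hx)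

lemma isSmoothPositive_segment {c g : QuarticCoeffs} (hc : IsSmoothPositive c)
    (hg : ∀ x : Fin 3 → ℝ, x ≠ 0 → 0 < eval x (quarticPoly g))
    (h1 : g ∉ Set.range (coneMap c id)) (h2 : g ∉ Set.range (coneMap c swapYZ))
    (h3 : g ∉ Set.range (coneMap c swapXZ)) {t : ℝ} (ht : t ∈ Set.Icc (0 : ℝ) 1) :
    IsSmoothPositive (c + t • (g - c)) := by
  rcases eq_or_ne t 0 with rfl | ht0
  · simpa using hc
  have hpos : ∀ x : Fin 3 → ℝ, x ≠ 0 → 0 < eval x (quarticPoly (c + t • (g - c))) := by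
    intro x hx
    have h : eval x (quarticPoly (c + t • (g - c))) =
        (1 - t) * eval x (quarticPoly c) + t * eval x (quarticPoly g) := by
      simp only [map_add, map_smul, map_sub, smul_eval]; ring
    rw [h]
    have := hc.pos x hx
    have := hg x hx
    have := lt_of_le_of_ne ht.1 ht0.symm
    have := ht.2
    have : 0 ≤ (1 - t) * eval x (quarticPoly c) := mul_nonneg (by linarith) (by linarith)
    positivity
  refine ⟨hpos, fun z hz => ?_⟩
  by_contra! hsing
  obtain ⟨p, hp⟩ := mem_range_nodalQuartic hpos hsing hz
  have key : ∀ e, c + t • (g - c) = nodalQuartic p ∘ e → g ∈ Set.range (coneMap c e) := by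
    intro e he
    refine ⟨Fin.cons t⁻¹ p, ?_⟩
    simp only [coneMap, Fin.cons_zero, Fin.cons_succ]
    rw [← he, add_sub_cancel_left, inv_smul_smul₀ ht0, add_sub_cancel]
  rcases hp with hp | hp | hp
  · exact h1 (key id hp)
  · exact h2 (key _ hp)
  · exact h3 (key _ hp)

lemma ncard_repSpans_segment {c g : QuarticCoeffs}
    (h : ∀ t ∈ Set.Icc (0 : ℝ) 1, IsSmoothPositive (c + t • (g - c))) :
    (repSpans c).ncard = (repSpans g).ncard := by
  have hcont : Continuous fun t : ℝ => c + t • (g - c) := by fun_prop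
  have hloc : IsLocallyConstant fun t : Set.Icc (0 : ℝ) 1 =>
      (repSpans (c + (t : ℝ) • (g - c))).ncard := by
    rw [IsLocallyConstant.iff_eventually_eq]
    intro t
    have := (hcont.comp continuous_subtype_val).tendsto t |>.eventually
      (eventually_ncard_repSpans_eq (h t t.2))
    filter_upwards [this] with u hu
    exact hu (h u u.2)
  have := hloc.apply_eq_of_preconnectedSpace (⟨0, by simp⟩) (⟨1, by simp⟩)
  simpa using this

/-- All smooth positive quartic forms have the same number of spans of representations. -/
lemma ncard_repSpans_eq {c c' : QuarticCoeffs} (hc : IsSmoothPositive c)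
    (hc' : IsSmoothPositive c') : (repSpans c).ncard = (repSpans c').ncard := by
  let S : QuarticCoeffs → Set QuarticCoeffs := fun c => Set.range (coneMap c id) ∪
    (Set.range (coneMap c swapYZ) ∪ Set.range (coneMap c swapXZ))
  have hS : ∀ c, dimH (S c) ≤ 14 := fun c => by
    simp only [S, dimH_union]
    exact max_le (dimH_range_coneMap _ _) (max_le (dimH_range_coneMap _ _)
      (dimH_range_coneMap _ _))
  have hdim : dimH (S c ∪ S c') < Module.finrank ℝ QuarticCoeffs := by
    rw [dimH_union]
    refine (max_le (hS c) (hS c')).trans_lt ?_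
    simp
    norm_num
  obtain ⟨g, hg, hgS⟩ := (dense_compl_of_dimH_lt_finrank hdim).inter_open_nonempty _
    isOpen_setOf_pos ⟨c, hc.pos⟩
  simp only [S, Set.mem_compl_iff, Set.mem_union, not_or] at hgS
  obtain ⟨⟨h1, h2, h3⟩, h1', h2', h3'⟩ := hgS
  rw [ncard_repSpans_segment fun t ht => isSmoothPositive_segment hc hg h1 h2 h3 ht,
    ncard_repSpans_segment fun t ht => isSmoothPositive_segment hc' hg h1' h2' h3' ht]

end

section

open MvPolynomial Matrix

/-- The Gram matrix of `∑ sᵢ pᵢ²` with respect to the quadratic monomials. -/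
def gram (s : Fin 3 → ℝ) (p : Fin 3 → ConicCoeffs) : Matrix (Fin 6) (Fin 6) ℝ :=
  (Matrix.of p)ᵀ * (Matrix.diagonal s * Matrix.of p)

lemma gram_apply (s : Fin 3 → ℝ) (p : Fin 3 → ConicCoeffs) (j k : Fin 6) :
    gram s p j k = s 0 * p 0 j * p 0 k + s 1 * p 1 j * p 1 k + s 2 * p 2 j * p 2 k := by
  simp [gram, Matrix.mul_apply, Matrix.diagonal_apply, Fin.sum_univ_three]
  ring

lemma gram_comm (s : Fin 3 → ℝ) (p : Fin 3 → ConicCoeffs) (j k : Fin 6) :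
    gram s p j k = gram s p k j := by
  rw [gram_apply, gram_apply]; ring

lemma det_submatrix_gram (s : Fin 3 → ℝ) (p : Fin 3 → ConicCoeffs) (r c : Fin 4 → Fin 6) :
    ((gram s p).submatrix r c).det = 0 := by
  have hker : LinearMap.ker ((Matrix.diagonal s * Matrix.of p).submatrix id c).mulVecLin ≠ ⊥ :=
    LinearMap.ker_ne_bot_of_finrank_lt (by simp)
  obtain ⟨v, hv, hv0⟩ := Submodule.exists_mem_ne_zero_of_ne_bot hker
  refine Matrix.exists_mulVec_eq_zero_iff.1 ⟨v, hv0, ?_⟩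
  rw [LinearMap.mem_ker, Matrix.mulVecLin_apply] at hv
  rw [gram, ← Matrix.submatrix_mul_equiv _ _ r (Equiv.refl _) c, ← Matrix.mulVec_mulVec]
  simp only [Equiv.coe_refl, hv, Matrix.mulVec_zero]

lemma squareSum_eq_gram (s : Fin 3 → ℝ) (p : Fin 3 → ConicCoeffs) :
    squareSum s p = ![gram s p 0 0, gram s p 1 1, gram s p 2 2, 2 * gram s p 1 3,
      2 * gram s p 2 3, 2 * gram s p 0 4, 2 * gram s p 2 4, 2 * gram s p 0 5, 2 * gram s p 1 5,
      gram s p 3 3 + 2 * gram s p 1 2, gram s p 4 4 + 2 * gram s p 0 2,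
      gram s p 5 5 + 2 * gram s p 0 1, 2 * (gram s p 0 3 + gram s p 4 5),
      2 * (gram s p 1 4 + gram s p 3 5), 2 * (gram s p 2 5 + gram s p 3 4)] := by
  ext i
  simp only [squareSum, Fin.sum_univ_three, conicMul_apply, gram_apply]
  fin_cases i <;> simp <;> ring

/-- The coefficients of the Fermat quartic `x⁴ + y⁴ + z⁴`. -/
def fermat : QuarticCoeffs := ![1, 1, 1, 0, 0, 0, 0, 0, 0, 0, 0, 0, 0, 0, 0]

/-- The symmetric matrices representing the Fermat quartic. -/
def fermatGram (t : Fin 6 → ℝ) : Matrix (Fin 6) (Fin 6) ℝ :=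
  !![1, -t 2, -t 1, -t 3, 0, 0;
    -t 2, 1, -t 0, 0, -t 4, 0;
    -t 1, -t 0, 1, 0, 0, -t 5;
    -t 3, 0, 0, 2 * t 0, t 5, t 4;
    0, -t 4, 0, t 5, 2 * t 1, t 3;
    0, 0, -t 5, t 4, t 3, 2 * t 2]

lemma squareSum_eq_fermat {s : Fin 3 → ℝ} {p : Fin 3 → ConicCoeffs} {t : Fin 6 → ℝ}
    (h : gram s p = fermatGram t) : squareSum s p = fermat := by
  rw [squareSum_eq_gram, h]
  ext i
  fin_cases i <;> simp [fermatGram, fermat]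

lemma exists_gram_eq_fermatGram {s : Fin 3 → ℝ} {p : Fin 3 → ConicCoeffs}
    (h : squareSum s p = fermat) : ∃ t, gram s p = fermatGram t := by
  rw [squareSum_eq_gram] at h
  have h' := fun i => congrFun h i
  simp only [Fin.forall_fin_succ, fermat] at h'
  simp at h'
  obtain ⟨h0, h1, h2, h3, h4, h5, h6, h7, h8, h9, h10, h11, h12, h13, h14⟩ := h'
  refine ⟨![-gram s p 1 2, -gram s p 0 2, -gram s p 0 1, -gram s p 0 3, -gram s p 1 4,
    -gram s p 2 5], ?_⟩
  have hs := gram_comm s p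
  ext j k
  fin_cases j <;> fin_cases k <;> simp [fermatGram] <;>
    linarith [hs 1 0, hs 2 0, hs 2 1, hs 3 0, hs 3 1, hs 3 2, hs 4 0, hs 4 1, hs 4 2, hs 4 3,
      hs 5 0, hs 5 1, hs 5 2, hs 5 3, hs 5 4]

/-- Weights and conics with equal Gram matrices have the same span. -/
lemma span_le_of_gram_eq {s s' : Fin 3 → ℝ} (hs : ∀ i, s i ≠ 0) {p p' : Fin 3 → ConicCoeffs}
    (hp : LinearIndependent ℝ p) (h : gram s p = gram s' p') :
    Submodule.span ℝ (Set.range p) ≤ Submodule.span ℝ (Set.range p') := by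
  have hsurj : Function.Surjective (Matrix.of p).mulVecLin := by
    rw [← LinearMap.range_eq_top]
    apply Submodule.eq_top_of_finrank_eq
    have := hp.rank_matrix (M := Matrix.of p)
    rw [Matrix.rank] at this
    simpa using this
  rw [Submodule.span_le]
  rintro _ ⟨i, rfl⟩
  obtain ⟨v, hv⟩ := hsurj (Pi.single i (s i)⁻¹)
  rw [Matrix.mulVecLin_apply] at hv
  have h1 : gram s p *ᵥ v = p i := by
    rw [gram, ← Matrix.mulVec_mulVec, ← Matrix.mulVec_mulVec, hv]
    rw [Matrix.diagonal_mulVec_single, mul_inv_cancel₀ (hs i), Matrix.mulVec_single_one]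
    rfl
  rw [← h1, h, gram, ← Matrix.mulVec_mulVec, Matrix.mulVec_transpose]
  have h2 : ∀ y : Fin 3 → ℝ, y ᵥ* Matrix.of p' = ∑ i, y i • p' i := fun y => by
    ext j
    simp [Matrix.vecMul, dotProduct]
  rw [SetLike.mem_coe, h2]
  exact Submodule.sum_mem _ fun i _ => Submodule.smul_mem _ _ (Submodule.subset_span ⟨i, rfl⟩)

/-- Representations of a smooth positive form with the same span have equal Gram matrices. -/
lemma gram_eq_of_span_eq {s s' : Fin 3 → ℝ} {p p' : Fin 3 → ConicCoeffs}
    (hc : IsSmoothPositive (squareSum s p)) (h : squareSum s p = squareSum s' p')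
    (hspan : Submodule.span ℝ (Set.range p) = Submodule.span ℝ (Set.range p')) :
    gram s p = gram s' p' := by
  have hp := hc.surjective_combine
  have hp' := IsSmoothPositive.surjective_combine (h ▸ hc)
  obtain ⟨A, -, rfl, hiso⟩ := exists_isometry hp' (linearIndependent_of_surjective hp) hspan.le h
  have hQ : ∀ r : Fin 3 → ConicCoeffs, squareSum s (mix A r) 0 = squareSum s' r 0 := fun r => by
    rw [hiso]
  have hdiag : ∀ (r : Fin 3 → ConicCoeffs), gram s (mix A r) 0 0 = gram s' r 0 0 := fun r => by
    simpa [squareSum_eq_gram] using hQ r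
  have hlin : ∀ a : Fin 3 → ℝ, (∑ i, s i * (∑ k, A i k * a k) ^ 2) = ∑ i, s' i * a i ^ 2 := by
    intro a
    have := hdiag fun k => a k • Pi.single 0 1
    simp only [gram_apply, mix_apply, Fin.sum_univ_three] at this ⊢
    simp at this
    linarith
  ext j k
  have h1 := hlin fun i => p' i j
  have h2 := hlin fun i => p' i k
  have h3 := hlin fun i => p' i j + p' i k
  simp only [Fin.sum_univ_three] at h1 h2 h3
  simp only [gram_apply, mix_apply]
  linarith

lemma det_fin_four (M : Matrix (Fin 4) (Fin 4) ℝ) : M.det =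
    M 0 0 * (M 1 1 * (M 2 2 * M 3 3 - M 2 3 * M 3 2) - M 1 2 * (M 2 1 * M 3 3 - M 2 3 * M 3 1) +
      M 1 3 * (M 2 1 * M 3 2 - M 2 2 * M 3 1)) -
    M 0 1 * (M 1 0 * (M 2 2 * M 3 3 - M 2 3 * M 3 2) - M 1 2 * (M 2 0 * M 3 3 - M 2 3 * M 3 0) +
      M 1 3 * (M 2 0 * M 3 2 - M 2 2 * M 3 0)) +
    M 0 2 * (M 1 0 * (M 2 1 * M 3 3 - M 2 3 * M 3 1) - M 1 1 * (M 2 0 * M 3 3 - M 2 3 * M 3 0) +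
      M 1 3 * (M 2 0 * M 3 1 - M 2 1 * M 3 0)) -
    M 0 3 * (M 1 0 * (M 2 1 * M 3 2 - M 2 2 * M 3 1) - M 1 1 * (M 2 0 * M 3 2 - M 2 2 * M 3 0) +
      M 1 2 * (M 2 0 * M 3 1 - M 2 1 * M 3 0)) := by
  simp [Matrix.det_succ_row_zero, Fin.sum_univ_succ, Fin.succAbove]
  ring

lemma eq_zero_of_minors {a b c w : ℝ} (h1 : w ^ 2 * (1 - c ^ 2) = 0) (h2 : (a * c + b) * w ^ 2 = 0)
    (h3 : w ^ 3 - 4 * a * b * w = 0) (h4 : w * (2 * c - w ^ 2 - 2 * b ^ 2 * c) = 0) : w = 0 := by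
  by_contra hw
  have hw2 : 0 < w ^ 2 := by positivity
  replace h1 := (mul_eq_zero.1 h1).resolve_left hw2.ne'
  replace h2 := (mul_eq_zero.1 h2).resolve_right hw2.ne'
  replace h3 : w ^ 2 - 4 * a * b = 0 :=
    (mul_eq_zero.1 (by linear_combination h3 : w * (w ^ 2 - 4 * a * b) = 0)).resolve_left hw
  replace h4 := (mul_eq_zero.1 h4).resolve_left hw
  have hb : b = -(a * c) := by linarith
  subst hb
  rcases mul_eq_zero.1 (by linear_combination -h1 : (c - 1) * (c + 1) = 0) with h | h
  · obtain rfl : c = 1 := by linarith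
    nlinarith [sq_nonneg a]
  · obtain rfl : c = -1 := by linarith
    nlinarith [sq_nonneg a]

lemma exists_of_minors_of_ne_zero {a b c u v w : ℝ} (hu : u ≠ 0) (hv : v ≠ 0) (hw : w ≠ 0)
    (h1 : b * v ^ 2 * w - a * u ^ 2 * w = 0) (h2 : -c * v * w ^ 2 + a * u ^ 2 * v = 0)
    (h3 : 2 * a * v * w - c * u * w ^ 2 - b * u * v ^ 2 - u ^ 2 * v * w = 0)
    (h4 : -c * v * w ^ 2 + 2 * b * u * w - a * u ^ 2 * v - u * v ^ 2 * w = 0)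
    (h5 : -b * v ^ 2 * w - a * u ^ 2 * w + 2 * c * u * v - u * v * w ^ 2 = 0)
    (h6 : -2 * a * c * v * w + u * w ^ 2 - a * u * v ^ 2 = 0) :
    ∃ s, s ^ 2 - 4 * s + 2 = 0 ∧ a = 1 - s ∧ b = 1 - s ∧ c = 1 - s ∧ u ^ 2 = s ^ 2 ∧
      v ^ 2 = s ^ 2 ∧ w ^ 2 = s ^ 2 ∧ u * v * w = s ^ 3 := by
  obtain ⟨t, ht⟩ : ∃ t, t = u * v * w := ⟨_, rfl⟩
  have ht0 : t ≠ 0 := by rw [ht]; positivity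
  obtain ⟨k, hk⟩ : ∃ k, k = a * u ^ 2 := ⟨_, rfl⟩
  have hkb : k = b * v ^ 2 := mul_right_cancel₀ hw (by rw [hk]; linear_combination -h1)
  have hkc : k = c * w ^ 2 := mul_right_cancel₀ hv (by rw [hk]; linear_combination h2)
  have e1 : 2 * k * t = u ^ 4 * (2 * k + t) := by
    have : 2 * a * v * w - 2 * k * u - u ^ 2 * v * w = 0 := by
      linear_combination h3 - u * hkb - u * hkc
    rw [ht]; linear_combination u ^ 3 * this + 2 * u * v * w * hk
  have e2 : 2 * k * t = v ^ 4 * (2 * k + t) := by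
    have : 2 * b * u * w - 2 * k * v - v ^ 2 * u * w = 0 := by
      linear_combination h4 - v * hkc - v * hk
    rw [ht]; linear_combination v ^ 3 * this + 2 * u * v * w * hkb
  have e3 : 2 * k * t = w ^ 4 * (2 * k + t) := by
    have : 2 * c * u * v - 2 * k * w - w ^ 2 * u * v = 0 := by
      linear_combination h5 - w * hkb - w * hk
    rw [ht]; linear_combination w ^ 3 * this + 2 * u * v * w * hkc
  have hkt : 2 * k + t ≠ 0 := fun h => by
    rw [h, mul_zero] at e1
    have hk0 : k = 0 := by simpa [ht0] using e1
    rw [hk0, mul_zero, zero_add] at h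
    exact ht0 h
  have sq_eq : ∀ x y : ℝ, x ≠ 0 → x ^ 4 = y ^ 4 → x ^ 2 = y ^ 2 := fun x y hx h => by
    have hx2 : 0 < x ^ 2 := by positivity
    have : (x ^ 2 - y ^ 2) * (x ^ 2 + y ^ 2) = 0 := by linear_combination h
    exact sub_eq_zero.1 ((mul_eq_zero.1 this).resolve_right (by positivity))
  have huv : u ^ 2 = v ^ 2 := sq_eq u v hu (mul_right_cancel₀ hkt (e1.symm.trans e2))
  have huw : u ^ 2 = w ^ 2 := sq_eq u w hu (mul_right_cancel₀ hkt (e1.symm.trans e3))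
  have hu2 : u ^ 2 ≠ 0 := pow_ne_zero _ hu
  have hab : b = a := mul_right_cancel₀ hu2 (by rw [← hk, hkb, huv])
  have hac : c = a := mul_right_cancel₀ hu2 (by rw [← hk, hkc, huw])
  subst hab hac
  obtain ⟨s, hs⟩ : ∃ s, s = v * w / u := ⟨_, rfl⟩
  have hsu : s * u = v * w := by rw [hs, div_mul_cancel₀ _ hu]
  have hs2 : u ^ 2 = s ^ 2 := by
    refine mul_right_cancel₀ hu2 ?_
    have : s ^ 2 * u ^ 2 = v ^ 2 * w ^ 2 := by linear_combination (s * u + v * w) * hsu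
    rw [this, ← huv, ← huw]
  have hs0 : s ≠ 0 := by rw [hs]; positivity
  have ht' : t = s ^ 3 := by rw [ht]; linear_combination -u * hsu + s * hs2
  have f1 : 2 * c * (1 - s) = s ^ 2 := by
    rw [ht', hk, hs2] at e1
    have h4 : u ^ 4 = s ^ 4 := by rw [show u ^ 4 = (u ^ 2) ^ 2 by ring, hs2]; ring
    rw [h4] at e1
    refine mul_left_cancel₀ (pow_ne_zero 5 hs0) ?_
    linear_combination e1
  have f2 : s * (1 - c) = 2 * c ^ 2 := by
    have : u * (-2 * c ^ 2 * s + s ^ 2 * (1 - c)) = 0 := by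
      linear_combination h6 - 2 * c ^ 2 * hsu - u * (huw.symm.trans hs2) +
        c * u * (huv.symm.trans hs2)
    refine mul_left_cancel₀ hs0 ?_
    linear_combination (mul_eq_zero.1 this).resolve_left hu
  have hc0 : c ≠ 0 := by
    rintro rfl
    exact hs0 (by linarith)
  have hc1 : 1 - c ≠ 0 := fun h => by
    rw [h, mul_zero] at f2
    exact hc0 (by simpa using f2.symm)
  have f3 : c ^ 2 + 2 * c - 1 = 0 := by
    have : 2 * c * (c ^ 2 + 2 * c - 1) = 0 := by
      linear_combination -(1 - c) ^ 2 * f1 -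
        (2 * c * (1 - c) + s * (1 - c) + 2 * c ^ 2) * f2
    exact (mul_eq_zero.1 this).resolve_left (by simpa using hc0)
  have f4 : c = 1 - s := by
    refine mul_left_cancel₀ hc1 ?_
    linear_combination f2 + f3
  refine ⟨s, ?_, f4, f4, f4, hs2, huv.symm.trans hs2, huw.symm.trans hs2, ht ▸ ht'⟩
  rw [f4] at f3
  linear_combination f3

lemma eq_zero_of_fst_eq_zero {a b c u v w : ℝ}
    (H : ∀ r r' : Fin 4 → Fin 6, ((fermatGram ![a, b, c, u, v, w]).submatrix r r').det = 0)
    (hu : u = 0) :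
    v = 0 ∧ w = 0 := by
  have h1 : v * w ^ 2 - 2 * b * c * u * w - b * u ^ 2 * v = 0 := by
    rw [← H ![0, 1, 2, 4] ![0, 3, 4, 5], det_fin_four]; simp [fermatGram]; ring
  have h2 : -v ^ 2 + b ^ 2 * v ^ 2 + c * u ^ 2 + a * b * u ^ 2 + b * u * v * w = 0 := by
    rw [← H ![0, 1, 2, 5] ![0, 2, 3, 4], det_fin_four]; simp [fermatGram]; ring
  have h3 : w ^ 2 - a * v ^ 2 - c ^ 2 * w ^ 2 - b * c * v ^ 2 - c * u * v * w = 0 := by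
    rw [← H ![0, 1, 2, 3] ![0, 1, 4, 5], det_fin_four]; simp [fermatGram]; ring
  have h4 : 2 * a ^ 2 * u * w + a * v * w ^ 2 - 4 * a * c * v + v ^ 3 = 0 := by
    rw [← H ![1, 2, 3, 5] ![2, 3, 4, 5], det_fin_four]; simp [fermatGram]; ring
  have h5 : u * w - 2 * b * v - a ^ 2 * u * w + 2 * a ^ 2 * b * v - a * v * w ^ 2 + v ^ 3 = 0 :=
      by
    rw [← H ![1, 2, 4, 5] ![1, 2, 3, 4], det_fin_four]; simp [fermatGram]; ring
  have h6 : a * c * w ^ 2 + b * w ^ 2 - u ^ 2 + a ^ 2 * u ^ 2 + a * u * v * w = 0 := by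
    rw [← H ![0, 1, 2, 4] ![1, 2, 3, 5], det_fin_four]; simp [fermatGram]; ring
  have h7 : -4 * a * b * w + w ^ 3 + b * u ^ 2 * w + 2 * b ^ 2 * u * v = 0 := by
    rw [← H ![0, 2, 3, 4] ![0, 3, 4, 5], det_fin_four]; simp [fermatGram]; ring
  have h8 : 2 * c * w - u * v - w ^ 3 - 2 * b ^ 2 * c * w + b ^ 2 * u * v + b * u ^ 2 * w = 0 :=
      by
    rw [← H ![0, 2, 3, 5] ![0, 2, 4, 5], det_fin_four]; simp [fermatGram]; ring
  subst hu
  have hvw : v = 0 ∨ w = 0 := by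
    have : v * w ^ 2 = 0 := by linear_combination h1
    simpa using this
  rcases hvw with rfl | rfl
  · refine ⟨rfl, eq_zero_of_minors (a := a) (b := b) (c := c) ?_ ?_ ?_ ?_⟩
    · linear_combination h3
    · linear_combination h6
    · linear_combination h7
    · linear_combination h8
  · refine ⟨eq_zero_of_minors (a := c) (b := a) (c := b) ?_ ?_ ?_ ?_, rfl⟩
    · linear_combination -h2
    · linear_combination -h3
    · linear_combination h4
    · linear_combination -h5

lemma eq_zero_of_snd_eq_zero {a b c u v w : ℝ}
    (H : ∀ r r' : Fin 4 → Fin 6, ((fermatGram ![a, b, c, u, v, w]).submatrix r r').det = 0)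
    (hv : v = 0) :
    u = 0 ∧ w = 0 := by
  have h1 : -2 * a * c * v * w + u * w ^ 2 - a * u * v ^ 2 = 0 := by
    rw [← H ![0, 1, 2, 3] ![1, 3, 4, 5], det_fin_four]; simp [fermatGram]; ring
  have h2 : a * c * w ^ 2 + b * w ^ 2 - u ^ 2 + a ^ 2 * u ^ 2 + a * u * v * w = 0 := by
    rw [← H ![0, 1, 2, 4] ![1, 2, 3, 5], det_fin_four]; simp [fermatGram]; ring
  have h3 : -v ^ 2 + b ^ 2 * v ^ 2 + c * u ^ 2 + a * b * u ^ 2 + b * u * v * w = 0 := by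
    rw [← H ![0, 1, 2, 5] ![0, 2, 3, 4], det_fin_four]; simp [fermatGram]; ring
  have h4 : -2 * c ^ 2 * v * w - c * u * v ^ 2 + 4 * b * c * u - u ^ 3 = 0 := by
    rw [← H ![0, 1, 4, 5] ![1, 3, 4, 5], det_fin_four]; simp [fermatGram]; ring
  have h5 : 2 * a * u - v * w - 2 * a * c ^ 2 * u + c ^ 2 * v * w + c * u * v ^ 2 - u ^ 3 = 0 :=
      by
    rw [← H ![0, 1, 3, 4] ![0, 1, 3, 5], det_fin_four]; simp [fermatGram]; ring
  subst hv
  have huw : u = 0 ∨ w = 0 := by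
    have : u * w ^ 2 = 0 := by linear_combination h1
    simpa using this
  rcases huw with rfl | rfl
  · exact ⟨rfl, (eq_zero_of_fst_eq_zero H rfl).2⟩
  · refine ⟨eq_zero_of_minors (a := b) (b := c) (c := a) ?_ ?_ ?_ ?_, rfl⟩
    · linear_combination -h2
    · linear_combination h3
    · linear_combination -h4
    · linear_combination h5

lemma eq_zero_of_trd_eq_zero {a b c u v w : ℝ}
    (H : ∀ r r' : Fin 4 → Fin 6, ((fermatGram ![a, b, c, u, v, w]).submatrix r r').det = 0)
    (hw : w = 0) :
    u = 0 ∧ v = 0 := by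
  have h1 : -2 * a * b * v * w - a * u * w ^ 2 + u * v ^ 2 = 0 := by
    rw [← H ![0, 1, 2, 3] ![2, 3, 4, 5], det_fin_four]; simp [fermatGram]; ring
  subst hw
  have huv : u = 0 ∨ v = 0 := by
    have : u * v ^ 2 = 0 := by linear_combination h1
    simpa using this
  rcases huv with rfl | rfl
  · exact ⟨rfl, (eq_zero_of_fst_eq_zero H rfl).1⟩
  · exact ⟨(eq_zero_of_snd_eq_zero H rfl).1, rfl⟩

lemma exists_of_det_fermatGram_of_ne_zero {a b c u v w : ℝ}
    (H : ∀ r r' : Fin 4 → Fin 6, ((fermatGram ![a, b, c, u, v, w]).submatrix r r').det = 0)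
    (hu : u ≠ 0) (hv : v ≠ 0) (hw : w ≠ 0) :
    ∃ s, s ^ 2 - 4 * s + 2 = 0 ∧ a = 1 - s ∧ b = 1 - s ∧ c = 1 - s ∧ u ^ 2 = s ^ 2 ∧
      v ^ 2 = s ^ 2 ∧ w ^ 2 = s ^ 2 ∧ u * v * w = s ^ 3 := by
  have h1 : b * v ^ 2 * w - a * u ^ 2 * w = 0 := by
    rw [← H ![0, 1, 3, 4] ![2, 3, 4, 5], det_fin_four]; simp [fermatGram]; ring
  have h2 : -c * v * w ^ 2 + a * u ^ 2 * v = 0 := by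
    rw [← H ![0, 2, 3, 5] ![1, 3, 4, 5], det_fin_four]; simp [fermatGram]; ring
  have h3 : 2 * a * v * w - c * u * w ^ 2 - b * u * v ^ 2 - u ^ 2 * v * w = 0 := by
    rw [← H ![0, 1, 2, 3] ![0, 3, 4, 5], det_fin_four]; simp [fermatGram]; ring
  have h4 : -c * v * w ^ 2 + 2 * b * u * w - a * u ^ 2 * v - u * v ^ 2 * w = 0 := by
    rw [← H ![0, 1, 2, 4] ![1, 3, 4, 5], det_fin_four]; simp [fermatGram]; ring
  have h5 : -b * v ^ 2 * w - a * u ^ 2 * w + 2 * c * u * v - u * v * w ^ 2 = 0 := by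
    rw [← H ![0, 1, 2, 5] ![2, 3, 4, 5], det_fin_four]; simp [fermatGram]; ring
  have h6 : -2 * a * c * v * w + u * w ^ 2 - a * u * v ^ 2 = 0 := by
    rw [← H ![0, 1, 2, 3] ![1, 3, 4, 5], det_fin_four]; simp [fermatGram]; ring
  refine exists_of_minors_of_ne_zero hu hv hw ?_ ?_ ?_ ?_ ?_ ?_
  · linear_combination h1
  · linear_combination h2
  · linear_combination h3
  · linear_combination h4
  · linear_combination h5
  · linear_combination h6

lemma eq_of_det_fermatGram_of_eq_zero {a b c : ℝ}
    (H : ∀ r r' : Fin 4 → Fin 6, ((fermatGram ![a, b, c, 0, 0, 0]).submatrix r r').det = 0)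
    :
    (b = 0 ∧ c = 0 ∧ a * (1 - a ^ 2) = 0) ∨ (a = 0 ∧ c = 0 ∧ b * (1 - b ^ 2) = 0) ∨
      (a = 0 ∧ b = 0 ∧ c * (1 - c ^ 2) = 0) := by
  have h1 : 8 * a * b * c = 0 := by
    rw [← H ![0, 3, 4, 5] ![0, 3, 4, 5], det_fin_four]; simp [fermatGram]; ring
  have h2 : 4 * a * b - 4 * a * b * c ^ 2 = 0 := by
    rw [← H ![0, 1, 3, 4] ![0, 1, 3, 4], det_fin_four]; simp [fermatGram]; ring
  have h3 : 4 * a * c - 4 * a * b ^ 2 * c = 0 := by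
    rw [← H ![0, 2, 3, 5] ![0, 2, 3, 5], det_fin_four]; simp [fermatGram]; ring
  have h4 : 4 * b * c - 4 * a ^ 2 * b * c = 0 := by
    rw [← H ![1, 2, 4, 5] ![1, 2, 4, 5], det_fin_four]; simp [fermatGram]; ring
  have h5 : 2 * a - 2 * a ^ 3 - 2 * a * c ^ 2 - 4 * a ^ 2 * b * c - 2 * a * b ^ 2 = 0 := by
    rw [← H ![0, 1, 2, 3] ![0, 1, 2, 3], det_fin_four]; simp [fermatGram]; ring
  have h6 : 2 * b - 2 * a ^ 2 * b - 2 * b * c ^ 2 - 4 * a * b ^ 2 * c - 2 * b ^ 3 = 0 := by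
    rw [← H ![0, 1, 2, 4] ![0, 1, 2, 4], det_fin_four]; simp [fermatGram]; ring
  have h7 : 2 * c - 2 * a ^ 2 * c - 2 * c ^ 3 - 4 * a * b * c ^ 2 - 2 * b ^ 2 * c = 0 := by
    rw [← H ![0, 1, 2, 5] ![0, 1, 2, 5], det_fin_four]; simp [fermatGram]; ring
  have hab : a * b = 0 := by linear_combination h2 / 4 + c / 8 * h1
  have hac : a * c = 0 := by linear_combination h3 / 4 + b / 8 * h1
  have hbc : b * c = 0 := by linear_combination h4 / 4 + a / 8 * h1
  by_cases ha : a = 0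
  · subst ha
    by_cases hb : b = 0
    · subst hb
      exact Or.inr (Or.inr ⟨rfl, rfl, by linear_combination h7 / 2⟩)
    · obtain rfl : c = 0 := by simpa [hb] using hbc
      exact Or.inr (Or.inl ⟨rfl, rfl, by linear_combination h6 / 2⟩)
  · obtain rfl : b = 0 := by simpa [ha] using hab
    obtain rfl : c = 0 := by simpa [ha] using hac
    exact Or.inl ⟨rfl, rfl, by linear_combination h5 / 2⟩

/-- The two roots of `s ^ 2 - 4 * s + 2`. -/
noncomputable def surd (e : Fin 2) : ℝ := 2 + ![1, -1] e * √2

lemma surd_sq (e : Fin 2) : surd e ^ 2 - 4 * surd e + 2 = 0 := by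
  have h : √2 ^ 2 = 2 := Real.sq_sqrt (by norm_num)
  fin_cases e <;> simp [surd] <;> linear_combination h

lemma surd_ne_zero (e : Fin 2) : surd e ≠ 0 := fun h => by
  have := surd_sq e
  rw [h] at this
  norm_num at this

lemma surd_injective : Function.Injective surd := by
  have h : √2 ≠ 0 := by positivity
  intro e e' hee
  fin_cases e <;> fin_cases e' <;> simp [surd] at hee ⊢ <;>
    exact h (by linarith)

lemma exists_eq_surd {s : ℝ} (hs : s ^ 2 - 4 * s + 2 = 0) : ∃ e, s = surd e := by
  have h : √2 ^ 2 = 2 := Real.sq_sqrt (by norm_num)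
  rcases mul_eq_zero.1 (by linear_combination hs - h : (s - 2 - √2) * (s - 2 + √2) = 0) with h | h
  · exact ⟨0, by simp [surd]; linarith⟩
  · exact ⟨1, by simp [surd]; linarith⟩

/-- The sign patterns with product one. -/
def evenSigns : Fin 4 → Fin 3 → ℝ := ![![1, 1, 1], ![1, -1, -1], ![-1, 1, -1], ![-1, -1, 1]]

/-- The parameters of the matrices of rank three representing the Fermat quartic. -/
noncomputable def fermatPoint : Fin 7 ⊕ Fin 4 × Fin 2 → Fin 6 → ℝ
  | .inl n => ![![0, 0, 0, 0, 0, 0], ![1, 0, 0, 0, 0, 0], ![-1, 0, 0, 0, 0, 0],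
      ![0, 1, 0, 0, 0, 0], ![0, -1, 0, 0, 0, 0], ![0, 0, 1, 0, 0, 0], ![0, 0, -1, 0, 0, 0]] n
  | .inr (i, e) => ![1 - surd e, 1 - surd e, 1 - surd e, surd e * evenSigns i 0,
      surd e * evenSigns i 1, surd e * evenSigns i 2]

lemma fermatPoint_injective : Function.Injective fermatPoint := by
  have hne : ∀ n i e, fermatPoint (.inl n) ≠ fermatPoint (.inr (i, e)) := fun n i e h => by
    have h3 := congrFun h 3
    fin_cases n <;> fin_cases i <;> simp [fermatPoint, evenSigns, surd_ne_zero] at h3 <;>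
      exact surd_ne_zero e h3.symm
  rintro (n | ⟨i, e⟩) (m | ⟨j, e'⟩) h
  · have h0 := congrFun h 0
    have h1 := congrFun h 1
    have h2 := congrFun h 2
    fin_cases n <;> fin_cases m <;> 
      first | rfl | (exfalso; simp [fermatPoint] at h0 h1 h2; done) |
        (exfalso; simp [fermatPoint] at h0 h1 h2; linarith)
  · exact absurd h (hne _ _ _)
  · exact absurd h.symm (hne _ _ _)
  · have h0 := congrFun h 0
    obtain rfl : e = e' := surd_injective (by simpa [fermatPoint] using h0)
    have h3 := congrFun h 3
    have h4 := congrFun h 4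
    simp only [fermatPoint] at h3 h4
    replace h3 := mul_left_cancel₀ (surd_ne_zero e) h3
    replace h4 := mul_left_cancel₀ (surd_ne_zero e) h4
    fin_cases i <;> fin_cases j <;> first | rfl | (exfalso; simp [evenSigns] at h3 h4; linarith)

lemma exists_eq_fermatPoint {t : Fin 6 → ℝ}
    (H : ∀ r r' : Fin 4 → Fin 6, ((fermatGram t).submatrix r r').det = 0) :
    ∃ i, t = fermatPoint i := by
  obtain ⟨a, b, c, u, v, w, rfl⟩ : ∃ a b c u v w, t = ![a, b, c, u, v, w] :=
    ⟨t 0, t 1, t 2, t 3, t 4, t 5, by ext j; fin_cases j <;> rfl⟩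
  have key : (u = 0 ∧ v = 0 ∧ w = 0) ∨ (u ≠ 0 ∧ v ≠ 0 ∧ w ≠ 0) := by
    by_cases hu : u = 0
    · exact Or.inl ⟨hu, eq_zero_of_fst_eq_zero H hu⟩
    by_cases hv : v = 0
    · exact absurd (eq_zero_of_snd_eq_zero H hv).1 hu
    by_cases hw : w = 0
    · exact absurd (eq_zero_of_trd_eq_zero H hw).1 hu
    exact Or.inr ⟨hu, hv, hw⟩
  have cube : ∀ x : ℝ, x * (1 - x ^ 2) = 0 → x = 0 ∨ x = 1 ∨ x = -1 := fun x hx => by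
    rw [← sq_eq_one_iff]
    rcases mul_eq_zero.1 hx with h | h
    · exact Or.inl h
    · exact Or.inr (by linarith)
  rcases key with ⟨rfl, rfl, rfl⟩ | ⟨hu, hv, hw⟩
  · rcases eq_of_det_fermatGram_of_eq_zero H with ⟨rfl, rfl, h⟩ | ⟨rfl, rfl, h⟩ | ⟨rfl, rfl, h⟩
    · rcases cube _ h with rfl | rfl | rfl
      exacts [⟨.inl 0, rfl⟩, ⟨.inl 1, rfl⟩, ⟨.inl 2, rfl⟩]
    · rcases cube _ h with rfl | rfl | rfl
      exacts [⟨.inl 0, rfl⟩, ⟨.inl 3, rfl⟩, ⟨.inl 4, rfl⟩]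
    · rcases cube _ h with rfl | rfl | rfl
      exacts [⟨.inl 0, rfl⟩, ⟨.inl 5, rfl⟩, ⟨.inl 6, rfl⟩]
  · obtain ⟨s, hs, rfl, rfl, rfl, hu2, hv2, hw2, huvw⟩ :=
      exists_of_det_fermatGram_of_ne_zero H hu hv hw
    obtain ⟨e, rfl⟩ := exists_eq_surd hs
    have hneg : ∀ x : ℝ, x = -(surd e ^ 3) → x ≠ surd e ^ 3 := fun x h h' =>
      pow_ne_zero 3 (surd_ne_zero e) (by linarith)
    rcases sq_eq_sq_iff_eq_or_eq_neg.1 hu2 with rfl | rfl <;>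
    rcases sq_eq_sq_iff_eq_or_eq_neg.1 hv2 with rfl | rfl <;>
    rcases sq_eq_sq_iff_eq_or_eq_neg.1 hw2 with rfl | rfl <;>
    first
    | (refine absurd huvw (hneg _ ?_); ring1)
    | (refine ⟨.inr (0, e), ?_⟩; simp [fermatPoint, evenSigns]; done)
    | (refine ⟨.inr (1, e), ?_⟩; simp [fermatPoint, evenSigns]; done)
    | (refine ⟨.inr (2, e), ?_⟩; simp [fermatPoint, evenSigns]; done)
    | (refine ⟨.inr (3, e), ?_⟩; simp [fermatPoint, evenSigns])

lemma exists_gram_eq_of_surd {s : ℝ} (hs : s ^ 2 - 4 * s + 2 = 0) {σ : Fin 3 → ℝ}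
    (h0 : σ 1 * σ 2 = σ 0) (h1 : σ 0 * σ 2 = σ 1) (h2 : σ 0 * σ 1 = σ 2) (hσ : ∀ i, σ i ^ 2 = 1) :
    ∃ d p, gram d p =
      fermatGram ![1 - s, 1 - s, 1 - s, s * σ 0, s * σ 1, s * σ 2] := by
  refine ⟨![(7 - 2 * s) / 3, (2 - s) / 4, (2 - s) / 12],
    ![![2 * s - 1, 2 * s - 1, 2 * s - 1, -(s * σ 0), -(s * σ 1), -(s * σ 2)],
      ![2 - s, -(2 - s), 0, -(s * σ 0), s * σ 1, 0],
      ![2 - s, 2 - s, -2 * (2 - s), -(s * σ 0), -(s * σ 1), 2 * (s * σ 2)]], ?_⟩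
  have hs0 := hσ 0
  have hs1 := hσ 1
  have hs2 := hσ 2
  generalize σ 0 = x at *
  generalize σ 1 = y at *
  generalize σ 2 = z at *
  ext j k
  rw [gram_apply]
  fin_cases j <;> fin_cases k <;> simp [fermatGram] <;> grind

lemma exists_gram_eq_of_sq_eq_one {x : ℝ} (hx : x ^ 2 = 1) :
    (∃ d p, gram d p = fermatGram ![x, 0, 0, 0, 0, 0]) ∧
    (∃ d p, gram d p = fermatGram ![0, x, 0, 0, 0, 0]) ∧
    (∃ d p, gram d p = fermatGram ![0, 0, x, 0, 0, 0]) := by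
  refine ⟨⟨![1, 1, 2 * x], ![![1, 0, 0, 0, 0, 0], ![0, 1, -x, 0, 0, 0], ![0, 0, 0, 1, 0, 0]], ?_⟩,
    ⟨![1, 1, 2 * x], ![![0, 1, 0, 0, 0, 0], ![1, 0, -x, 0, 0, 0], ![0, 0, 0, 0, 1, 0]], ?_⟩,
    ⟨![1, 1, 2 * x], ![![0, 0, 1, 0, 0, 0], ![1, -x, 0, 0, 0, 0], ![0, 0, 0, 0, 0, 1]], ?_⟩⟩ <;>
  · ext j k
    rw [gram_apply]
    fin_cases j <;> fin_cases k <;> simp [fermatGram] <;> linear_combination hx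

lemma exists_gram_eq_fermatPoint (i : Fin 7 ⊕ Fin 4 × Fin 2) :
    ∃ d p, gram d p = fermatGram (fermatPoint i) := by
  have h1 := exists_gram_eq_of_sq_eq_one (x := 1) (by norm_num)
  have h2 := exists_gram_eq_of_sq_eq_one (x := -1) (by norm_num)
  rcases i with n | ⟨i, e⟩
  · fin_cases n
    · refine ⟨![1, 1, 1], ![![1, 0, 0, 0, 0, 0], ![0, 1, 0, 0, 0, 0], ![0, 0, 1, 0, 0, 0]], ?_⟩
      ext j k
      rw [gram_apply]
      fin_cases j <;> fin_cases k <;> simp [fermatGram, fermatPoint]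
    exacts [h1.1, h2.1, h1.2.1, h2.2.1, h1.2.2, h2.2.2]
  · exact exists_gram_eq_of_surd (surd_sq e) (by fin_cases i <;> simp [evenSigns])
      (by fin_cases i <;> simp [evenSigns]) (by fin_cases i <;> simp [evenSigns])
      (by intro j; fin_cases i <;> fin_cases j <;> simp [evenSigns])

lemma exists_isSign_gram (d : Fin 3 → ℝ) (p : Fin 3 → ConicCoeffs) :
    ∃ s, IsSign s ∧ gram s (fun i => √|d i| • p i) = gram d p := by
  refine ⟨fun i => if d i < 0 then -1 else 1, fun i => ?_, ?_⟩
  · dsimp only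
    split_ifs <;> simp
  · have key : ∀ i, (if d i < 0 then (-1 : ℝ) else 1) * (√|d i| * √|d i|) = d i := fun i => by
      rw [Real.mul_self_sqrt (abs_nonneg _)]
      split_ifs with h
      · rw [abs_of_neg h]; ring
      · rw [abs_of_nonneg (not_lt.1 h)]; ring
    ext j k
    simp only [gram_apply, Pi.smul_apply, smul_eq_mul]
    linear_combination p 0 j * p 0 k * key 0 + p 1 j * p 1 k * key 1 + p 2 j * p 2 k * key 2

lemma fermatGram_injective : Function.Injective fermatGram := by
  intro t t' h
  have h' := fun j k => congrFun (congrFun h j) k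
  have h0 := h' 3 3
  have h1 := h' 4 4
  have h2 := h' 5 5
  have h3 := h' 4 5
  have h4 := h' 3 5
  have h5 := h' 3 4
  simp [fermatGram] at h0 h1 h2 h3 h4 h5
  ext j
  fin_cases j <;> simp [*]

lemma eval_quarticPoly_fermat (x : Fin 3 → ℝ) :
    eval x (quarticPoly fermat) = x 0 ^ 4 + x 1 ^ 4 + x 2 ^ 4 := by
  simp [quarticPoly_eq, fermat]

lemma isSmoothPositive_fermat : IsSmoothPositive fermat where
  pos x hx := by
    rw [eval_quarticPoly_fermat]
    by_contra! h
    have h0 : ∀ i, 0 ≤ x i ^ 4 := fun i => by positivity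
    refine hx (funext fun i => pow_eq_zero_iff (n := 4) (by norm_num) |>.1 ?_)
    fin_cases i <;> dsimp only [Fin.zero_eta, Fin.mk_one, Fin.reduceFinMk] <;>
      linarith [h0 0, h0 1, h0 2]
  smooth x hx := by
    by_contra! h
    refine hx (funext fun i => ?_)
    have := h i
    fin_cases i <;>
      simpa [aeval_pderiv_zero_quarticPoly, aeval_pderiv_one_quarticPoly,
        aeval_pderiv_two_quarticPoly, fermat] using this

lemma ncard_repSpans_fermat : (repSpans fermat).ncard = 15 := by
  have hex : ∀ i, ∃ s q, IsSign s ∧ gram s q = fermatGram (fermatPoint i) := fun i => by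
    obtain ⟨d, p, h⟩ := exists_gram_eq_fermatPoint i
    obtain ⟨s, hs, h'⟩ := exists_isSign_gram d p
    exact ⟨s, _, hs, h'.trans h⟩
  choose s q hs hq using hex
  have hrange : repSpans fermat = Set.range fun i => Submodule.span ℝ (Set.range (q i)) := by
    ext W
    constructor
    · rintro ⟨s', hs', p, hp, rfl⟩
      obtain ⟨t, ht⟩ := exists_gram_eq_fermatGram hp
      obtain ⟨i, rfl⟩ := exists_eq_fermatPoint fun r r' => ht ▸ det_submatrix_gram s' p r r'
      have li : ∀ {s p}, squareSum s p = fermat → LinearIndependent ℝ p := fun h =>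
        linearIndependent_of_surjective (IsSmoothPositive.surjective_combine
          (h ▸ isSmoothPositive_fermat))
      exact ⟨i, le_antisymm
        (span_le_of_gram_eq (hs i).ne_zero (li (squareSum_eq_fermat (hq i)))
          ((hq i).trans ht.symm))
        (span_le_of_gram_eq hs'.ne_zero (li hp) (ht.trans (hq i).symm))⟩
    · rintro ⟨i, rfl⟩
      exact ⟨s i, hs i, q i, squareSum_eq_fermat (hq i), rfl⟩
  have hinj : Function.Injective fun i => Submodule.span ℝ (Set.range (q i)) := fun i j hij => by
    have hi := squareSum_eq_fermat (hq i)
    have hj := squareSum_eq_fermat (hq j)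
    refine fermatPoint_injective (fermatGram_injective ?_)
    rw [← hq, ← hq]
    exact gram_eq_of_span_eq (hi ▸ isSmoothPositive_fermat) (hi.trans hj.symm) hij
  rw [hrange, Set.ncard, Set.encard, ← Set.image_univ, ← Set.encard, ← Set.ncard,
    Set.ncard_image_of_injective _ hinj]
  simp [Set.ncard_univ]

lemma hasDerivAt_eval_update {σ : Type*} [Finite σ] [DecidableEq σ] (p : MvPolynomial σ ℝ)
    (x : σ → ℝ) (i : σ) (t : ℝ) : HasDerivAt (fun t => eval (Function.update x i t) p)
      (eval (Function.update x i t) (pderiv i p)) t := by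
  cases nonempty_fintype σ
  induction p using MvPolynomial.induction_on with
  | C a => simpa using hasDerivAt_const t a
  | add p q hp hq =>
    simp only [map_add]
    exact hp.add hq
  | mul_X p j hp =>
    have hj := hasDerivAt_pi.1 (hasDerivAt_update x i t) j
    simp only [map_mul, eval_X, Derivation.leibniz, pderiv_X, smul_eq_mul, map_add]
    refine (hp.mul hj).congr_deriv ?_
    rw [add_comm]
    rcases eq_or_ne j i with rfl | hij
    · simp [mul_comm]
    · simp [hij, mul_comm]

/-- At a zero of a nonnegative polynomial the gradient vanishes. -/
lemma eval_pderiv_eq_zero {σ : Type*} [Finite σ] {p : MvPolynomial σ ℝ}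
    (hp : ∀ x : σ → ℝ, 0 ≤ eval x p) {x : σ → ℝ} (hx : eval x p = 0) (i : σ) :
    eval x (pderiv i p) = 0 := by
  classical
  have h := hasDerivAt_eval_update p x i (x i)
  have hmin : IsLocalMin (fun t => eval (Function.update x i t) p) (x i) :=
    Filter.Eventually.of_forall fun t => by
      simpa only [Function.update_eq_self, hx] using hp _
  simpa using hmin.hasDerivAt_eq_zero h

lemma four_mul_aeval_quarticPoly (c : QuarticCoeffs) (x : Fin 3 → ℂ) :
    4 * aeval x (quarticPoly c) = ∑ i, x i * aeval x (pderiv i (quarticPoly c)) := by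
  rw [Fin.sum_univ_three, aeval_pderiv_zero_quarticPoly, aeval_pderiv_one_quarticPoly,
    aeval_pderiv_two_quarticPoly]
  simp [quarticPoly_eq]
  ring

lemma isSmoothPositive_of_nonneg {c : QuarticCoeffs}
    (hnn : ∀ x : Fin 3 → ℝ, 0 ≤ eval x (quarticPoly c))
    (hsmooth : ∀ x : Fin 3 → ℂ, x ≠ 0 → eval x (map (algebraMap ℝ ℂ) (quarticPoly c)) = 0 →
      ∃ i, eval x (pderiv i (map (algebraMap ℝ ℂ) (quarticPoly c))) ≠ 0) :
    IsSmoothPositive c := by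
  have hsmooth' : ∀ x : Fin 3 → ℂ, x ≠ 0 → ∃ i, aeval x (pderiv i (quarticPoly c)) ≠ 0 := by
    intro x hx
    by_contra! h
    have h4 := four_mul_aeval_quarticPoly c x
    simp only [h, mul_zero, Finset.sum_const_zero] at h4
    obtain ⟨i, hi⟩ := hsmooth x hx (by
      rw [eval_map, ← aeval_def]
      exact (mul_eq_zero.1 h4).resolve_left (by norm_num))
    rw [pderiv_map, eval_map, ← aeval_def] at hi
    exact hi (h i)
  refine ⟨fun x hx => (hnn x).lt_of_ne' fun h => ?_, hsmooth'⟩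
  obtain ⟨i, hi⟩ := hsmooth' (fun j => algebraMap ℝ ℂ (x j)) fun h0 => hx (funext fun j => by
    simpa using congrFun h0 j)
  refine hi ?_
  have := eval_pderiv_eq_zero hnn h i
  rw [← Function.comp_def, aeval_algebraMap_apply, aeval_eq_eval, this, map_zero]

lemma range_span_eq_image_repSpans (c : QuarticCoeffs) :
    (Set.range fun t : SignedQuadRep (quarticPoly c) =>
      Submodule.span ℝ ({t.1.2.1, t.1.2.2.1, t.1.2.2.2} : Set (MvPolynomial (Fin 3) ℝ))) =
      Submodule.map conicPoly '' repSpans c := by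
  have hspan : ∀ p : Fin 3 → ConicCoeffs,
      Submodule.map conicPoly (Submodule.span ℝ (Set.range p)) =
        Submodule.span ℝ {conicPoly (p 0), conicPoly (p 1), conicPoly (p 2)} := fun p => by
    rw [Submodule.map_span, ← Set.range_comp]
    congr 1
    ext y
    simp [Fin.exists_fin_succ, eq_comm]
  ext W
  constructor
  · rintro ⟨⟨⟨⟨s₀, s₁, s₂⟩, p₀, p₁, p₂⟩, h₀, h₁, h₂, hp₀, hp₁, hp₂, h⟩, rfl⟩
    dsimp only at h₀ h₁ h₂ hp₀ hp₁ hp₂ h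
    obtain ⟨q₀, rfl⟩ := exists_conicPoly_eq hp₀
    obtain ⟨q₁, rfl⟩ := exists_conicPoly_eq hp₁
    obtain ⟨q₂, rfl⟩ := exists_conicPoly_eq hp₂
    refine ⟨_, ⟨![s₀, s₁, s₂], ?_, ![q₀, q₁, q₂], ?_, rfl⟩, hspan _⟩
    · intro i
      fin_cases i <;> assumption
    · refine quarticPoly_injective ?_
      rw [quarticPoly_squareSum, Fin.sum_univ_three, h]
      rfl
  · rintro ⟨_, ⟨s, hs, p, rfl, rfl⟩, rfl⟩
    refine ⟨⟨⟨⟨s 0, s 1, s 2⟩, conicPoly (p 0), conicPoly (p 1), conicPoly (p 2)⟩, hs 0, hs 1,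
      hs 2, isHomogeneous_conicPoly _, isHomogeneous_conicPoly _, isHomogeneous_conicPoly _, ?_⟩,
      (hspan p).symm⟩
    rw [quarticPoly_squareSum, Fin.sum_univ_three]

end

end TernaryQuartic

/-- A non-negative real ternary quartic form defining a smooth complex plane curve
has exactly 15 inequivalent signed quadratic representations. -/
theorem fifteen_signed_quadratic_representations
    (f : MvPolynomial (Fin 3) ℝ)
    (hf : f.IsHomogeneous 4)
    (hnn : ∀ x : Fin 3 → ℝ, 0 ≤ MvPolynomial.eval x f)
    (hsmooth : ∀ x : Fin 3 → ℂ, x ≠ 0 →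
      MvPolynomial.eval x (MvPolynomial.map (algebraMap ℝ ℂ) f) = 0 →
      ∃ i : Fin 3,
        MvPolynomial.eval x (MvPolynomial.pderiv i (MvPolynomial.map (algebraMap ℝ ℂ) f)) ≠ 0) :
    Nat.card (Quotient (SignedQuadRepSetoid f)) = 15 := by
  obtain ⟨c, rfl⟩ := TernaryQuartic.exists_quarticPoly_eq hf
  have hc := TernaryQuartic.isSmoothPositive_of_nonneg hnn hsmooth
  rw [SignedQuadRepSetoid, Nat.card_congr (Setoid.quotientKerEquivRange _),
    TernaryQuartic.range_span_eq_image_repSpans, Nat.card_coe_set_eq,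
    Set.ncard_image_of_injective _
      (Submodule.map_injective_of_injective TernaryQuartic.conicPoly_injective),
    TernaryQuartic.ncard_repSpans_eq hc TernaryQuartic.isSmoothPositive_fermat,
    TernaryQuartic.ncard_repSpans_fermat]
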